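/- arXiv:2602.06304 — 4 statements merged into one kernel-verified Lean document; each statement's English description precedes it below -/
import Mathlib

section
/- For every integer r ≥ 1, every real a with 0 < a ≤ 1, and every s ∈ ℂ with Re(s) > r, the r-fold series Σ_{m_1,…,m_r ≥ 0} (a + m_1 + ⋯ + m_r)^{−s} converges absolutely and equals Σ_{j=0}^{r−1} p_{r,j}(a) ζ_H(s−j, a). -/
open Complex Filter Finset MeasureTheory

/-- The Hurwitz zeta function `ζ_H(s,a)` (meromorphic continuation of
`∑ m, (m+a)^{-s}`). -/
noncomputable def hzeta (a : ℝ) (s : ℂ) : ℂ := HurwitzZeta.hurwitzZeta (a : UnitAddCircle) s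

/-- `p_{r,j}(a)`: the coefficient of `X^j` in `(1/(r-1)!) ∏_{i=1}^{r-1} (X + i - a)`. -/
noncomputable def pCoeff (r : ℕ) (a : ℝ) (j : ℕ) : ℝ :=
  ((Nat.factorial (r - 1) : ℝ)⁻¹ •
    ∏ i ∈ Finset.range (r - 1), (Polynomial.X + Polynomial.C ((i : ℝ) + 1 - a))).coeff j

/-- The Hurwitz multiple zeta function `ζ_r(s,a,𝟏) = ∑_{j=0}^{r-1} p_{r,j}(a) ζ_H(s-j,a)`. -/
noncomputable def zetaR (r : ℕ) (a : ℝ) (s : ℂ) : ℂ :=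
  ∑ j ∈ Finset.range r, (pCoeff r a j : ℂ) * hzeta a (s - j)

theorem card_antidiagonalTuple_succ (k n : ℕ) :
    (Finset.Nat.antidiagonalTuple (k + 1) n).card = (n + k).choose k := by
  change (List.Nat.antidiagonalTuple (k + 1) n).length = _
  induction k generalizing n with
  | zero => simp
  | succ k ih =>
    rw [List.Nat.antidiagonalTuple, List.length_flatMap]
    simp only [List.length_map, ih]
    change ∑ p ∈ Finset.HasAntidiagonal.antidiagonal n, (p.2 + k).choose k = _
    rw [Finset.Nat.sum_antidiagonal_eq_sum_range_succ (fun _ j => (j + k).choose k) n,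
      ← Finset.sum_range_reflect, ← add_assoc n k 1, ← Nat.sum_range_add_choose n k]
    refine Finset.sum_congr rfl fun i hi => ?_
    have := Finset.mem_range.1 hi
    congr 2
    omega

theorem sum_pCoeff_mul_pow (k : ℕ) (a : ℝ) (n : ℕ) :
    ∑ j ∈ Finset.range (k + 1), pCoeff (k + 1) a j * ((n : ℝ) + a) ^ j =
      ((n + k).choose k : ℝ) := by
  set p : Polynomial ℝ := (Nat.factorial k : ℝ)⁻¹ •
    ∏ i ∈ Finset.range k, (Polynomial.X + Polynomial.C ((i : ℝ) + 1 - a)) with hp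
  have hdeg : p.natDegree < k + 1 := by
    refine Nat.lt_succ_of_le ((Polynomial.natDegree_smul_le _ _).trans ?_)
    refine (Polynomial.natDegree_prod_le _ _).trans ?_
    simp only [Polynomial.natDegree_X_add_C, Finset.sum_const, Finset.card_range, smul_eq_mul,
      mul_one, le_refl]
  have h := Polynomial.eval_eq_sum_range' hdeg ((n : ℝ) + a)
  change ∑ j ∈ Finset.range (k + 1), p.coeff j * ((n : ℝ) + a) ^ j = _
  rw [← h, hp, Polynomial.eval_smul, Polynomial.eval_prod, smul_eq_mul,
    inv_mul_eq_iff_eq_mul₀ (by positivity)]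
  have hasc := Nat.ascFactorial_eq_factorial_mul_choose n k
  rw [Nat.ascFactorial_eq_prod_range] at hasc
  have hasc' := congrArg (Nat.cast : ℕ → ℝ) hasc
  push_cast at hasc'
  rw [← hasc']
  refine Finset.prod_congr rfl fun i _ => ?_
  simp only [Polynomial.eval_add, Polynomial.eval_X, Polynomial.eval_C]
  ring

theorem hasSum_choose_mul_cpow (k : ℕ) {a : ℝ} (ha : 0 < a) (ha1 : a ≤ 1) {s : ℂ}
    (hs : (k : ℝ) + 1 < s.re) :
    HasSum (fun n : ℕ => ((n + k).choose k : ℂ) * ((a : ℂ) + n) ^ (-s)) (zetaR (k + 1) a s) := by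
  have hj : ∀ j ∈ Finset.range (k + 1), HasSum
      (fun n : ℕ => (pCoeff (k + 1) a j : ℂ) * (1 / ((n : ℂ) + a) ^ (s - j)))
      ((pCoeff (k + 1) a j : ℂ) * hzeta a (s - j)) := by
    intro j hj
    refine (HurwitzZeta.hasSum_hurwitzZeta_of_one_lt_re ⟨ha.le, ha1⟩ ?_).mul_left _
    have hjk : (j : ℝ) ≤ k := by exact_mod_cast Nat.lt_succ_iff.1 (Finset.mem_range.1 hj)
    simp only [Complex.sub_re, Complex.natCast_re]
    linarith
  refine (hasSum_sum hj).congr_fun ?_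
  intro n
  have hne : (n : ℂ) + a ≠ 0 := by
    have : ((n : ℝ) + a) ≠ 0 := by positivity
    exact_mod_cast this
  have hchoose := congrArg (fun x : ℝ => (x : ℂ)) (sum_pCoeff_mul_pow k a n)
  push_cast at hchoose
  rw [← hchoose, Finset.sum_mul]
  refine Finset.sum_congr rfl fun j _ => ?_
  rw [one_div, ← Complex.cpow_neg, neg_sub, sub_eq_add_neg, Complex.cpow_add _ _ hne,
    Complex.cpow_natCast, add_comm (a : ℂ), mul_assoc]

theorem stmt0 (r : ℕ) (hr : 1 ≤ r) (a : ℝ) (ha : 0 < a) (ha1 : a ≤ 1)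
    (s : ℂ) (hs : (r : ℝ) < s.re) :
    Summable (fun m : Fin r → ℕ => ‖((a : ℂ) + ∑ i, (m i : ℂ)) ^ (-s)‖) ∧
    ∑' m : Fin r → ℕ, ((a : ℂ) + ∑ i, (m i : ℂ)) ^ (-s) = zetaR r a s := by
  obtain ⟨k, rfl⟩ : ∃ k, r = k + 1 := ⟨r - 1, by omega⟩
  have hsum := hasSum_choose_mul_cpow k ha ha1 (s := s) (by exact_mod_cast hs)
  let e := Finset.Nat.sigmaAntidiagonalTupleEquivTuple (k + 1)
  have he : ∀ x, (a : ℂ) + ∑ i, (e x i : ℂ) = (a : ℂ) + x.1 := by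
    rintro ⟨n, m, hm⟩
    have := Finset.Nat.mem_antidiagonalTuple.1 hm
    change (a : ℂ) + ∑ i, (m i : ℂ) = a + (n : ℂ)
    rw [← this, Nat.cast_sum]
  have hnorm : Summable (fun m : Fin (k + 1) → ℕ => ‖((a : ℂ) + ∑ i, (m i : ℂ)) ^ (-s)‖) := by
    rw [← e.summable_iff]
    simp only [Function.comp_def, he]
    refine (summable_sigma_of_nonneg fun _ => norm_nonneg _).2 ⟨fun n => Summable.of_finite, ?_⟩
    refine hsum.summable.norm.congr fun n => ?_
    simp [card_antidiagonalTuple_succ]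
  refine ⟨hnorm, ?_⟩
  have hsumm := e.summable_iff.2 hnorm.of_norm
  rw [← e.tsum_eq]
  simp only [Function.comp_def, he] at hsumm ⊢
  rw [hsumm.tsum_sigma' fun n => Summable.of_finite, ← hsum.tsum_eq]
  refine tsum_congr fun n => ?_
  simp [card_antidiagonalTuple_succ]
end

section
/- Let r ≥ 1 be an integer and 0 < a ≤ 1. Then for s = σ + it with t ≥ 2 the following uniform bounds hold as t → ∞, with implied constants depending only on a, r and σ: (i) if σ > r then ζ_r(σ+it, a, 𝟏) ≪ 1; (ii) if r−1 < σ ≤ r then ζ_r(σ+it, a, 𝟏) ≪ t^{(r−σ)/2} log t; (iii) if σ ≤ r−1 then ζ_r(σ+it, a, 𝟏) ≪ t^{r−σ−1/2} log t. -/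
open Complex Filter Finset MeasureTheory

/-- Phragmén–Lindelöf in a vertical strip of width less than `π`, for functions of at most
exponential growth. -/
lemma norm_le_of_strip_of_exp_growth {f : ℂ → ℂ} {a b C A B : ℝ}
    (hf : ∀ z : ℂ, a ≤ z.re → DifferentiableAt ℂ f z) (hab : a < b) (hπ : b - a < Real.pi)
    (hgr : ∀ z : ℂ, a < z.re → z.re < b → 1 ≤ |z.im| → ‖f z‖ ≤ Real.exp (A + B * |z.im|))
    (hla : ∀ z : ℂ, z.re = a → ‖f z‖ ≤ C) (hlb : ∀ z : ℂ, z.re = b → ‖f z‖ ≤ C)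
    {z : ℂ} (hza : a ≤ z.re) (hzb : z.re ≤ b) : ‖f z‖ ≤ C := by
  have hd : DiffContOnCl ℂ f (re ⁻¹' Set.Ioo a b) := by
    refine DifferentiableOn.diffContOnCl fun w hw => (hf w ?_).differentiableWithinAt
    have hsub : closure (re ⁻¹' Set.Ioo a b) ⊆ {w : ℂ | a ≤ w.re} :=
      closure_minimal (fun w hw => hw.1.le) (isClosed_le continuous_const continuous_re)
    exact hsub hw
  refine PhragmenLindelof.vertical_strip hd ?_ hla hlb hza hzb
  refine ⟨1, by rw [lt_div_iff₀ (by linarith)]; linarith, |A| + |B|, ?_⟩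
  refine Asymptotics.IsBigO.of_bound 1 ?_
  have h1 : ∀ᶠ z : ℂ in comap (_root_.abs ∘ im) atTop ⊓ 𝓟 (re ⁻¹' Set.Ioo a b),
      1 ≤ |z.im| :=
    (tendsto_comap.eventually (eventually_ge_atTop (1 : ℝ))).filter_mono inf_le_left
  have h2 : ∀ᶠ z : ℂ in comap (_root_.abs ∘ im) atTop ⊓ 𝓟 (re ⁻¹' Set.Ioo a b),
      z ∈ re ⁻¹' Set.Ioo a b := mem_inf_of_right (mem_principal_self _)
  filter_upwards [h1, h2] with z hz1 hz2
  refine (hgr z hz2.1 hz2.2 hz1).trans ?_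
  rw [one_mul, Real.norm_eq_abs, Real.abs_exp, one_mul]
  refine Real.exp_le_exp.mpr ?_
  have h3 : |z.im| + 1 ≤ Real.exp |z.im| := Real.add_one_le_exp _
  nlinarith [le_abs_self A, le_abs_self B, abs_nonneg A, abs_nonneg B, abs_nonneg z.im]

lemma norm_Gamma_le_Gamma_re {s : ℂ} (hs : 0 < s.re) : ‖Gamma s‖ ≤ Real.Gamma s.re := by
  rw [Gamma_eq_integral hs, Real.Gamma_eq_integral hs, GammaIntegral]
  refine (norm_integral_le_integral_norm _).trans (le_of_eq ?_)
  refine setIntegral_congr_fun measurableSet_Ioi fun x hx => ?_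
  simp only [norm_mul, norm_cpow_eq_rpow_re_of_pos hx, sub_re, one_re, norm_real, Real.norm_eq_abs,
    Real.abs_exp]

lemma norm_Gamma_half_add_mul_I_le (t : ℝ) :
    ‖Gamma (1 / 2 + t * I)‖ ≤ 3 * Real.exp (-(Real.pi * |t| / 2)) := by
  have hconj : (1 : ℂ) - (1 / 2 + t * I) = (starRingEnd ℂ) (1 / 2 + t * I) := by
    simp [Complex.ext_iff]; norm_num
  have h := Gamma_mul_Gamma_one_sub (1 / 2 + t * I)
  rw [hconj, Gamma_conj, mul_conj, show (Real.pi : ℂ) * (1 / 2 + t * I) =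
    ((Real.pi * t : ℝ) : ℂ) * I + Real.pi / 2 by push_cast; ring, sin_add_pi_div_two, cos_mul_I,
    ← ofReal_cosh, ← ofReal_div, ofReal_inj, normSq_eq_norm_sq] at h
  have hc : Real.exp (Real.pi * |t|) / 2 ≤ Real.cosh (Real.pi * t) := by
    rw [← Real.cosh_abs, abs_mul, abs_of_pos Real.pi_pos, Real.cosh_eq]
    linarith [Real.exp_pos (-(Real.pi * |t|))]
  have h4 : ‖Gamma (1 / 2 + t * I)‖ ^ 2 ≤ (3 * Real.exp (-(Real.pi * |t| / 2))) ^ 2 := by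
    rw [h, mul_pow, ← Real.exp_nat_mul, div_le_iff₀ (Real.cosh_pos _)]
    have h5 : Real.exp (((2 : ℕ) : ℝ) * -(Real.pi * |t| / 2)) * Real.exp (Real.pi * |t|) = 1 := by
      rw [← Real.exp_add, ← Real.exp_zero]; congr 1; push_cast; ring
    have := Real.exp_pos (((2 : ℕ) : ℝ) * -(Real.pi * |t| / 2))
    nlinarith [Real.pi_lt_four, mul_le_mul_of_nonneg_left hc this.le]
  exact (sq_le_sq₀ (norm_nonneg _) (by positivity)).mp h4

/-- The Gaussian absorbs the linear growth of a shift. -/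
lemma one_add_abs_mul_exp_neg_sq_le (u : ℝ) : (1 + |u|) * Real.exp (-u ^ 2) ≤ 2 := by
  have h := Real.add_one_le_exp (u ^ 2)
  have h2 : Real.exp (-u ^ 2) * Real.exp (u ^ 2) = 1 := by rw [← Real.exp_add]; simp
  have h3 := Real.exp_pos (-u ^ 2)
  have h4 : 1 + |u| ≤ 2 * (u ^ 2 + 1) := by nlinarith [sq_abs u, sq_nonneg (|u| - 1)]
  nlinarith [mul_le_mul_of_nonneg_left h h3.le, mul_le_mul_of_nonneg_right h4 h3.le]

lemma one_add_abs_le_mul (y t : ℝ) : 1 + |y| ≤ (1 + |t|) * (1 + |y - t|) := by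
  have : |y| ≤ |y - t| + |t| := by simpa using abs_add_le (y - t) t
  nlinarith [abs_nonneg t, abs_nonneg (y - t), mul_nonneg (abs_nonneg t) (abs_nonneg (y - t))]

lemma norm_Gamma_three_halves_le (z : ℂ) (hz : z.re = 3 / 2) :
    ‖Gamma z‖ ≤ 3 * (1 + |z.im|) * Real.exp (-(Real.pi * |z.im| / 2)) := by
  have hz' : z = (1 / 2 + z.im * I) + 1 := by
    apply Complex.ext <;> simp [hz]; norm_num
  have h0 : (1 / 2 + z.im * I : ℂ) ≠ 0 := by
    intro h; have := congrArg re h; norm_num at this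
  have h1 : ‖(1 / 2 + z.im * I : ℂ)‖ ≤ 1 + |z.im| := by
    refine (norm_add_le _ _).trans ?_
    simp only [norm_mul, norm_I, norm_real, mul_one, Real.norm_eq_abs]; norm_num
  rw [show Gamma z = Gamma ((1 / 2 + z.im * I) + 1) by rw [← hz'], Gamma_add_one _ h0, norm_mul]
  calc _ ≤ (1 + |z.im|) * (3 * Real.exp (-(Real.pi * |z.im| / 2))) := by
        gcongr; exact norm_Gamma_half_add_mul_I_le _
    _ = _ := by ring

lemma exists_Gamma_re_le : ∃ M : ℝ, 0 < M ∧ ∀ x : ℝ, 1 / 2 ≤ x → x ≤ 4 → Real.Gamma x ≤ M := by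
  have hc : ContinuousOn Real.Gamma (Set.Icc (1 / 2) 4) := fun x hx =>
    (Real.differentiableAt_Gamma fun m => by
      have := hx.1; have : (0 : ℝ) ≤ m := m.cast_nonneg; linarith).continuousAt.continuousWithinAt
  obtain ⟨M, hM⟩ := (isCompact_Icc.image_of_continuousOn hc).bddAbove
  refine ⟨max M 1, by positivity, fun x h1 h2 => (hM ⟨x, ⟨h1, h2⟩, rfl⟩).trans (le_max_left _ _)⟩

lemma exists_norm_Gamma_le_of_nonneg : ∃ C : ℝ, 0 < C ∧ ∀ x t : ℝ, 1 / 2 ≤ x → x ≤ 3 / 2 → 0 ≤ t →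
    ‖Gamma (x + t * I)‖ ≤ C * (1 + t) ^ (x - 1 / 2) * Real.exp (-(Real.pi * t / 2)) := by
  obtain ⟨M, hM0, hM⟩ := exists_Gamma_re_le
  refine ⟨6 * Real.exp (9 / 4), by positivity, fun x t hx1 hx2 ht => ?_⟩
  set L := Real.log (1 + t) with hL
  have hT : 0 < 1 + t := by linarith
  have hL0 : 0 ≤ L := Real.log_nonneg (by linarith)
  have hTL : Real.exp L = 1 + t := Real.exp_log hT
  let E : ℂ → ℂ := fun s => -(I * Real.pi * s / 2) + (s - t * I) ^ 2 - (s - 1 / 2) * L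
  have hE (s : ℂ) : ‖exp (E s)‖ = Real.exp (Real.pi * s.im / 2 + s.re ^ 2 - (s.im - t) ^ 2
      - (s.re - 1 / 2) * L) := by
    rw [norm_exp]; congr 1
    simp [E, pow_two, div_eq_mul_inv]
    norm_num
    ring
  have key : ‖Gamma (x + t * I) * exp (E (x + t * I))‖ ≤ 6 * Real.exp (9 / 4) := by
    refine norm_le_of_strip_of_exp_growth (f := fun s => Gamma s * exp (E s)) (a := 1 / 2)
      (b := 3 / 2) (A := Real.log M + 9 / 4) (B := 2) ?_ (by norm_num)
      (by linarith [Real.pi_gt_three]) ?_ ?_ ?_ (by simpa using hx1) (by simpa using hx2)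
    · intro z hz
      refine DifferentiableAt.mul (differentiableAt_Gamma _ fun m h => ?_) (by fun_prop)
      have := congrArg re h
      simp only [neg_re, natCast_re] at this
      have : (0 : ℝ) ≤ m := m.cast_nonneg
      linarith
    · intro z hz1 hz2 _
      rw [norm_mul, hE]
      have h1 := (norm_Gamma_le_Gamma_re (by linarith : 0 < z.re)).trans
        (hM z.re hz1.le (by linarith))
      rw [add_assoc, Real.exp_add, Real.exp_log hM0]
      gcongr
      nlinarith [Real.pi_lt_four, le_abs_self z.im, abs_nonneg z.im, Real.pi_pos,
        mul_nonneg (by linarith : 0 ≤ z.re - 1 / 2) hL0, sq_nonneg (z.im - t)]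
    · intro z hz
      rw [norm_mul, hE, hz]
      have h1 := norm_Gamma_half_add_mul_I_le z.im
      have hz' : (1 / 2 + z.im * I : ℂ) = z := by apply Complex.ext <;> simp [hz]
      rw [hz'] at h1
      calc _ ≤ 3 * Real.exp (-(Real.pi * |z.im| / 2)) * Real.exp (Real.pi * z.im / 2 +
            (1 / 2) ^ 2 - (z.im - t) ^ 2 - (1 / 2 - 1 / 2) * L) := by gcongr
        _ = 3 * Real.exp (-(Real.pi * |z.im| / 2) + (Real.pi * z.im / 2 +
            (1 / 2) ^ 2 - (z.im - t) ^ 2 - (1 / 2 - 1 / 2) * L)) := by rw [Real.exp_add, mul_assoc]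
        _ ≤ 6 * Real.exp (9 / 4) := by
            gcongr
            · norm_num
            · nlinarith [Real.pi_pos, le_abs_self z.im, sq_nonneg (z.im - t)]
    · intro z hz
      rw [norm_mul, hE, hz]
      have h1 := norm_Gamma_three_halves_le z hz
      have h2 := one_add_abs_le_mul z.im t
      rw [abs_of_nonneg ht] at h2
      calc _ ≤ 3 * ((1 + t) * (1 + |z.im - t|)) * Real.exp (-(Real.pi * |z.im| / 2)) *
            Real.exp (Real.pi * z.im / 2 + (3 / 2) ^ 2 - (z.im - t) ^ 2 - (3 / 2 - 1 / 2) * L) := by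
            gcongr; exact h1.trans (by gcongr)
        _ ≤ 3 * ((1 + t) * (1 + |z.im - t|)) * Real.exp (-(Real.pi * |z.im| / 2)) *
            Real.exp (Real.pi * |z.im| / 2 + 9 / 4 + -(z.im - t) ^ 2 + -L) := by
            gcongr ?_ * Real.exp ?_
            nlinarith [Real.pi_pos, le_abs_self z.im]
        _ = 3 * Real.exp (9 / 4) * ((1 + |z.im - t|) * Real.exp (-(z.im - t) ^ 2)) *
            ((1 + t) * (Real.exp L)⁻¹) *
            (Real.exp (-(Real.pi * |z.im| / 2)) * Real.exp (Real.pi * |z.im| / 2)) := by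
            simp only [Real.exp_add, Real.exp_neg]; ring
        _ ≤ 3 * Real.exp (9 / 4) * 2 * 1 * 1 := by
            rw [hTL, mul_inv_cancel₀ hT.ne', ← Real.exp_add, neg_add_cancel, Real.exp_zero]
            gcongr
            exact one_add_abs_mul_exp_neg_sq_le _
        _ = _ := by ring
  rw [norm_mul, hE] at key
  simp only [add_re, ofReal_re, mul_re, I_re, mul_zero, ofReal_im, I_im, mul_one, sub_self,
    add_zero, add_im, mul_im, zero_add] at key
  rw [Real.rpow_def_of_pos hT, ← hL]
  have h3 : Real.exp (Real.pi * t / 2 - (x - 1 / 2) * L) ≤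
      Real.exp (Real.pi * t / 2 + x ^ 2 - 0 ^ 2 - (x - 1 / 2) * L) := by
    gcongr; nlinarith
  have h4 := (mul_le_mul_of_nonneg_left h3 (norm_nonneg (Gamma (x + t * I)))).trans key
  calc _ = ‖Gamma (x + t * I)‖ * Real.exp (Real.pi * t / 2 - (x - 1 / 2) * L) *
        Real.exp (-(Real.pi * t / 2 - (x - 1 / 2) * L)) := by
        rw [mul_assoc, ← Real.exp_add]; simp
    _ ≤ 6 * Real.exp (9 / 4) * Real.exp (-(Real.pi * t / 2 - (x - 1 / 2) * L)) := by gcongr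
    _ = _ := by rw [mul_assoc (6 * Real.exp (9 / 4)), ← Real.exp_add]; congr 2; ring

/-- Uniform upper Stirling bound in the strip `1/2 ≤ Re s ≤ 3/2`. -/
lemma exists_norm_Gamma_le : ∃ C : ℝ, 0 < C ∧ ∀ x t : ℝ, 1 / 2 ≤ x → x ≤ 3 / 2 →
    ‖Gamma (x + t * I)‖ ≤ C * (1 + |t|) ^ (x - 1 / 2) * Real.exp (-(Real.pi * |t| / 2)) := by
  obtain ⟨C, hC0, hC⟩ := exists_norm_Gamma_le_of_nonneg
  refine ⟨C, hC0, fun x t hx1 hx2 => ?_⟩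
  rcases le_total 0 t with ht | ht
  · rw [abs_of_nonneg ht]; exact hC x t hx1 hx2 ht
  · have h := hC x (-t) hx1 hx2 (by linarith)
    rw [show (x + ((-t : ℝ) : ℂ) * I : ℂ) = (starRingEnd ℂ) (x + t * I) by simp,
      Gamma_conj, norm_conj] at h
    rwa [abs_of_nonpos ht]

/-- Upper Stirling bound on a vertical line `Re s = x ≥ 1/2`. -/
lemma exists_norm_Gamma_vertical_le {x : ℝ} (hx : 1 / 2 ≤ x) : ∃ C : ℝ, 0 < C ∧ ∀ t : ℝ,
    ‖Gamma (x + t * I)‖ ≤ C * (1 + |t|) ^ (x - 1 / 2) * Real.exp (-(Real.pi * |t| / 2)) := by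
  obtain ⟨n, hn⟩ := exists_nat_ge (x - 3 / 2)
  induction n generalizing x with
  | zero =>
    obtain ⟨C, hC0, hC⟩ := exists_norm_Gamma_le
    exact ⟨C, hC0, fun t => hC x t hx (by simp at hn; linarith)⟩
  | succ n ih =>
    rcases le_total x (3 / 2) with h | h
    · obtain ⟨C, hC0, hC⟩ := exists_norm_Gamma_le
      exact ⟨C, hC0, fun t => hC x t hx h⟩
    obtain ⟨C, hC0, hC⟩ := ih (x := x - 1) (by linarith) (by push_cast at hn; linarith)
    refine ⟨x * C, by positivity, fun t => ?_⟩
    have h0 : ((x - 1 : ℝ) + t * I : ℂ) ≠ 0 := by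
      intro h'; have := congrArg re h'; simp at this; linarith
    have h1 : ‖((x - 1 : ℝ) + t * I : ℂ)‖ ≤ x * (1 + |t|) := by
      refine (norm_add_le _ _).trans ?_
      simp only [norm_mul, norm_I, norm_real, mul_one, Real.norm_eq_abs]
      rw [abs_of_nonneg (by linarith)]
      nlinarith [abs_nonneg t]
    rw [show (x + t * I : ℂ) = ((x - 1 : ℝ) + t * I) + 1 by push_cast; ring, Gamma_add_one _ h0,
      norm_mul, show x - 1 / 2 = 1 + (x - 1 - 1 / 2) by ring,
      Real.rpow_add (by positivity), Real.rpow_one]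
    calc _ ≤ (x * (1 + |t|)) * (C * (1 + |t|) ^ (x - 1 - 1 / 2) *
          Real.exp (-(Real.pi * |t| / 2))) := by gcongr; exact hC t
      _ = _ := by ring

lemma norm_cos_le_exp (z : ℂ) : ‖cos z‖ ≤ Real.exp |z.im| := by
  rw [Complex.cos, norm_div]
  have h1 : ‖exp (z * I)‖ ≤ Real.exp |z.im| := by
    rw [norm_exp]; gcongr; simpa using neg_le_abs z.im
  have h2 : ‖exp (-z * I)‖ ≤ Real.exp |z.im| := by
    rw [norm_exp]; gcongr; simpa using le_abs_self z.im
  have h3 := norm_add_le (exp (z * I)) (exp (-z * I))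
  rw [show ‖(2 : ℂ)‖ = 2 by simp]
  linarith

lemma exists_norm_Gammaℝ_inv_le : ∃ C : ℝ, 0 < C ∧ ∀ s : ℂ, -1 / 2 ≤ s.re → s.re ≤ 5 / 2 →
    1 ≤ |s.im| → ‖(Gammaℝ s)⁻¹‖ ≤ C * Real.exp (2 * |s.im|) := by
  obtain ⟨M, hM0, hM⟩ := exists_Gamma_re_le
  refine ⟨2 * Real.pi * M, by positivity, fun s h1 h2 h3 => ?_⟩
  have him : s.im ≠ 0 := by intro h; simp [h] at h3; linarith
  have h0 : 2 - s ≠ 0 := by intro h; apply him; simpa using congrArg im h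
  have hcos : cos (Real.pi * (s - 1) / 2) ≠ 0 := by
    rw [Complex.cos_ne_zero_iff]
    intro k h
    apply him
    have h' := congrArg im h
    have e1 : (Real.pi * (s - 1) / 2 : ℂ) = ((Real.pi / 2 : ℝ) : ℂ) * (s - 1) := by
      push_cast; ring
    have e2 : ((2 * k + 1) * Real.pi / 2 : ℂ) = (((2 * k + 1) * Real.pi / 2 : ℝ) : ℂ) := by
      push_cast; ring
    rw [e1, e2, ofReal_im, im_ofReal_mul] at h'
    simpa [Real.pi_ne_zero] using h'
  have hrefl := Gammaℝ_one_sub_mul_Gammaℝ_one_add (s - 1)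
  rw [show 1 - (s - 1) = 2 - s by ring, show 1 + (s - 1) = s by ring] at hrefl
  have htwo := Gammaℝ_add_two h0
  have hpi : (Real.pi : ℂ) ≠ 0 := ofReal_ne_zero.mpr Real.pi_ne_zero
  have hne : Gammaℝ s ≠ 0 := by
    intro h; rw [h, mul_zero] at hrefl; exact hcos (inv_eq_zero.mp hrefl.symm)
  have hform : (Gammaℝ s)⁻¹ = 2 * Real.pi * Gammaℝ (2 - s + 2) / (2 - s) *
      cos (Real.pi * (s - 1) / 2) := by
    rw [htwo]
    field_simp
    field_simp at hrefl
    linear_combination -hrefl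
  have hG : ‖Gammaℝ (2 - s + 2)‖ ≤ M := by
    rw [Gammaℝ_def, norm_mul, norm_cpow_eq_rpow_re_of_pos Real.pi_pos]
    have hre : ((2 - s + 2) / 2).re = (4 - s.re) / 2 := by simp; ring
    have hre' : (-(2 - s + 2) / 2).re = -((4 - s.re) / 2) := by simp; ring
    have hg := norm_Gamma_le_Gamma_re (s := (2 - s + 2) / 2) (by rw [hre]; linarith)
    rw [hre] at hg
    have hp : Real.pi ^ (-((4 - s.re) / 2)) ≤ 1 :=
      Real.rpow_le_one_of_one_le_of_nonpos (by linarith [Real.pi_gt_three]) (by linarith)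
    rw [hre', ← one_mul M]
    gcongr
    exact hg.trans (hM _ (by linarith) (by linarith))
  have hc : ‖cos (Real.pi * (s - 1) / 2)‖ ≤ Real.exp (2 * |s.im|) := by
    refine (norm_cos_le_exp _).trans ?_
    have e1 : (Real.pi * (s - 1) / 2 : ℂ) = ((Real.pi / 2 : ℝ) : ℂ) * (s - 1) := by
      push_cast; ring
    gcongr
    rw [e1, im_ofReal_mul, sub_im, one_im, sub_zero, abs_mul, abs_of_pos (by positivity)]
    gcongr
    linarith [Real.pi_lt_four]
  have hd : 1 ≤ ‖2 - s‖ := by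
    refine h3.trans ?_
    have := abs_im_le_norm (2 - s)
    simpa using this
  rw [hform, norm_mul, norm_div, norm_mul, norm_mul, norm_real, Real.norm_of_nonneg Real.pi_pos.le,
    show ‖(2 : ℂ)‖ = 2 by simp]
  gcongr
  refine (div_le_self (by positivity) hd).trans ?_
  gcongr

lemma WeakFEPair.exists_norm_mellin_le {P : WeakFEPair ℂ} (hP : IsStrongFEPair P) (α β : ℝ) :
    ∃ C : ℝ, 0 < C ∧ ∀ s : ℂ, α ≤ s.re → s.re ≤ β → ‖P.Λ s‖ ≤ C := by
  have hα := (hP.hasMellin (α : ℂ)).1.norm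
  have hβ := (hP.hasMellin (β : ℂ)).1.norm
  set J := ∫ t in Set.Ioi (0 : ℝ), (‖(t : ℂ) ^ ((α : ℂ) - 1) • P.f t‖ +
    ‖(t : ℂ) ^ ((β : ℂ) - 1) • P.f t‖) with hJ
  have hJ0 : 0 ≤ J := integral_nonneg fun t => by positivity
  refine ⟨J + 1, by linarith, fun s h1 h2 => ?_⟩
  rw [hP.Λ_eq, mellin]
  refine (norm_integral_le_integral_norm _).trans ?_
  refine le_trans ?_ (le_add_of_nonneg_right zero_le_one)
  refine setIntegral_mono_on (hP.hasMellin s).1.norm (hα.add hβ) measurableSet_Ioi fun t ht => ?_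
  have ht : 0 < t := ht
  simp only [norm_smul, norm_cpow_eq_rpow_re_of_pos ht, sub_re, one_re, ofReal_re]
  rw [← add_mul]
  gcongr
  rcases le_total t 1 with h | h
  · exact (Real.rpow_le_rpow_of_exponent_ge ht h (by linarith)).trans
      (le_add_of_nonneg_right (by positivity))
  · exact (Real.rpow_le_rpow_of_exponent_le h (by linarith)).trans
      (le_add_of_nonneg_left (by positivity))

open HurwitzZeta

lemma exists_norm_hurwitzZeta_le_exp (a : UnitAddCircle) : ∃ C : ℝ, 0 < C ∧ ∀ s : ℂ,
    -1 / 2 ≤ s.re → s.re ≤ 3 / 2 → 1 ≤ |s.im| → ‖hurwitzZeta a s‖ ≤ C * Real.exp (2 * |s.im|) := by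
  obtain ⟨G, hG0, hG⟩ := exists_norm_Gammaℝ_inv_le
  obtain ⟨A, hA0, hA⟩ := WeakFEPair.exists_norm_mellin_le
    (hurwitzEvenFEPair a).isStrongFEPair_toStrongFEPair (-1 / 4) (3 / 4)
  obtain ⟨B, hB0, hB⟩ := WeakFEPair.exists_norm_mellin_le
    (isStrong_hurwitzOddFEPair a) (1 / 4) (5 / 4)
  have hΛ : (hurwitzEvenFEPair a).toStrongFEPair.Λ = (hurwitzEvenFEPair a).Λ₀ :=
    (hurwitzEvenFEPair a).isStrongFEPair_toStrongFEPair.Λ_eq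
  rw [hΛ] at hA
  refine ⟨(A + 2 + B) * G, by positivity, fun s h1 h2 h3 => ?_⟩
  have him : s.im ≠ 0 := by intro h; simp [h] at h3; linarith
  have hs0 : s ≠ 0 := by rintro rfl; simp at him
  have hE : ‖completedHurwitzZetaEven a s‖ ≤ A + 2 := by
    rw [completedHurwitzZetaEven_eq]
    have e1 : ‖completedHurwitzZetaEven₀ a s‖ ≤ A := by
      rw [completedHurwitzZetaEven₀, norm_div, show ‖(2 : ℂ)‖ = 2 by simp]
      have := hA (s / 2) (by simp; linarith) (by simp; linarith)
      linarith [norm_nonneg ((hurwitzEvenFEPair a).Λ₀ (s / 2))]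
    have e2 : ‖(if a = 0 then 1 else 0 : ℂ) / s‖ ≤ 1 := by
      rw [norm_div]
      refine div_le_one_of_le₀ ?_ (norm_nonneg _)
      refine le_trans ?_ (h3.trans (abs_im_le_norm s))
      split_ifs <;> simp
    have e3 : ‖1 / (1 - s)‖ ≤ 1 := by
      rw [norm_div, norm_one]
      refine div_le_one_of_le₀ ?_ (norm_nonneg _)
      refine h3.trans ?_
      simpa using abs_im_le_norm (1 - s)
    have := norm_sub_le (completedHurwitzZetaEven₀ a s - (if a = 0 then 1 else 0) / s) (1 / (1 - s))
    have := norm_sub_le (completedHurwitzZetaEven₀ a s) ((if a = 0 then 1 else 0) / s)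
    linarith
  have hO : ‖completedHurwitzZetaOdd a s‖ ≤ B := by
    rw [completedHurwitzZetaOdd, norm_div, show ‖(2 : ℂ)‖ = 2 by simp]
    have := hB ((s + 1) / 2) (by simp; linarith) (by simp; linarith)
    linarith [norm_nonneg ((hurwitzOddFEPair a).Λ ((s + 1) / 2))]
  have g1 := hG s h1 (by linarith) h3
  have g2 := hG (s + 1) (by simp; linarith) (by simp; linarith) (by simpa using h3)
  rw [show (s + 1).im = s.im by simp] at g2
  rw [hurwitzZeta, hurwitzZetaEven_def_of_ne_or_ne (Or.inr hs0), hurwitzZetaOdd, div_eq_mul_inv,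
    div_eq_mul_inv]
  refine (norm_add_le _ _).trans ?_
  rw [norm_mul, norm_mul]
  calc _ ≤ (A + 2) * (G * Real.exp (2 * |s.im|)) + B * (G * Real.exp (2 * |s.im|)) := by gcongr
    _ = _ := by ring

/-- The entire function `(s - 1) ζ(s, a)`, with its correct value at `s = 1`. -/
noncomputable def hurwitzZetaMulSubOne (a : UnitAddCircle) (s : ℂ) : ℂ :=
  (s - 1) * (hurwitzZeta a s - 1 / (s - 1) / Gammaℝ s) + (Gammaℝ s)⁻¹

lemma hurwitzZetaMulSubOne_eq (a : UnitAddCircle) {s : ℂ} (hs : s ≠ 1) :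
    hurwitzZetaMulSubOne a s = (s - 1) * hurwitzZeta a s := by
  have : s - 1 ≠ 0 := sub_ne_zero.mpr hs
  rw [hurwitzZetaMulSubOne, mul_sub, one_div, div_eq_mul_inv, ← mul_assoc, mul_inv_cancel₀ this]
  ring

lemma differentiable_hurwitzZetaMulSubOne (a : UnitAddCircle) :
    Differentiable ℂ (hurwitzZetaMulSubOne a) := by
  intro s
  refine DifferentiableAt.add (DifferentiableAt.mul (by fun_prop) ?_) (differentiable_Gammaℝ_inv s)
  by_cases hs : s = 1
  · rw [hs]; exact differentiableAt_hurwitzZeta_sub_one_div a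
  · refine (differentiableAt_hurwitzZeta a hs).sub ?_
    simp_rw [div_eq_mul_inv]
    refine DifferentiableAt.mul ?_ (differentiable_Gammaℝ_inv s)
    exact (DifferentiableAt.inv (h := fun s : ℂ => s - 1) (by fun_prop)
      (sub_ne_zero.mpr hs)).const_mul 1

lemma norm_hurwitzZeta_le_re {a : ℝ} (ha : a ∈ Set.Icc (0 : ℝ) 1) {s : ℂ} (hs : 1 < s.re) :
    ‖hurwitzZeta a s‖ ≤ ‖hurwitzZeta a s.re‖ := by
  have h1 := hasSum_hurwitzZeta_of_one_lt_re ha hs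
  have h2 := hasSum_hurwitzZeta_of_one_lt_re ha (s := (s.re : ℂ)) (by simpa using hs)
  have hterm (n : ℕ) : ‖1 / (n + a : ℂ) ^ s‖ = 1 / (n + a : ℝ) ^ s.re := by
    have h0 : 0 ≤ (n + a : ℝ) := add_nonneg n.cast_nonneg ha.1
    rw [norm_div, norm_one, show (n + a : ℂ) = ((n + a : ℝ) : ℂ) by push_cast; rfl,
      norm_cpow_eq_rpow_re_of_nonneg h0 (by linarith)]
  have hterm' (n : ℕ) : (1 / (n + a : ℂ) ^ (s.re : ℂ)) = ((1 / (n + a : ℝ) ^ s.re : ℝ) : ℂ) := by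
    have h0 : 0 ≤ (n + a : ℝ) := add_nonneg n.cast_nonneg ha.1
    push_cast [ofReal_cpow h0]; rfl
  simp_rw [hterm'] at h2
  have hsum : Summable fun n : ℕ => 1 / (n + a : ℝ) ^ s.re := by
    have := h2.summable; exact_mod_cast this
  have hval : hurwitzZeta a s.re = ((∑' n : ℕ, 1 / (n + a : ℝ) ^ s.re : ℝ) : ℂ) := by
    rw [← h2.tsum_eq, ofReal_tsum]
  rw [hval, norm_real, Real.norm_eq_abs, ← h1.tsum_eq]
  refine le_trans ?_ (le_abs_self _)
  refine (norm_tsum_le_tsum_norm (by simpa only [hterm] using hsum)).trans ?_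
  simp_rw [hterm]; rfl

lemma norm_expZeta_le_re (a : UnitAddCircle) {s : ℂ} (hs : 1 < s.re) :
    ‖expZeta a s‖ ≤ ‖hurwitzZeta 0 s.re‖ := by
  induction a using QuotientAddGroup.induction_on with | H a => ?_
  have h1 := hasSum_expZeta_of_one_lt_re a hs
  have h2 := hasSum_hurwitzZeta_of_one_lt_re (a := 0) (by simp) (s := (s.re : ℂ))
    (by simpa using hs)
  have hterm (n : ℕ) : ‖exp (2 * Real.pi * I * a * n) / n ^ s‖ = 1 / (n : ℝ) ^ s.re := by
    rw [norm_div, ← ofReal_natCast, norm_cpow_eq_rpow_re_of_nonneg n.cast_nonneg (by linarith),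
      norm_exp]
    simp
  have hterm' (n : ℕ) : (1 / (n + (0 : ℝ) : ℂ) ^ (s.re : ℂ)) = ((1 / (n : ℝ) ^ s.re : ℝ) : ℂ) := by
    push_cast [ofReal_cpow (n.cast_nonneg : (0 : ℝ) ≤ n)]; simp
  simp_rw [hterm'] at h2
  have hsum : Summable fun n : ℕ => 1 / (n : ℝ) ^ s.re := by
    have := h2.summable; exact_mod_cast this
  have hval : hurwitzZeta 0 s.re = ((∑' n : ℕ, 1 / (n : ℝ) ^ s.re : ℝ) : ℂ) := by
    rw [ofReal_tsum, h2.tsum_eq, AddCircle.coe_zero]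
  rw [hval, norm_real, Real.norm_eq_abs]
  change ‖expZeta (a : UnitAddCircle) s‖ ≤ _
  rw [← h1.tsum_eq]
  refine le_trans ?_ (le_abs_self _)
  refine (norm_tsum_le_tsum_norm (by simpa only [hterm] using hsum)).trans ?_
  simp_rw [hterm]; rfl

/-- The simple pole at `1` controls the size of `ζ(σ, a)` as `σ → 1⁺`. -/
lemma exists_norm_hurwitzZeta_le_div (a : UnitAddCircle) : ∃ C : ℝ, 0 < C ∧ ∀ δ : ℝ, 0 < δ →
    δ ≤ 1 / 2 → ‖hurwitzZeta a ((1 + δ : ℝ) : ℂ)‖ ≤ C / δ := by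
  have hc : ContinuousOn (fun δ : ℝ => hurwitzZetaMulSubOne a ((1 + δ : ℝ) : ℂ))
      (Set.Icc 0 (1 / 2)) :=
    ((differentiable_hurwitzZetaMulSubOne a).continuous.comp
      (continuous_ofReal.comp (continuous_const.add continuous_id))).continuousOn
  obtain ⟨C, hC⟩ := isCompact_Icc.exists_bound_of_continuousOn hc
  refine ⟨max C 1, by positivity, fun δ h0 h1 => ?_⟩
  have h := (hC δ ⟨h0.le, h1⟩).trans (le_max_left C 1)
  have hne : ((1 + δ : ℝ) : ℂ) ≠ 1 := by
    rw [Ne, ofReal_eq_one]; linarith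
  rw [hurwitzZetaMulSubOne_eq a hne, norm_mul,
    show ((1 + δ : ℝ) : ℂ) - 1 = (δ : ℂ) by push_cast; ring, norm_real,
    Real.norm_of_nonneg h0.le] at h
  rw [le_div_iff₀ h0]
  linarith

/-- Size of the Hurwitz zeta function to the left of the critical strip, by the functional
equation. -/
lemma norm_hurwitzZeta_one_sub_le (a : UnitAddCircle) {s : ℂ} (hs : 1 < s.re) :
    ‖hurwitzZeta a (1 - s)‖ ≤
      2 * (‖Gamma s‖ * Real.exp (Real.pi * |s.im| / 2)) * ‖hurwitzZeta 0 s.re‖ := by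
  rw [hurwitzZeta_one_sub a (fun n h => ?_) (Or.inr fun h => ?_)]
  · have h2pi : ‖(2 * Real.pi : ℂ) ^ (-s)‖ ≤ 1 := by
      rw [show (2 * Real.pi : ℂ) = ((2 * Real.pi : ℝ) : ℂ) by push_cast; rfl,
        norm_cpow_eq_rpow_re_of_pos (by positivity)]
      exact Real.rpow_le_one_of_one_le_of_nonpos (by linarith [Real.pi_gt_three])
        (by simp; linarith)
    have e1 : ‖exp (-Real.pi * I * s / 2)‖ ≤ Real.exp (Real.pi * |s.im| / 2) := by
      rw [norm_exp, show (-Real.pi * I * s / 2 : ℂ) = ((Real.pi / 2 : ℝ) : ℂ) * (-I * s) by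
        push_cast; ring, re_ofReal_mul]
      gcongr
      simp
      nlinarith [le_abs_self s.im, Real.pi_pos]
    have e2 : ‖exp (Real.pi * I * s / 2)‖ ≤ Real.exp (Real.pi * |s.im| / 2) := by
      rw [norm_exp, show (Real.pi * I * s / 2 : ℂ) = ((Real.pi / 2 : ℝ) : ℂ) * (I * s) by
        push_cast; ring, re_ofReal_mul]
      gcongr
      simp
      nlinarith [neg_le_abs s.im, Real.pi_pos]
    rw [norm_mul, norm_mul]
    calc _ ≤ 1 * ‖Gamma s‖ * (Real.exp (Real.pi * |s.im| / 2) * ‖hurwitzZeta 0 s.re‖ +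
          Real.exp (Real.pi * |s.im| / 2) * ‖hurwitzZeta 0 s.re‖) := by
          gcongr
          refine (norm_add_le _ _).trans ?_
          rw [norm_mul, norm_mul]
          gcongr
          · exact norm_expZeta_le_re a hs
          · exact norm_expZeta_le_re (-a) hs
      _ = _ := by ring
  · have := congrArg re h
    simp only [neg_re, natCast_re] at this
    have : (0 : ℝ) ≤ n := n.cast_nonneg
    linarith
  · rw [h, one_re] at hs; exact lt_irrefl _ hs

lemma norm_hurwitzZetaMulSubOne_mul_inv_le (a : UnitAddCircle) {s : ℂ} (hs : s ≠ 1)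
    (hre : -1 / 2 ≤ s.re) : ‖hurwitzZetaMulSubOne a s * (s + 2)⁻¹‖ ≤ ‖hurwitzZeta a s‖ := by
  have h2 : ‖s - 1‖ ≤ ‖s + 2‖ := by
    rw [← sq_le_sq₀ (norm_nonneg _) (norm_nonneg _), ← normSq_eq_norm_sq, ← normSq_eq_norm_sq,
      normSq_apply, normSq_apply]
    simp
    nlinarith
  rw [hurwitzZetaMulSubOne_eq a hs, norm_mul, norm_mul, norm_inv, mul_right_comm]
  refine mul_le_of_le_one_left (norm_nonneg _) ?_
  rw [← div_eq_mul_inv]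
  exact div_le_one_of_le₀ h2 (norm_nonneg _)

/-- Convexity bound for the Hurwitz zeta function in the closed critical strip. -/
lemma exists_norm_hurwitzZeta_strip_le {a : ℝ} (ha : a ∈ Set.Icc (0 : ℝ) 1) : ∃ C : ℝ, 0 < C ∧
    ∀ σ t : ℝ, 0 ≤ σ → σ ≤ 1 → 2 ≤ t →
      ‖hurwitzZeta a (σ + t * I)‖ ≤ C * t ^ ((1 - σ) / 2) * Real.log t := by
  obtain ⟨D, hD0, hD⟩ := exists_norm_hurwitzZeta_le_div (a : UnitAddCircle)
  obtain ⟨D', hD'0, hD'⟩ := exists_norm_hurwitzZeta_le_div 0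
  obtain ⟨G, hG0, hG⟩ := exists_norm_Gamma_le
  obtain ⟨M, hM0, hM⟩ := exists_norm_hurwitzZeta_le_exp (a : UnitAddCircle)
  set K := 32 * Real.exp 1 * G * D' + 4 * Real.exp 3 * D with hK
  refine ⟨3 * K, by positivity, fun σ t hσ0 hσ1 ht => ?_⟩
  have ht0 : 0 < t := by linarith
  set L := Real.log t with hL
  have hL2 : 1 / 2 < L := by
    have := Real.log_two_gt_d9
    have := Real.log_le_log (by norm_num) ht
    linarith
  have hL0 : 0 < L := by linarith
  have htL : Real.exp L = t := Real.exp_log ht0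
  set δ := 1 / (4 * L) with hδ
  have hδ0 : 0 < δ := by positivity
  have hδ1 : δ ≤ 1 / 2 := by
    rw [hδ, div_le_iff₀ (by positivity)]; linarith
  have hδL : L * δ = 1 / 4 := by rw [hδ]; field_simp
  have hdiv (c : ℝ) : c / δ = 4 * c * L := by rw [hδ]; field_simp
  let E : ℂ → ℂ := fun s => (s - 1) / 2 * L + (s - t * I) ^ 2
  have hE (s : ℂ) : ‖exp (E s)‖ =
      Real.exp ((s.re - 1) / 2 * L + s.re ^ 2 - (s.im - t) ^ 2) := by
    rw [norm_exp]; congr 1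
    simp [E, pow_two, div_eq_mul_inv]
    norm_num
    ring
  have key : ‖hurwitzZetaMulSubOne a (σ + t * I) * ((σ + t * I) + 2 : ℂ)⁻¹ *
      exp (E (σ + t * I))‖ ≤ K * L := by
    refine norm_le_of_strip_of_exp_growth
      (f := fun s => hurwitzZetaMulSubOne a s * (s + 2)⁻¹ * exp (E s)) (a := -δ)
      (b := 1 + δ) (A := Real.log M + (L + 9 / 4)) (B := 2) ?_ (by linarith)
      (by linarith [Real.pi_gt_three]) ?_ ?_ ?_ (by simp; linarith) (by simp; linarith)
    · intro z hz
      refine ((differentiable_hurwitzZetaMulSubOne _ z).mul (DifferentiableAt.inv (by fun_prop)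
        fun h => ?_)).mul (by fun_prop)
      have := congrArg re h
      simp at this
      linarith
    · intro z hz1 hz2 hz3
      have hne : z ≠ 1 := by rintro rfl; simp at hz3; linarith
      rw [norm_mul, hE]
      have h1 := (norm_hurwitzZetaMulSubOne_mul_inv_le (a : UnitAddCircle) hne
        (by linarith)).trans (hM z (by linarith) (by linarith) hz3)
      calc _ ≤ M * Real.exp (2 * |z.im|) * Real.exp (L + 9 / 4) := by
            gcongr
            have : (z.re - 1) / 2 * L ≤ 1 * L := by gcongr; linarith
            nlinarith [sq_nonneg (z.im - t)]
        _ = _ := by rw [Real.exp_add (Real.log M + (L + 9 / 4)), Real.exp_add (Real.log M), Real.exp_log hM0]; ring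
    · intro z hz
      have hne : z ≠ 1 := by rintro rfl; simp at hz; linarith
      rw [norm_mul, hE, hz]
      have h1 := norm_hurwitzZetaMulSubOne_mul_inv_le (a : UnitAddCircle) hne (by linarith)
      have hw : (1 - z).re = 1 + δ := by simp [hz]
      have hwi : |(1 - z).im| = |z.im| := by simp
      have h2 := norm_hurwitzZeta_one_sub_le (a : UnitAddCircle) (s := 1 - z)
        (by rw [hw]; linarith)
      have h3 := hG (1 - z).re (1 - z).im (by rw [hw]; linarith) (by rw [hw]; linarith)
      rw [re_add_im] at h3
      rw [sub_sub_cancel, hw, hwi] at h2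
      rw [hw, hwi] at h3
      have h4 : ‖Gamma (1 - z)‖ * Real.exp (Real.pi * |z.im| / 2) ≤
          G * (1 + |z.im|) ^ (1 + δ - 1 / 2) := by
        calc _ ≤ G * (1 + |z.im|) ^ (1 + δ - 1 / 2) * Real.exp (-(Real.pi * |z.im| / 2)) *
              Real.exp (Real.pi * |z.im| / 2) := by gcongr
          _ = _ := by rw [mul_assoc, ← Real.exp_add]; simp
      have h5 : (1 + |z.im|) ^ (1 + δ - 1 / 2) ≤
          Real.exp (L * (1 + δ - 1 / 2)) * (2 * (1 + |z.im - t|)) := by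
        have h6 := one_add_abs_le_mul z.im t
        rw [abs_of_pos ht0] at h6
        calc _ ≤ (t * (2 * (1 + |z.im - t|))) ^ (1 + δ - 1 / 2) := by
              gcongr
              · linarith
              · nlinarith [abs_nonneg (z.im - t)]
          _ = t ^ (1 + δ - 1 / 2) * (2 * (1 + |z.im - t|)) ^ (1 + δ - 1 / 2) :=
              Real.mul_rpow ht0.le (by positivity)
          _ ≤ t ^ (1 + δ - 1 / 2) * (2 * (1 + |z.im - t|)) ^ (1 : ℝ) := by
              gcongr
              · linarith [abs_nonneg (z.im - t)]
              · linarith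
          _ = _ := by rw [Real.rpow_one, Real.rpow_def_of_pos ht0]
      have h7 := hD' δ hδ0 hδ1
      rw [hdiv] at h7
      calc _ ≤ 2 * (G * (Real.exp (L * (1 + δ - 1 / 2)) * (2 * (1 + |z.im - t|)))) *
            (4 * D' * L) * Real.exp ((-δ - 1) / 2 * L + (-δ) ^ 2 - (z.im - t) ^ 2) := by
            gcongr
            refine h1.trans (h2.trans ?_)
            gcongr 2 * ?_ * ?_
            exact h4.trans (by gcongr)
        _ = 16 * G * D' * L * (1 + |z.im - t|) * Real.exp (L * (1 + δ - 1 / 2) +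
            ((-δ - 1) / 2 * L + (-δ) ^ 2 - (z.im - t) ^ 2)) := by
            rw [Real.exp_add]; ring
        _ ≤ 16 * G * D' * L * (1 + |z.im - t|) * Real.exp (1 + -(z.im - t) ^ 2) := by
            refine mul_le_mul_of_nonneg_left (Real.exp_le_exp.mpr ?_) (by positivity)
            nlinarith
        _ = 16 * G * D' * L * Real.exp 1 * ((1 + |z.im - t|) * Real.exp (-(z.im - t) ^ 2)) := by
            rw [Real.exp_add]; ring
        _ ≤ 16 * G * D' * L * Real.exp 1 * 2 := by
            gcongr; exact one_add_abs_mul_exp_neg_sq_le _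
        _ = (32 * Real.exp 1 * G * D') * L := by ring
        _ ≤ K * L := by
            gcongr; rw [hK]; exact le_add_of_nonneg_right (by positivity)
    · intro z hz
      have hne : z ≠ 1 := by rintro rfl; simp at hz; linarith
      rw [norm_mul, hE, hz]
      have h1 := norm_hurwitzZetaMulSubOne_mul_inv_le (a : UnitAddCircle) hne (by linarith)
      have h2 := norm_hurwitzZeta_le_re ha (s := z) (by linarith)
      rw [hz] at h2
      have h3 := hD δ hδ0 hδ1
      rw [hdiv] at h3
      calc _ ≤ (4 * D * L) * Real.exp 3 := by
            gcongr
            · exact h1.trans (h2.trans h3)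
            · nlinarith [sq_nonneg (z.im - t)]
        _ = (4 * Real.exp 3 * D) * L := by ring
        _ ≤ K * L := by
            gcongr; rw [hK]; exact le_add_of_nonneg_left (by positivity)
  have him : ((σ : ℂ) + t * I).im = t := by simp
  have hre : ((σ : ℂ) + t * I).re = σ := by simp
  rw [norm_mul, hE, him, hre] at key
  set s : ℂ := σ + t * I with hs
  have hne : s ≠ 1 := by intro h; rw [h] at him; simp at him; linarith
  have hs1 : 2 ≤ ‖s - 1‖ := by
    refine ht.trans ?_
    have := abs_im_le_norm (s - 1)
    rw [sub_im, him, one_im, sub_zero, abs_of_pos ht0] at this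
    exact this
  have hs2 : ‖s + 2‖ ≤ 3 * ‖s - 1‖ := by
    have := norm_add_le (s - 1) 3
    rw [show s - 1 + 3 = s + 2 by ring, show ‖(3 : ℂ)‖ = 3 by simp] at this
    linarith
  have hs0 : 0 < ‖s + 2‖ := by
    refine lt_of_lt_of_le ht0 ?_
    have := abs_im_le_norm (s + 2)
    rw [add_im, him, show (2 : ℂ).im = 0 by simp, add_zero, abs_of_pos ht0] at this
    exact this
  have hlow : ‖hurwitzZeta a s‖ ≤ 3 * ‖hurwitzZetaMulSubOne a s * (s + 2)⁻¹‖ := by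
    rw [hurwitzZetaMulSubOne_eq _ hne, norm_mul, norm_mul, norm_inv, ← div_eq_mul_inv,
      ← mul_div_assoc, le_div_iff₀ hs0]
    nlinarith [norm_nonneg (hurwitzZeta a s), mul_le_mul_of_nonneg_left hs2
      (norm_nonneg (hurwitzZeta a s))]
  have h3 : Real.exp ((σ - 1) / 2 * L) ≤ Real.exp ((σ - 1) / 2 * L + σ ^ 2 - (t - t) ^ 2) := by
    gcongr; nlinarith
  have h4 := (mul_le_mul_of_nonneg_left h3 (norm_nonneg _)).trans key
  rw [Real.rpow_def_of_pos ht0, ← hL]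
  calc _ ≤ 3 * ‖hurwitzZetaMulSubOne a s * (s + 2)⁻¹‖ := hlow
    _ = 3 * (‖hurwitzZetaMulSubOne a s * (s + 2)⁻¹‖ * Real.exp ((σ - 1) / 2 * L)) *
        Real.exp (-((σ - 1) / 2 * L)) := by
        rw [mul_assoc 3, mul_assoc ‖_‖, ← Real.exp_add]; simp
    _ ≤ 3 * (K * L) * Real.exp (-((σ - 1) / 2 * L)) := by gcongr
    _ = _ := by rw [show -((σ - 1) / 2 * L) = L * ((1 - σ) / 2) by ring]; ring

/-- Size of the Hurwitz zeta function on a vertical line left of the critical strip. -/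
lemma exists_norm_hurwitzZeta_left_le (a : UnitAddCircle) {σ : ℝ} (hσ : σ < 0) : ∃ C : ℝ, 0 < C ∧
    ∀ t : ℝ, 2 ≤ t → ‖hurwitzZeta a (σ + t * I)‖ ≤ C * t ^ (1 / 2 - σ) := by
  obtain ⟨G, hG0, hG⟩ := exists_norm_Gamma_vertical_le (x := 1 - σ) (by linarith)
  refine ⟨2 * (G * 2 ^ (1 / 2 - σ)) * (‖hurwitzZeta 0 ((1 - σ : ℝ) : ℂ)‖ + 1), by positivity,
    fun t ht => ?_⟩
  have ht0 : 0 < t := by linarith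
  have h1 := norm_hurwitzZeta_one_sub_le a (s := (1 - σ : ℝ) + (-t : ℝ) * I) (by simp; linarith)
  have h2 := hG (-t)
  have him : ((1 - σ : ℝ) + (-t : ℝ) * I : ℂ).im = -t := by simp
  have hre : ((1 - σ : ℝ) + (-t : ℝ) * I : ℂ).re = 1 - σ := by simp
  rw [him, hre, abs_neg, abs_of_pos ht0,
    show (1 - ((1 - σ : ℝ) + (-t : ℝ) * I) : ℂ) = σ + t * I by push_cast; ring] at h1
  rw [abs_neg, abs_of_pos ht0, show 1 - σ - 1 / 2 = 1 / 2 - σ by ring] at h2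
  have h3 : ‖Gamma ((1 - σ : ℝ) + (-t : ℝ) * I)‖ * Real.exp (Real.pi * t / 2) ≤
      G * 2 ^ (1 / 2 - σ) * t ^ (1 / 2 - σ) := by
    calc _ ≤ G * (1 + t) ^ (1 / 2 - σ) * Real.exp (-(Real.pi * t / 2)) *
          Real.exp (Real.pi * t / 2) := by gcongr
      _ = G * (1 + t) ^ (1 / 2 - σ) := by rw [mul_assoc, ← Real.exp_add]; simp
      _ ≤ G * (2 * t) ^ (1 / 2 - σ) := by
          gcongr <;> linarith
      _ = _ := by rw [Real.mul_rpow zero_le_two ht0.le]; ring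
  calc _ ≤ 2 * (G * 2 ^ (1 / 2 - σ) * t ^ (1 / 2 - σ)) *
        (‖hurwitzZeta 0 ((1 - σ : ℝ) : ℂ)‖ + 1) := by
        refine h1.trans ?_
        gcongr
        linarith
    _ = _ := by ring

lemma exists_norm_hurwitzZeta_right_le {a : ℝ} (ha : a ∈ Set.Icc (0 : ℝ) 1) {σ : ℝ} (hσ : 1 < σ) :
    ∃ C : ℝ, 0 < C ∧ ∀ t : ℝ, ‖hurwitzZeta a (σ + t * I)‖ ≤ C := by
  refine ⟨‖hurwitzZeta a (σ : ℂ)‖ + 1, by positivity, fun t => ?_⟩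
  have := norm_hurwitzZeta_le_re ha (s := σ + t * I) (by simpa using hσ)
  simp only [add_re, ofReal_re, mul_re, I_re, mul_zero, ofReal_im, I_im, mul_one, sub_self,
    add_zero] at this
  linarith

lemma exists_norm_hurwitzZeta_le_rpow_mul_log {a : ℝ} (ha : a ∈ Set.Icc (0 : ℝ) 1) {σ e : ℝ}
    (he : 0 ≤ e) (h1 : (1 - σ) / 2 ≤ e) (h2 : σ < 0 → 1 / 2 - σ ≤ e) : ∃ C : ℝ, 0 < C ∧
    ∀ t : ℝ, 2 ≤ t → ‖hurwitzZeta a (σ + t * I)‖ ≤ C * t ^ e * Real.log t := by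
  have hlog {t : ℝ} (ht : 2 ≤ t) : 1 ≤ 2 * Real.log t := by
    have := Real.log_two_gt_d9
    have := Real.log_le_log (by norm_num) ht
    linarith
  have hpow {t : ℝ} (ht : 2 ≤ t) {e' : ℝ} (h : e' ≤ e) : t ^ e' ≤ t ^ e :=
    Real.rpow_le_rpow_of_exponent_le (by linarith) h
  rcases lt_or_ge σ 0 with hσ | hσ
  · obtain ⟨C, hC0, hC⟩ := exists_norm_hurwitzZeta_left_le (a : UnitAddCircle) hσ
    refine ⟨C * 2, by positivity, fun t ht => (hC t ht).trans ?_⟩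
    have ht0 : 0 < t := by linarith
    calc C * t ^ (1 / 2 - σ) ≤ C * t ^ e * 1 := by
          rw [mul_one]; exact mul_le_mul_of_nonneg_left (hpow ht (h2 hσ)) hC0.le
      _ ≤ C * t ^ e * (2 * Real.log t) := by gcongr; exact hlog ht
      _ = _ := by ring
  rcases le_or_gt σ 1 with hσ1 | hσ1
  · obtain ⟨C, hC0, hC⟩ := exists_norm_hurwitzZeta_strip_le ha
    refine ⟨C, hC0, fun t ht => (hC σ t hσ hσ1 ht).trans ?_⟩
    have := hlog ht
    exact mul_le_mul_of_nonneg_right (mul_le_mul_of_nonneg_left (hpow ht h1) hC0.le) (by linarith)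
  · obtain ⟨C, hC0, hC⟩ := exists_norm_hurwitzZeta_right_le ha hσ1
    refine ⟨C * 2, by positivity, fun t ht => (hC t).trans ?_⟩
    have ht0 : 0 < t := by linarith
    have h3 : 1 ≤ t ^ e := Real.one_le_rpow (by linarith) he
    calc C = C * 1 * 1 := by ring
      _ ≤ C * t ^ e * (2 * Real.log t) := by gcongr; exact hlog ht
      _ = _ := by ring

lemma exists_norm_zetaR_le (r : ℕ) (a σ : ℝ) (B : ℝ → ℝ)
    (hB : ∀ t, 2 ≤ t → 0 ≤ B t)
    (h : ∀ j < r, ∃ C : ℝ, 0 < C ∧ ∀ t : ℝ, 2 ≤ t →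
      ‖hurwitzZeta a ((σ - j : ℝ) + t * I)‖ ≤ C * B t) :
    ∃ C : ℝ, 0 < C ∧ ∀ t : ℝ, 2 ≤ t → ‖zetaR r a (σ + t * I)‖ ≤ C * B t := by
  choose! C hC0 hC using h
  refine ⟨∑ j ∈ range r, |pCoeff r a j| * C j + 1, ?_, fun t ht => ?_⟩
  · have : 0 ≤ ∑ j ∈ range r, |pCoeff r a j| * C j :=
      sum_nonneg fun j hj => mul_nonneg (abs_nonneg _) (hC0 j (mem_range.mp hj)).le
    linarith
  · rw [zetaR, add_mul, sum_mul]
    refine (norm_sum_le _ _).trans (le_trans (sum_le_sum fun j hj => ?_)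
      (le_add_of_nonneg_right (mul_nonneg zero_le_one (hB t ht))))
    rw [norm_mul, norm_real, Real.norm_eq_abs, mul_assoc, hzeta,
      show (σ + t * I - j : ℂ) = (σ - j : ℝ) + t * I by push_cast; ring]
    gcongr
    exact hC j (mem_range.mp hj) t ht

theorem stmt4 (r : ℕ) (hr : 1 ≤ r) (a : ℝ) (ha : 0 < a) (ha1 : a ≤ 1) (σ : ℝ) :
    ((r : ℝ) < σ →
      ∃ C > 0, ∀ t : ℝ, 2 ≤ t → ‖zetaR r a (σ + t * I)‖ ≤ C) ∧
    ((r : ℝ) - 1 < σ → σ ≤ (r : ℝ) →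
      ∃ C > 0, ∀ t : ℝ, 2 ≤ t →
        ‖zetaR r a (σ + t * I)‖ ≤ C * t ^ (((r : ℝ) - σ) / 2) * Real.log t) ∧
    (σ ≤ (r : ℝ) - 1 →
      ∃ C > 0, ∀ t : ℝ, 2 ≤ t →
        ‖zetaR r a (σ + t * I)‖ ≤ C * t ^ ((r : ℝ) - σ - 1 / 2) * Real.log t) := by
  have hmem : a ∈ Set.Icc (0 : ℝ) 1 := ⟨ha.le, ha1⟩
  have hj {j : ℕ} (h : j < r) : (j : ℝ) + 1 ≤ r := by exact_mod_cast h
  have hB (e : ℝ) : ∀ t : ℝ, 2 ≤ t → 0 ≤ t ^ e * Real.log t := fun t ht =>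
    mul_nonneg (Real.rpow_nonneg (by linarith) _) (Real.log_nonneg (by linarith))
  refine ⟨fun h => ?_, fun h h' => ?_, fun h => ?_⟩
  · obtain ⟨C, hC0, hC⟩ := exists_norm_zetaR_le r a σ (fun _ => 1) (fun _ _ => zero_le_one)
      fun j hjr => by
        obtain ⟨C, hC0, hC⟩ := exists_norm_hurwitzZeta_right_le hmem
          (σ := σ - j) (by linarith [hj hjr])
        exact ⟨C, hC0, fun t _ => by simpa using hC t⟩
    exact ⟨C, hC0, fun t ht => by simpa using hC t ht⟩
  · simp_rw [mul_assoc]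
    refine exists_norm_zetaR_le r a σ _ (hB _) fun j hjr => ?_
    simp_rw [← mul_assoc]
    have := hj hjr
    exact exists_norm_hurwitzZeta_le_rpow_mul_log hmem (by linarith) (by linarith)
      fun h0 => by linarith
  · simp_rw [mul_assoc]
    refine exists_norm_zetaR_le r a σ _ (hB _) fun j hjr => ?_
    simp_rw [← mul_assoc]
    have := hj hjr
    exact exists_norm_hurwitzZeta_le_rpow_mul_log hmem (by linarith) (by linarith)
      fun _ => by linarith
end

section
/- Let r ≥ 1 be an integer and 0 < a ≤ 1. Then, as T → ∞: (a) ∫_1^T |ζ_r(r−1/2+it, a, 𝟏)|² dt ≍ T log T; and (b) for every σ with r−1 < σ < r−1/2, ∫_1^T |ζ_r(σ+it, a, 𝟏)|² dt ≍ T^{2r−2σ}. (That is, in each case the integral is bounded above and below by positive constant multiples of the stated function of T, for all sufficiently large T.) -/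
open Complex Filter Finset MeasureTheory

section Plancherel

open scoped FourierTransform SchwartzMap ContDiff

/-- On `L¹ ∩ L²` the Fourier integral represents the `L²` Fourier transform. -/
theorem coeFn_fourier_toLp_ae_eq {f : ℝ → ℂ} (hf : Integrable f) (hf2 : MemLp f 2) :
    ((𝓕 (hf2.toLp f) : Lp ℂ 2 (volume : Measure ℝ)) : ℝ → ℂ) =ᵐ[volume] 𝓕 f := by
  set F : Lp ℂ 2 (volume : Measure ℝ) := 𝓕 (hf2.toLp f)
  have hcont : Continuous (𝓕 f) :=
    VectorFourier.fourierIntegral_continuous Real.continuous_fourierChar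
      (L := innerₗ ℝ) continuous_inner hf
  have hF : LocallyIntegrable (F : ℝ → ℂ) := (Lp.memLp F).locallyIntegrable one_le_two
  have hG : LocallyIntegrable (𝓕 f) := hcont.locallyIntegrable
  refine ae_eq_of_integral_contDiff_smul_eq hF hG fun g hg hgc => ?_
  have hgc' : HasCompactSupport (fun x => (g x : ℂ)) := hgc.comp_left Complex.ofReal_zero
  let φ : 𝓢(ℝ, ℂ) := hgc'.toSchwartzMap (Complex.ofRealCLM.contDiff.comp hg)
  have hφ : ∀ x, φ x = (g x : ℂ) := fun _ => rfl
  have h1 := congrArg (fun u => u φ) (Lp.fourier_toTemperedDistribution_eq (hf2.toLp f))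
  simp only [TemperedDistribution.fourier_apply, Lp.toTemperedDistribution_apply] at h1
  have h2 : ∫ x, (𝓕 φ) x • (hf2.toLp f) x = ∫ x, (𝓕 φ) x • f x := by
    refine integral_congr_ae ?_
    filter_upwards [hf2.coeFn_toLp] with x hx
    rw [hx]
  have h3 : ∫ x, (𝓕 (φ : ℝ → ℂ)) x • f x = ∫ x, φ x • 𝓕 f x := by
    simpa using! VectorFourier.integral_fourierIntegral_smul_eq_flip (L := innerₗ ℝ)
      Real.continuous_fourierChar continuous_inner φ.integrable hf
  rw [h2, SchwartzMap.fourier_coe, h3] at h1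
  simpa [hφ] using h1.symm

/-- **Plancherel's theorem** for functions in `L¹ ∩ L²`. -/
theorem integral_norm_sq_fourier {f : ℝ → ℂ} (hf : Integrable f) (hf2 : MemLp f 2) :
    MemLp (𝓕 f) 2 ∧ ∫ ξ, ‖𝓕 f ξ‖ ^ 2 = ∫ x, ‖f x‖ ^ 2 := by
  have hae := coeFn_fourier_toLp_ae_eq hf hf2
  have hmem : MemLp (𝓕 f) 2 := (memLp_congr_ae hae).1 (Lp.memLp _)
  refine ⟨hmem, ?_⟩
  have key : ∀ {g : ℝ → ℂ} (hg : MemLp g 2), ∫ x, ‖g x‖ ^ 2 = ‖hg.toLp g‖ ^ 2 := by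
    intro g hg
    have h := L2.inner_def (𝕜 := ℂ) (hg.toLp g) (hg.toLp g)
    rw [inner_self_eq_norm_sq_to_K] at h
    have h2 : ∫ x, inner ℂ ((hg.toLp g) x) ((hg.toLp g) x) = ∫ x, ((‖g x‖ ^ 2 : ℝ) : ℂ) := by
      refine integral_congr_ae ?_
      filter_upwards [hg.coeFn_toLp] with x hx
      rw [hx, inner_self_eq_norm_sq_to_K]
      simp
    rw [h2, integral_complex_ofReal] at h
    exact Complex.ofReal_injective (by push_cast at h ⊢; exact h.symm)
  rw [key hmem, key hf2]
  have : hmem.toLp (𝓕 f) = 𝓕 (hf2.toLp f) := by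
    refine Lp.ext ?_
    exact hmem.coeFn_toLp.trans hae.symm
  rw [this, Lp.norm_fourier_eq]

/-- **Plancherel's theorem** for the Mellin transform on the vertical line `re s = σ`. -/
theorem integral_norm_sq_mellin {D : ℝ → ℂ} {σ : ℝ} (hD : MellinConvergent D σ)
    (hD2 : IntegrableOn (fun x : ℝ => ‖D x‖ ^ 2 * x ^ (2 * σ - 1)) (Set.Ioi 0)) :
    Integrable (fun t : ℝ => ‖mellin D (σ + t * I)‖ ^ 2) ∧
      ∫ t : ℝ, ‖mellin D (σ + t * I)‖ ^ 2 =
        2 * Real.pi * ∫ x in Set.Ioi (0 : ℝ), ‖D x‖ ^ 2 * x ^ (2 * σ - 1) := by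
  have hderiv : ∀ x ∈ Set.univ, HasDerivWithinAt (Real.exp ∘ Neg.neg) (-Real.exp (-x))
      Set.univ x := fun x _ => mul_neg_one (Real.exp (-x)) ▸
    ((Real.hasDerivAt_exp (-x)).comp x (hasDerivAt_neg x)).hasDerivWithinAt
  have himage : Real.exp ∘ Neg.neg '' Set.univ = Set.Ioi 0 := by
    rw [Set.image_comp, Set.image_univ_of_surjective neg_surjective, Set.image_univ,
      Real.range_exp]
  have hinj : Set.univ.InjOn (Real.exp ∘ Neg.neg) :=
    Real.exp_injective.injOn.comp neg_injective.injOn (Set.univ.mapsTo_univ _)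
  set f : ℝ → ℂ := fun u => Real.exp (-σ * u) • D (Real.exp (-u)) with hfdef
  have hf : Integrable f := by
    have h := hD
    rw [MellinConvergent, ← himage, integrableOn_image_iff_integrableOn_abs_deriv_smul
      MeasurableSet.univ hderiv hinj, integrableOn_univ] at h
    refine h.congr (Eventually.of_forall fun u => ?_)
    simp only [hfdef, Function.comp, abs_neg, Real.abs_exp]
    rw [← Complex.ofReal_one, ← Complex.ofReal_sub, ← Complex.ofReal_cpow (Real.exp_pos _).le,
      Complex.real_smul, smul_eq_mul, Complex.real_smul, ← mul_assoc, ← Complex.ofReal_mul,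
      ← Real.exp_mul, ← Real.exp_add]
    congr 3
    ring
  have hpt : ∀ u : ℝ, |-Real.exp (-u)| • (‖D (Real.exp (-u))‖ ^ 2 *
      Real.exp (-u) ^ (2 * σ - 1)) = ‖f u‖ ^ 2 := by
    intro u
    simp only [hfdef, abs_neg, Real.abs_exp, norm_smul, Real.norm_eq_abs, mul_pow, smul_eq_mul]
    rw [← Real.exp_mul, ← Real.exp_nat_mul, mul_left_comm, ← Real.exp_add, mul_comm]
    congr 2
    push_cast
    ring
  have hf2int : Integrable fun u => ‖f u‖ ^ 2 := by
    have h := hD2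
    rw [← himage, integrableOn_image_iff_integrableOn_abs_deriv_smul
      MeasurableSet.univ hderiv hinj, integrableOn_univ] at h
    exact h.congr (Eventually.of_forall fun u => hpt u)
  have hf2eq : ∫ x in Set.Ioi (0 : ℝ), ‖D x‖ ^ 2 * x ^ (2 * σ - 1) = ∫ u, ‖f u‖ ^ 2 := by
    rw [← himage, integral_image_eq_integral_abs_deriv_smul MeasurableSet.univ hderiv hinj,
      setIntegral_univ]
    exact integral_congr_ae (Eventually.of_forall fun u => hpt u)
  have hf2 : MemLp f 2 := (memLp_two_iff_integrable_sq_norm hf.1).2 hf2int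
  obtain ⟨hm, hP⟩ := integral_norm_sq_fourier hf hf2
  have hmel : ∀ t : ℝ, mellin D (σ + t * I) = 𝓕 f (t / (2 * Real.pi)) := by
    intro t
    rw [mellin_eq_fourier]
    simp [hfdef]
  have hpi : (2 * Real.pi) ≠ 0 := by positivity
  simp only [hmel]
  constructor
  · exact ((memLp_two_iff_integrable_sq_norm hm.1).1 hm).comp_div hpi
  · rw [Measure.integral_comp_div (fun t => ‖𝓕 f t‖ ^ 2), hP, hf2eq, smul_eq_mul,
      abs_of_pos (by positivity)]

end Plancherel

/-- The number of integers `m ≥ 0` with `m + a ≤ x`. -/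
noncomputable def shiftCount (a x : ℝ) : ℕ := ⌊x + 1 - a⌋₊

/-- The counting error `#{m ≥ 0 : m + a ≤ x} - x`. -/
noncomputable def shiftRem (a x : ℝ) : ℝ := shiftCount a x - x

theorem lt_shiftCount_iff {a x : ℝ} {n : ℕ} : n < shiftCount a x ↔ n + a ≤ x := by
  rw [shiftCount, ← Nat.succ_le_iff, Nat.le_floor_iff' (Nat.succ_ne_zero n)]
  push_cast
  constructor <;> intro h <;> linarith

theorem shiftCount_of_lt {a x : ℝ} (h : x < a) : shiftCount a x = 0 :=
  Nat.floor_eq_zero.2 (by linarith)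

theorem shiftCount_le {a x : ℝ} (ha1 : a ≤ 1) (hx : 0 ≤ x) : (shiftCount a x : ℝ) ≤ x + 1 - a :=
  Nat.floor_le (by linarith)

theorem lt_shiftCount {a x : ℝ} : x - a < shiftCount a x := by
  have := Nat.lt_floor_add_one (x + 1 - a)
  rw [shiftCount]
  linarith

theorem shiftCount_mono (a : ℝ) : Monotone (shiftCount a) := fun _ _ h =>
  Nat.floor_mono (by linarith)

@[fun_prop]
theorem measurable_shiftCount (a : ℝ) : Measurable fun x => (shiftCount a x : ℝ) := by
  unfold shiftCount
  exact measurable_from_nat.comp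
    (Nat.measurable_floor.comp (by fun_prop : Measurable fun x : ℝ => x + 1 - a))

@[fun_prop]
theorem measurable_shiftRem (a : ℝ) : Measurable (shiftRem a) :=
  (measurable_shiftCount a).sub measurable_id

theorem abs_shiftRem_le {a x : ℝ} (ha : 0 < a) (ha1 : a ≤ 1) (hx : 0 ≤ x) :
    |shiftRem a x| ≤ 1 := by
  have h1 := shiftCount_le ha1 hx
  have h2 := lt_shiftCount (a := a) (x := x)
  rw [shiftRem, abs_le]
  constructor <;> linarith

theorem shiftRem_of_lt {a x : ℝ} (h : x < a) : shiftRem a x = -x := by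
  simp [shiftRem, shiftCount_of_lt h]

theorem locallyIntegrableOn_of_measurable_bounded {f : ℝ → ℂ} {C : ℝ} (hf : Measurable f)
    (h : ∀ x, 0 < x → ‖f x‖ ≤ C) : LocallyIntegrableOn f (Set.Ioi 0) := by
  rw [locallyIntegrableOn_iff isOpen_Ioi.isLocallyClosed]
  intro k hk hkc
  refine Measure.integrableOn_of_bounded (M := C) hkc.measure_lt_top.ne hf.aestronglyMeasurable ?_
  exact (ae_restrict_iff' hkc.measurableSet).2 (Eventually.of_forall fun x hx => h x (hk hx))

/-- The counting error with its initial segment `(0, a)` removed. -/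
noncomputable def shiftRemTail (a x : ℝ) : ℂ :=
  (Set.Ici a).indicator (fun x => (shiftRem a x : ℂ)) x

theorem measurable_shiftRemTail (a : ℝ) : Measurable (shiftRemTail a) :=
  (Complex.measurable_ofReal.comp (measurable_shiftRem a)).indicator measurableSet_Ici

theorem norm_shiftRemTail_le {a x : ℝ} (ha : 0 < a) (ha1 : a ≤ 1) (hx : 0 ≤ x) :
    ‖shiftRemTail a x‖ ≤ 1 := by
  refine (norm_indicator_le_norm_self _ _).trans ?_
  simpa using abs_shiftRem_le ha ha1 hx

theorem isBigO_one_atTop_of_bounded {f : ℝ → ℂ} {C : ℝ} (h : ∀ x, 0 < x → ‖f x‖ ≤ C) :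
    f =O[atTop] (fun x : ℝ => x ^ (-(0 : ℝ))) := by
  refine Asymptotics.IsBigO.of_bound C ?_
  filter_upwards [eventually_gt_atTop 0] with x hx
  simpa using h x hx

theorem isBigO_shiftRemTail_zero {a : ℝ} (ha : 0 < a) (b : ℝ) :
    shiftRemTail a =O[nhdsWithin 0 (Set.Ioi 0)] (fun x : ℝ => x ^ (-b)) := by
  refine Asymptotics.IsBigO.of_bound 1 ?_
  filter_upwards [nhdsWithin_le_nhds (Iio_mem_nhds ha)] with x hx
  rw [shiftRemTail, Set.indicator_of_notMem (by simpa using hx)]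
  simp

theorem mellinConvergent_shiftRemTail {a : ℝ} (ha : 0 < a) (ha1 : a ≤ 1) {s : ℂ} (hs : 0 < s.re) :
    MellinConvergent (shiftRemTail a) (-s) :=
  have hb : ∀ x, 0 < x → ‖shiftRemTail a x‖ ≤ 1 := fun _ hx => norm_shiftRemTail_le ha ha1 hx.le
  mellinConvergent_of_isBigO_rpow (a := 0) (b := -s.re - 1)
    (locallyIntegrableOn_of_measurable_bounded (measurable_shiftRemTail a) hb)
    (isBigO_one_atTop_of_bounded hb) (by simpa using hs)
    (isBigO_shiftRemTail_zero ha _) (by simp)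

theorem differentiableAt_mellin_shiftRemTail {a : ℝ} (ha : 0 < a) (ha1 : a ≤ 1) {s : ℂ}
    (hs : 0 < s.re) : DifferentiableAt ℂ (fun s => mellin (shiftRemTail a) (-s)) s := by
  have hb : ∀ x, 0 < x → ‖shiftRemTail a x‖ ≤ 1 := fun _ hx => norm_shiftRemTail_le ha ha1 hx.le
  have := mellin_differentiableAt_of_isBigO_rpow (a := 0) (b := -s.re - 1) (s := -s)
    (locallyIntegrableOn_of_measurable_bounded (measurable_shiftRemTail a) hb)
    (isBigO_one_atTop_of_bounded hb) (by simpa using hs)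
    (isBigO_shiftRemTail_zero ha _) (by simp)
  exact this.comp s differentiable_neg.differentiableAt

theorem mellinConvergent_shiftRem {a : ℝ} (ha : 0 < a) (ha1 : a ≤ 1) {s : ℂ} (hs : 0 < s.re)
    (hs1 : s.re < 1) : MellinConvergent (fun x => (shiftRem a x : ℂ)) (-s) := by
  have hb : ∀ x : ℝ, 0 < x → ‖(shiftRem a x : ℂ)‖ ≤ 1 := fun x hx => by
    simpa using abs_shiftRem_le ha ha1 hx.le
  refine mellinConvergent_of_isBigO_rpow (a := 0) (b := -1)
    (locallyIntegrableOn_of_measurable_bounded (by fun_prop) hb)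
    (isBigO_one_atTop_of_bounded hb) (by simpa using hs)
    ?_ (by simpa using hs1)
  refine Asymptotics.IsBigO.of_bound 1 ?_
  filter_upwards [nhdsWithin_le_nhds (Iio_mem_nhds ha)] with x hx
  rw [shiftRem_of_lt hx]
  simp

/-- The counting function is the Mellin density of the Hurwitz zeta function. -/
theorem hzeta_eq_mellin_shiftCount {a : ℝ} (ha : 0 < a) (ha1 : a ≤ 1) {s : ℂ} (hs : 1 < s.re) :
    hzeta a s = s * mellin (fun x => (shiftCount a x : ℂ)) (-s) := by
  have hs0 : s ≠ 0 := by
    rintro rfl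
    norm_num at hs
  have hpos : ∀ n : ℕ, 0 < (n : ℝ) + a := fun n => by positivity
  set f : ℕ → ℝ → ℂ := fun n => (Set.Ici (n + a)).indicator fun x : ℝ => (x : ℂ) ^ (-s - 1) with hf
  have hinter : ∀ n : ℕ, Set.Ioi (0 : ℝ) ∩ Set.Ici (n + a) = Set.Ici (n + a) := fun n =>
    Set.inter_eq_right.2 fun x hx => (hpos n).trans_le hx
  have hre : (-s - 1).re < -1 := by
    simp only [sub_re, neg_re, one_re]
    linarith
  have hint : ∀ n, Integrable (f n) (volume.restrict (Set.Ioi 0)) := by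
    intro n
    have hon : IntegrableOn (fun x : ℝ => (x : ℂ) ^ (-s - 1)) (Set.Ici (n + a)) := by
      rw [integrableOn_Ici_iff_integrableOn_Ioi]
      exact integrableOn_Ioi_cpow_of_lt hre (hpos n)
    exact ((integrable_indicator_iff measurableSet_Ici).2 hon).integrableOn
  have hsum := HurwitzZeta.hasSum_hurwitzZeta_of_one_lt_re (a := a) ⟨ha.le, ha1⟩ hs
  have hval : ∀ n, ∫ x in Set.Ioi 0, f n x = (1 / (n + a : ℂ) ^ s) / s := by
    intro n
    simp only [hf]
    rw [setIntegral_indicator measurableSet_Ici, hinter, integral_Ici_eq_integral_Ioi,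
      integral_Ioi_cpow_of_lt hre (hpos n), sub_add_cancel, cpow_neg, neg_div_neg_eq]
    push_cast
    simp
  have hnorm : ∀ n, ∫ x in Set.Ioi 0, ‖f n x‖ = ‖1 / (n + a : ℂ) ^ s‖ / s.re := by
    intro n
    have h1 : ∀ x, ‖f n x‖ = (Set.Ici (n + a)).indicator (fun x : ℝ => x ^ (-s.re - 1)) x := by
      intro x
      simp only [hf, norm_indicator_eq_indicator_norm]
      by_cases hx : x ∈ Set.Ici ((n : ℝ) + a)
      · rw [Set.indicator_of_mem hx, Set.indicator_of_mem hx,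
          norm_cpow_eq_rpow_re_of_pos ((hpos n).trans_le hx)]
        simp
      · rw [Set.indicator_of_notMem hx, Set.indicator_of_notMem hx]
    simp only [h1]
    rw [setIntegral_indicator measurableSet_Ici, hinter, integral_Ici_eq_integral_Ioi,
      integral_Ioi_rpow_of_lt (by linarith) (hpos n), sub_add_cancel, neg_div_neg_eq, norm_div,
      norm_one, ← ofReal_natCast, ← ofReal_add, norm_cpow_eq_rpow_re_of_pos (hpos n),
      Real.rpow_neg (hpos n).le, one_div]
  have hmain := hasSum_integral_of_summable_integral_norm hint (by
    simp only [hnorm]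
    exact hsum.summable.norm.div_const _)
  simp only [hval] at hmain
  have huniq := hmain.unique (hsum.div_const s)
  rw [hzeta, ← mul_div_cancel₀ (HurwitzZeta.hurwitzZeta (a : UnitAddCircle) s) hs0, ← huniq]
  rw [mellin]
  congr 1
  refine setIntegral_congr_fun measurableSet_Ioi fun x hx => ?_
  have hout : ∀ n ∉ range (shiftCount a x), f n x = 0 := fun n hn =>
    Set.indicator_of_notMem (fun h => hn (Finset.mem_range.2 (lt_shiftCount_iff.2 h))) _
  have hin : ∀ n ∈ range (shiftCount a x), f n x = (x : ℂ) ^ (-s - 1) := fun n hn =>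
    Set.indicator_of_mem (lt_shiftCount_iff.1 (Finset.mem_range.1 hn)) _
  rw [tsum_eq_sum hout, sum_congr rfl hin]
  simp [mul_comm]

theorem hzeta_eq_of_one_lt_re {a : ℝ} (ha : 0 < a) (ha1 : a ≤ 1) {s : ℂ} (hs : 1 < s.re) :
    hzeta a s = s * (mellin (shiftRemTail a) (-s) + (a : ℂ) ^ (1 - s) / (s - 1)) := by
  rw [hzeta_eq_mellin_shiftCount ha ha1 hs]
  congr 1
  have hs1 : s - 1 ≠ 0 := fun h => by
    rw [sub_eq_zero.1 h] at hs
    norm_num at hs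
  have hre : (-s).re < -1 := by simpa using hs
  have h1 := mellinConvergent_shiftRemTail ha ha1 (by linarith : 0 < s.re)
  have hinter : Set.Ioi (0 : ℝ) ∩ Set.Ici a = Set.Ici a :=
    Set.inter_eq_right.2 fun x hx => ha.trans_le hx
  have h2 : IntegrableOn (fun x : ℝ => (x : ℂ) ^ (-s)) (Set.Ici a) := by
    rw [integrableOn_Ici_iff_integrableOn_Ioi]
    exact integrableOn_Ioi_cpow_of_lt hre ha
  have h3 : IntegrableOn ((Set.Ici a).indicator fun x : ℝ => (x : ℂ) ^ (-s)) (Set.Ioi 0) :=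
    ((integrable_indicator_iff measurableSet_Ici).2 h2).integrableOn
  have h4 : ∫ x in Set.Ioi 0, (Set.Ici a).indicator (fun x : ℝ => (x : ℂ) ^ (-s)) x =
      (a : ℂ) ^ (1 - s) / (s - 1) := by
    rw [setIntegral_indicator measurableSet_Ici, hinter, integral_Ici_eq_integral_Ioi,
      integral_Ioi_cpow_of_lt hre ha, neg_add_eq_sub, ← neg_sub s 1, neg_div_neg_eq]
  rw [← h4, mellin, mellin, ← integral_add h1 h3]
  refine setIntegral_congr_fun measurableSet_Ioi fun x hx => ?_
  have hx0 : (x : ℂ) ≠ 0 := ofReal_ne_zero.2 (ne_of_gt hx)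
  simp only [shiftRemTail]
  by_cases hxa : a ≤ x
  · rw [Set.indicator_of_mem (Set.mem_Ici.2 hxa), Set.indicator_of_mem (Set.mem_Ici.2 hxa),
      cpow_sub _ _ hx0, shiftRem]
    simp only [smul_eq_mul, cpow_one]
    push_cast
    field_simp
    ring
  · rw [Set.indicator_of_notMem (by simpa using hxa), Set.indicator_of_notMem (by simpa using hxa),
      shiftCount_of_lt (not_le.1 hxa)]
    simp

theorem hzeta_eq_of_im_ne_zero {a : ℝ} (ha : 0 < a) (ha1 : a ≤ 1) {s : ℂ} (hs : 0 < s.re)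
    (hs' : s.im ≠ 0) :
    hzeta a s = s * (mellin (shiftRemTail a) (-s) + (a : ℂ) ^ (1 - s) / (s - 1)) := by
  set ε : ℝ := s.im
  let A : Set ℂ := {z | 0 < z.re} ∩ {z | 0 < ε * z.im}
  let B : Set ℂ := {z | 1 < z.re}
  have hAo : IsOpen A := (isOpen_lt continuous_const continuous_re).inter
    (isOpen_lt continuous_const (by fun_prop))
  have hBo : IsOpen B := isOpen_lt continuous_const continuous_re
  have hBc : Convex ℝ B := convex_halfSpace_re_gt 1
  have hAc : Convex ℝ A := by
    refine (convex_halfSpace_re_gt 0).inter ?_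
    exact convex_halfSpace_gt (f := fun z : ℂ => ε * z.im)
      ⟨fun x y => by simp [mul_add], fun c x => by simp; ring⟩ 0
  have hεε : 0 < ε * ε := mul_self_pos.2 hs'
  have hcon : IsPreconnected (A ∪ B) :=
    IsPreconnected.union (2 + ε * I) (by simpa [A] using hεε) (by simp [B]) hAc.isPreconnected
      hBc.isPreconnected
  have hne : ∀ z ∈ A ∪ B, z ≠ 1 := by
    rintro z (hz | hz) rfl
    · simpa using hz.2
    · simp [B] at hz
  have hpos : ∀ z ∈ A ∪ B, 0 < z.re := by
    rintro z (hz | hz)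
    · exact hz.1
    · exact zero_lt_one.trans hz
  have hf : AnalyticOnNhd ℂ (hzeta a) (A ∪ B) :=
    DifferentiableOn.analyticOnNhd (fun z hz =>
      (HurwitzZeta.differentiableAt_hurwitzZeta _ (hne z hz)).differentiableWithinAt)
      (hAo.union hBo)
  have hg : AnalyticOnNhd ℂ (fun s => s * (mellin (shiftRemTail a) (-s) +
      (a : ℂ) ^ (1 - s) / (s - 1))) (A ∪ B) := by
    refine DifferentiableOn.analyticOnNhd (fun z hz => DifferentiableAt.differentiableWithinAt ?_)
      (hAo.union hBo)
    have h1 := differentiableAt_mellin_shiftRemTail ha ha1 (hpos z hz)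
    have h2 : DifferentiableAt ℂ (fun s : ℂ => (a : ℂ) ^ (1 - s)) z :=
      DifferentiableAt.const_cpow (by fun_prop) (Or.inl (ofReal_ne_zero.2 ha.ne'))
    have h3 : z - 1 ≠ 0 := sub_ne_zero.2 (hne z hz)
    exact differentiableAt_id.mul (h1.add (h2.div (by fun_prop) h3))
  have h2B : (2 : ℂ) ∈ B := by simp [B]
  refine hf.eqOn_of_preconnected_of_eventuallyEq hg hcon (Or.inr h2B) ?_ (Or.inl ⟨hs, hεε⟩)
  filter_upwards [hBo.mem_nhds h2B] with z hz
  exact hzeta_eq_of_one_lt_re ha ha1 hz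

/-- In the critical strip, `ζ_H(s,a)/s` is the Mellin transform of the counting error. -/
theorem hzeta_eq_mellin_shiftRem {a : ℝ} (ha : 0 < a) (ha1 : a ≤ 1) {s : ℂ} (hs : 0 < s.re)
    (hs1 : s.re < 1) (hs' : s.im ≠ 0) :
    hzeta a s = s * mellin (fun x => (shiftRem a x : ℂ)) (-s) := by
  rw [hzeta_eq_of_im_ne_zero ha ha1 hs hs']
  congr 1
  have hc := mellinConvergent_shiftRem ha ha1 hs hs1
  have ht := mellinConvergent_shiftRemTail ha ha1 hs
  rw [← eq_sub_iff_add_eq', mellin, mellin, ← integral_sub hc ht]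
  have hs1' : s - 1 ≠ 0 := fun h => by
    rw [sub_eq_zero.1 h] at hs1
    norm_num at hs1
  have h1 : ∀ x ∈ Set.Ioi (0 : ℝ), (x : ℂ) ^ (-s - 1) • (shiftRem a x : ℂ) -
      (x : ℂ) ^ (-s - 1) • shiftRemTail a x =
      (Set.Iio a).indicator (fun x : ℝ => -(x : ℂ) ^ (-s)) x := by
    intro x hx
    have hx0 : (x : ℂ) ≠ 0 := ofReal_ne_zero.2 (ne_of_gt hx)
    rw [shiftRemTail]
    by_cases hxa : x < a
    · rw [Set.indicator_of_notMem (by simpa using hxa), Set.indicator_of_mem (Set.mem_Iio.2 hxa),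
        shiftRem_of_lt hxa, cpow_sub _ _ hx0]
      simp only [smul_eq_mul, cpow_one]
      push_cast
      field_simp
      ring
    · rw [Set.indicator_of_mem (Set.mem_Ici.2 (not_lt.1 hxa)),
        Set.indicator_of_notMem (by simpa using hxa), sub_self]
  have hinter : Set.Ioi (0 : ℝ) ∩ Set.Iio a = Set.Ioo 0 a := Set.Ioi_inter_Iio
  rw [setIntegral_congr_fun measurableSet_Ioi h1, setIntegral_indicator measurableSet_Iio, hinter,
    ← integral_Ioc_eq_integral_Ioo, ← intervalIntegral.integral_of_le ha.le,
    intervalIntegral.integral_neg, integral_cpow (Or.inl (by simpa using hs1))]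
  have h2 : -s + 1 ≠ 0 := by rwa [neg_add_eq_sub, ← neg_sub, neg_ne_zero]
  rw [ofReal_zero, zero_cpow h2, sub_zero, neg_add_eq_sub, ← neg_sub s 1, div_neg, neg_neg]

/-- The increment of the counting error between `x` and `q * x`. -/
noncomputable def shiftDiff (a q x : ℝ) : ℝ := shiftRem a (q * x) - shiftRem a x

/-- The weighted `L²` norm of the increment of the counting error. -/
noncomputable def shiftVar (a q σ : ℝ) : ℝ :=
  ∫ x in Set.Ioi (0 : ℝ), shiftDiff a q x ^ 2 * x ^ (-2 * σ - 1)

theorem hasMellin_shiftDiff {a q : ℝ} (ha : 0 < a) (ha1 : a ≤ 1) (hq : 0 < q) {s : ℂ}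
    (hs : 0 < s.re) (hs1 : s.re < 1) :
    HasMellin (fun x => (shiftDiff a q x : ℂ)) (-s)
      (((q : ℂ) ^ s - 1) * mellin (fun x => (shiftRem a x : ℂ)) (-s)) := by
  have h1 := mellinConvergent_shiftRem ha ha1 hs hs1
  have h2 := (MellinConvergent.comp_mul_left hq).2 h1
  have h3 := hasMellin_sub h2 h1
  rw [mellin_comp_mul_left (fun x => (shiftRem a x : ℂ)) _ hq, neg_neg, smul_eq_mul] at h3
  convert h3 using 1
  · ext x
    simp [shiftDiff]
  · ring

theorem conj_ofReal_cpow {x : ℝ} (hx : 0 ≤ x) (s : ℂ) :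
    starRingEnd ℂ ((x : ℂ) ^ s) = (x : ℂ) ^ (starRingEnd ℂ s) := by
  rw [cpow_conj _ _ (by rw [arg_ofReal_of_nonneg hx]; exact Real.pi_ne_zero.symm), conj_ofReal]

theorem norm_hzeta_conj {a : ℝ} (ha : 0 < a) (ha1 : a ≤ 1) {s : ℂ} (hs : 0 < s.re)
    (hs1 : s.re < 1) (hs' : s.im ≠ 0) : ‖hzeta a (starRingEnd ℂ s)‖ = ‖hzeta a s‖ := by
  rw [hzeta_eq_mellin_shiftRem ha ha1 hs hs1 hs', hzeta_eq_mellin_shiftRem ha ha1 (by simpa)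
    (by simpa) (by simpa), norm_mul, norm_mul, norm_conj]
  congr 1
  rw [← norm_conj (mellin _ (-s)), mellin, mellin, ← integral_conj]
  congr 1
  refine setIntegral_congr_fun measurableSet_Ioi fun x hx => ?_
  simp only [smul_eq_mul, map_mul, conj_ofReal]
  rw [conj_ofReal_cpow (le_of_lt hx)]
  simp

/-- The spectral weight attached to the dilation by `q`. -/
noncomputable def dilationWeight (q σ t : ℝ) : ℝ :=
  (‖(q : ℂ) ^ (σ + t * I : ℂ) - 1‖ / ‖(σ + t * I : ℂ)‖) ^ 2

theorem abs_shiftDiff_le_two {a q x : ℝ} (ha : 0 < a) (ha1 : a ≤ 1) (hq : 0 < q) (hx : 0 < x) :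
    |shiftDiff a q x| ≤ 2 := by
  have h1 := abs_shiftRem_le ha ha1 (mul_pos hq hx).le
  have h2 := abs_shiftRem_le ha ha1 hx.le
  rw [abs_le] at h1 h2
  rw [shiftDiff, abs_le]
  constructor <;> linarith

theorem shiftDiff_of_lt {a q x : ℝ} (hq : 1 ≤ q) (hx : 0 < x) (hxa : q * x < a) :
    shiftDiff a q x = (1 - q) * x := by
  rw [shiftDiff, shiftRem_of_lt hxa, shiftRem_of_lt (by nlinarith)]
  ring

@[fun_prop]
theorem measurable_shiftDiff (a q : ℝ) : Measurable (shiftDiff a q) := by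
  unfold shiftDiff
  exact ((measurable_shiftRem a).comp (by fun_prop)).sub (measurable_shiftRem a)

theorem integrableOn_shiftDiff_sq {a q σ : ℝ} (ha : 0 < a) (ha1 : a ≤ 1) (hq : 1 ≤ q)
    (hσ : 0 < σ) (hσ1 : σ < 1) :
    IntegrableOn (fun x => shiftDiff a q x ^ 2 * x ^ (-2 * σ - 1)) (Set.Ioi 0) := by
  have hq0 : 0 < q := by linarith
  have hb : ∀ x : ℝ, 0 < x → shiftDiff a q x ^ 2 ≤ 4 := fun x hx => by
    rw [← sq_abs]
    nlinarith [abs_shiftDiff_le_two ha ha1 hq0 hx, abs_nonneg (shiftDiff a q x)]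
  have hmc : MellinConvergent (fun x => ((shiftDiff a q x ^ 2 : ℝ) : ℂ)) ((-2 * σ : ℝ) : ℂ) := by
    have hb' : ∀ x : ℝ, 0 < x → ‖((shiftDiff a q x ^ 2 : ℝ) : ℂ)‖ ≤ 4 := fun x hx => by
      rw [norm_real, Real.norm_of_nonneg (sq_nonneg _)]
      exact hb x hx
    refine mellinConvergent_of_isBigO_rpow (a := 0) (b := -2)
      (locallyIntegrableOn_of_measurable_bounded (by fun_prop) hb')
      (isBigO_one_atTop_of_bounded hb') (by simpa using hσ) ?_ (by rw [ofReal_re]; linarith)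
    refine Asymptotics.IsBigO.of_bound ((1 - q) ^ 2) ?_
    filter_upwards [nhdsWithin_le_nhds (Iio_mem_nhds (div_pos ha hq0)), self_mem_nhdsWithin]
      with x hx hx0
    rw [shiftDiff_of_lt hq hx0 (by rw [mul_comm]; exact (lt_div_iff₀ hq0).1 hx), norm_real,
      Real.norm_of_nonneg (sq_nonneg _), neg_neg,
      Real.norm_of_nonneg (Real.rpow_nonneg (le_of_lt hx0) _), mul_pow]
    norm_num
  refine IntegrableOn.congr_fun (Integrable.norm hmc) (fun x hx => ?_) measurableSet_Ioi
  have hx : 0 < x := hx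
  simp only [norm_smul]
  rw [norm_cpow_eq_rpow_re_of_pos hx, norm_real, Real.norm_of_nonneg (sq_nonneg _), mul_comm,
    sub_re, ofReal_re, one_re]

/-- The weighted second moment of the Hurwitz zeta function on a line in the critical strip. -/
theorem integral_dilationWeight_mul_hzeta {a q σ : ℝ} (ha : 0 < a) (ha1 : a ≤ 1) (hq : 1 ≤ q)
    (hσ : 0 < σ) (hσ1 : σ < 1) :
    IntegrableOn (fun t : ℝ => dilationWeight q σ t * ‖hzeta a (σ + t * I)‖ ^ 2) (Set.Ioi 0) ∧
      ∫ t in Set.Ioi (0 : ℝ), dilationWeight q σ t * ‖hzeta a (σ + t * I)‖ ^ 2 =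
        Real.pi * shiftVar a q σ := by
  have hq0 : 0 < q := by linarith
  have hM : ∀ s : ℂ, 0 < s.re → s.re < 1 → s.im ≠ 0 →
      ‖mellin (fun x => (shiftDiff a q x : ℂ)) (-s)‖ ^ 2 =
        dilationWeight q s.re s.im * ‖hzeta a s‖ ^ 2 := by
    intro s h0 h1 h2
    have hs0 : s ≠ 0 := by
      rintro rfl
      simp at h0
    rw [(hasMellin_shiftDiff ha ha1 hq0 h0 h1).2, dilationWeight, re_add_im,
      hzeta_eq_mellin_shiftRem ha ha1 h0 h1 h2, norm_mul, norm_mul]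
    have := norm_pos_iff.2 hs0
    field_simp
  have hconj : ∀ t : ℝ, starRingEnd ℂ (σ + t * I) = σ + (-t : ℝ) * I := fun t => by
    simp
  have heven : ∀ t : ℝ, t ≠ 0 →
      ‖mellin (fun x => (shiftDiff a q x : ℂ)) ((-σ : ℝ) + t * I)‖ ^ 2 =
        dilationWeight q σ |t| * ‖hzeta a (σ + |t| * I)‖ ^ 2 := by
    intro t ht
    have h1 : (((-σ : ℝ) : ℂ) + t * I) = -(σ + (-t : ℝ) * I) := by
      push_cast
      ring
    rw [h1, hM _ (by simpa) (by simpa) (by simpa)]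
    have hw : ∀ t, dilationWeight q σ (-t) = dilationWeight q σ t := by
      intro t
      rw [dilationWeight, ← hconj, norm_conj, ← conj_ofReal_cpow hq0.le, dilationWeight,
        ← norm_conj ((q : ℂ) ^ (σ + t * I : ℂ) - 1), map_sub, map_one]
    have hz : ‖hzeta a (σ + (-t : ℝ) * I)‖ = ‖hzeta a (σ + t * I)‖ := by
      rw [← hconj]
      exact norm_hzeta_conj ha ha1 (by simpa) (by simpa) (by simpa)
    rw [hz]
    simp only [add_re, ofReal_re, mul_re, I_re, mul_zero, ofReal_im, I_im, mul_one, sub_self,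
      add_zero, add_im, mul_im, zero_add, ofReal_neg, neg_re, neg_im, neg_zero]
    rcases abs_choice t with h | h
    · rw [h, hw]
    · rw [h, hz, hw]
  have hD2 : ∀ x : ℝ, ‖(shiftDiff a q x : ℂ)‖ ^ 2 * x ^ (2 * (-σ) - 1) =
      shiftDiff a q x ^ 2 * x ^ (-2 * σ - 1) := fun x => by
    rw [norm_real, Real.norm_eq_abs, sq_abs, mul_neg, neg_mul]
  have hP := integral_norm_sq_mellin (D := fun x => (shiftDiff a q x : ℂ)) (σ := -σ)
    (by
      have := (hasMellin_shiftDiff ha ha1 hq0 (s := σ) (by simpa) (by simpa)).1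
      simpa using this)
    (by
      simp only [hD2]
      exact integrableOn_shiftDiff_sq ha ha1 hq hσ hσ1)
  simp only [hD2] at hP
  have hae : (fun t : ℝ => ‖mellin (fun x => (shiftDiff a q x : ℂ)) ((-σ : ℝ) + t * I)‖ ^ 2)
      =ᵐ[volume] fun t => dilationWeight q σ |t| * ‖hzeta a (σ + |t| * I)‖ ^ 2 := by
    filter_upwards [compl_mem_ae_iff.2 (measure_singleton (0 : ℝ))] with t ht
    exact heven t ht
  constructor
  · exact ((hP.1.congr hae).integrableOn).congr_fun (fun t ht => by
      simp only [abs_of_pos (Set.mem_Ioi.1 ht)]) measurableSet_Ioi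
  · have h2 := hP.2
    rw [integral_congr_ae hae, integral_comp_abs
      (f := fun t => dilationWeight q σ t * ‖hzeta a (σ + t * I)‖ ^ 2)] at h2
    rw [shiftVar]
    linarith

theorem shiftCount_rpow_nonneg {a p x : ℝ} (hx : 0 ≤ x) :
    0 ≤ (shiftCount a x : ℝ) * x ^ (-p - 1) := by positivity

theorem shiftCount_rpow_le {a p x : ℝ} (ha : 0 < a) (ha1 : a ≤ 1) (hx : 0 < x) :
    (shiftCount a x : ℝ) * x ^ (-p - 1) ≤ (1 + 1 / a) * x ^ (-p) := by
  have hN : (shiftCount a x : ℝ) ≤ (1 + 1 / a) * x := by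
    rcases lt_or_ge x a with h | h
    · rw [shiftCount_of_lt h]
      push_cast
      positivity
    · have h1 := shiftCount_le ha1 hx.le
      have h2 : 1 ≤ 1 / a * x := by
        rw [one_div_mul_eq_div, le_div_iff₀ ha]
        linarith
      linarith
  calc _ ≤ (1 + 1 / a) * x * x ^ (-p - 1) := by gcongr
    _ = _ := by
      rw [Real.rpow_sub_one hx.ne']
      field_simp

theorem intervalIntegrable_shiftCount_rpow {a p : ℝ} (ha : 0 < a) (ha1 : a ≤ 1) (hp : 0 < p)
    {x y : ℝ} (hx : 0 ≤ x) (hy : 0 ≤ y) :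
    IntervalIntegrable (fun x => (shiftCount a x : ℝ) * x ^ (-p - 1)) volume x y := by
  rw [intervalIntegrable_iff]
  refine Measure.integrableOn_of_bounded (M := (1 + 1 / a) * a ^ (-p))
    (by rw [Set.uIoc]; exact measure_Ioc_lt_top.ne) (by fun_prop)
    ((ae_restrict_iff' measurableSet_uIoc).2 (Eventually.of_forall fun t ht => ?_))
  have ht0 : 0 < t := (le_min hx hy).trans_lt ht.1
  rw [Real.norm_of_nonneg (shiftCount_rpow_nonneg ht0.le)]
  rcases lt_or_ge t a with h | h
  · rw [shiftCount_of_lt h]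
    push_cast
    rw [zero_mul]
    positivity
  · refine (shiftCount_rpow_le ha ha1 ht0).trans ?_
    exact mul_le_mul_of_nonneg_left
      (Real.rpow_le_rpow_of_nonpos ha h (neg_nonpos.2 hp.le)) (by positivity)

/-- Number of shifted integers in `(x, q * x]`. -/
noncomputable def shiftCountDiff (a q x : ℝ) : ℝ := (shiftCount a (q * x) : ℝ) - shiftCount a x

theorem shiftDiff_eq (a q x : ℝ) : shiftDiff a q x = shiftCountDiff a q x - (q - 1) * x := by
  rw [shiftDiff, shiftRem, shiftRem, shiftCountDiff]
  ring

theorem shiftCountDiff_sq {a q x : ℝ} (ha1 : a ≤ 1) (hq : 1 ≤ q) (hx : 0 ≤ x)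
    (hqx : (q - 1) * x ≤ 1) : shiftCountDiff a q x ^ 2 = shiftCountDiff a q x := by
  have h1 := shiftCount_le ha1 (by nlinarith : 0 ≤ q * x)
  have h2 := lt_shiftCount (a := a) (x := x)
  have h3 : shiftCount a x ≤ shiftCount a (q * x) := shiftCount_mono a (by nlinarith)
  have h4 : (shiftCount a (q * x) : ℝ) < shiftCount a x + 2 := by linarith
  have h5 : shiftCount a (q * x) < shiftCount a x + 2 := by exact_mod_cast h4
  have h6 : shiftCount a (q * x) = shiftCount a x ∨
      shiftCount a (q * x) = shiftCount a x + 1 := by omega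
  rcases h6 with h | h <;> simp [shiftCountDiff, h]

theorem integral_shiftCountDiff {a q p X : ℝ} (ha : 0 < a) (ha1 : a ≤ 1) (hp : 0 < p)
    (hq : 1 ≤ q) (hX : 0 ≤ X) :
    IntervalIntegrable (fun x => shiftCountDiff a q x * x ^ (-p - 1)) volume 0 X ∧
    ∫ x in (0 : ℝ)..X, shiftCountDiff a q x * x ^ (-p - 1) =
      (q ^ p - 1) * (∫ x in (0 : ℝ)..X, (shiftCount a x : ℝ) * x ^ (-p - 1)) +
        q ^ p * ∫ x in X..(q * X), (shiftCount a x : ℝ) * x ^ (-p - 1) := by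
  have hq0 : 0 < q := by linarith
  set f : ℝ → ℝ := fun x => (shiftCount a x : ℝ) * x ^ (-p - 1) with hf
  have hint : ∀ {x y : ℝ}, 0 ≤ x → 0 ≤ y → IntervalIntegrable f volume x y :=
    intervalIntegrable_shiftCount_rpow ha ha1 hp
  have heq : Set.EqOn (fun x => q ^ (p + 1) * f (q * x) - f x)
      (fun x => shiftCountDiff a q x * x ^ (-p - 1)) (Set.uIoc 0 X) := by
    intro x hx
    rw [Set.uIoc_of_le hX] at hx
    have hx0 := hx.1
    simp only [hf, shiftCountDiff]
    rw [Real.mul_rpow hq0.le hx0.le, show -p - 1 = -(p + 1) by ring, Real.rpow_neg hq0.le]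
    have : q ^ (p + 1) ≠ 0 := by positivity
    field_simp
  have hc : IntervalIntegrable (fun x => f (q * x)) volume 0 X := by
    have := (hint le_rfl (by positivity : 0 ≤ q * X)).comp_mul_left (c := q)
    simpa [mul_div_cancel_left₀ _ hq0.ne'] using this
  have hi := (hc.const_mul (q ^ (p + 1))).sub (hint le_rfl hX)
  refine ⟨hi.congr heq, ?_⟩
  rw [← intervalIntegral.integral_congr_ae (Eventually.of_forall heq), intervalIntegral.integral_sub
    (hc.const_mul _) (hint le_rfl hX), intervalIntegral.integral_const_mul,
    intervalIntegral.integral_comp_mul_left _ hq0.ne', mul_zero,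
    ← intervalIntegral.integral_add_adjacent_intervals (hint le_rfl hX)
      (hint hX (by positivity : 0 ≤ q * X)), Real.rpow_add_one hq0.ne', smul_eq_mul]
  field_simp
  ring

theorem integral_shiftCount_le {a p X : ℝ} (ha : 0 < a) (ha1 : a ≤ 1) (hp : 0 < p) (hX : a ≤ X) :
    ∫ x in (0 : ℝ)..X, (shiftCount a x : ℝ) * x ^ (-p - 1) ≤
      (1 + 1 / a) * ∫ x in a..X, x ^ (-p) := by
  have hX0 : 0 ≤ X := ha.le.trans hX
  rw [← intervalIntegral.integral_add_adjacent_intervals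
    (intervalIntegrable_shiftCount_rpow ha ha1 hp le_rfl ha.le)
    (intervalIntegrable_shiftCount_rpow ha ha1 hp ha.le hX0)]
  have h0 : ∫ x in (0 : ℝ)..a, (shiftCount a x : ℝ) * x ^ (-p - 1) = 0 := by
    rw [intervalIntegral.integral_of_le ha.le, integral_Ioc_eq_integral_Ioo]
    refine setIntegral_eq_zero_of_forall_eq_zero fun x hx => ?_
    rw [shiftCount_of_lt hx.2]
    simp
  rw [h0, zero_add, ← intervalIntegral.integral_const_mul]
  refine intervalIntegral.integral_mono_on hX
    (intervalIntegrable_shiftCount_rpow ha ha1 hp ha.le hX0) ?_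
    fun x hx => shiftCount_rpow_le ha ha1 (ha.trans_le hx.1)
  refine (intervalIntegral.intervalIntegrable_rpow (Or.inr ?_)).const_mul _
  rw [Set.uIcc_of_le hX]
  exact fun h => absurd h.1 (not_le.2 ha)

theorem integral_shiftCount_short_le {a q p X : ℝ} (ha : 0 < a) (ha1 : a ≤ 1) (hp : 0 < p)
    (hq : 1 ≤ q) (hX : 0 < X) :
    ∫ x in X..(q * X), (shiftCount a x : ℝ) * x ^ (-p - 1) ≤
      (1 + 1 / a) * ((q - 1) * X * X ^ (-p)) := by
  have hXq : X ≤ q * X := by nlinarith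
  have h1 : ∫ x in X..(q * X), (shiftCount a x : ℝ) * x ^ (-p - 1) ≤
      ∫ _ in X..(q * X), (1 + 1 / a) * X ^ (-p) := by
    refine intervalIntegral.integral_mono_on hXq
      (intervalIntegrable_shiftCount_rpow ha ha1 hp hX.le (hX.le.trans hXq))
      intervalIntegrable_const fun x hx => ?_
    refine (shiftCount_rpow_le ha ha1 (hX.trans_le hx.1)).trans ?_
    exact mul_le_mul_of_nonneg_left
      (Real.rpow_le_rpow_of_nonpos hX hx.1 (neg_nonpos.2 hp.le)) (by positivity)
  rw [intervalIntegral.integral_const, smul_eq_mul] at h1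
  refine h1.trans (le_of_eq ?_)
  ring

theorem le_integral_shiftCount {a p X : ℝ} (ha : 0 < a) (ha1 : a ≤ 1) (hp : 0 < p) (hX : 2 ≤ X) :
    (1 / 2) * ∫ x in (2 : ℝ)..X, x ^ (-p) ≤
      ∫ x in (0 : ℝ)..X, (shiftCount a x : ℝ) * x ^ (-p - 1) := by
  have hX0 : 0 ≤ X := by linarith
  rw [← intervalIntegral.integral_add_adjacent_intervals
    (intervalIntegrable_shiftCount_rpow ha ha1 hp le_rfl zero_le_two)
    (intervalIntegrable_shiftCount_rpow ha ha1 hp zero_le_two hX0),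
    ← intervalIntegral.integral_const_mul]
  refine le_add_of_nonneg_of_le (intervalIntegral.integral_nonneg zero_le_two fun x hx =>
    shiftCount_rpow_nonneg hx.1) ?_
  refine intervalIntegral.integral_mono_on hX ?_
    (intervalIntegrable_shiftCount_rpow ha ha1 hp zero_le_two hX0) fun x hx => ?_
  · refine (intervalIntegral.intervalIntegrable_rpow (Or.inr ?_)).const_mul _
    rw [Set.uIcc_of_le hX]
    exact fun h => absurd h.1 (not_le.2 zero_lt_two)
  · have hx0 : 0 < x := by linarith [hx.1]
    have h1 := lt_shiftCount (a := a) (x := x)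
    have h2 : 1 / 2 * x ≤ shiftCount a x := by linarith [hx.1]
    calc 1 / 2 * x ^ (-p) = 1 / 2 * x * x ^ (-p - 1) := by
          rw [Real.rpow_sub_one hx0.ne']
          field_simp
      _ ≤ _ := by gcongr

theorem integral_sq_mul_rpow {p X : ℝ} (hp1 : p ≤ 1) (hX : 0 ≤ X) :
    IntervalIntegrable (fun x : ℝ => x ^ 2 * x ^ (-p - 1)) volume 0 X ∧
      ∫ x in (0 : ℝ)..X, x ^ 2 * x ^ (-p - 1) ≤ X ^ (2 - p) := by
  have heq : Set.EqOn (fun x : ℝ => x ^ (1 - p)) (fun x : ℝ => x ^ 2 * x ^ (-p - 1))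
      (Set.uIoc 0 X) := by
    intro x hx
    rw [Set.uIoc_of_le hX] at hx
    simp only
    rw [← Real.rpow_natCast, ← Real.rpow_add hx.1]
    congr 1
    push_cast
    ring
  have hi : IntervalIntegrable (fun x : ℝ => x ^ (1 - p)) volume 0 X :=
    intervalIntegral.intervalIntegrable_rpow' (by linarith)
  refine ⟨hi.congr heq, ?_⟩
  rw [← intervalIntegral.integral_congr_ae (Eventually.of_forall heq),
    integral_rpow (Or.inl (by linarith)),
    show 1 - p + 1 = 2 - p by ring, Real.zero_rpow (by linarith), sub_zero]
  exact div_le_self (by positivity) (by linarith)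

theorem shiftVar_le {a σ T : ℝ} (ha : 0 < a) (ha1 : a ≤ 1) (hσ : 0 < σ) (hσ1 : σ ≤ 1 / 2)
    (hT : 1 ≤ T) :
    shiftVar a (1 + 1 / T) σ ≤ 2 * (1 + 1 / a) * ((∫ x in a..T, x ^ (-(2 * σ))) / T) +
      (4 * (1 + 1 / a) + 2 + 4 / (2 * σ)) * T ^ (-(2 * σ)) := by
  set p := 2 * σ with hp
  set q := 1 + 1 / T with hq
  have hp0 : 0 < p := by positivity
  have hp1 : p ≤ 1 := by linarith
  have hT0 : 0 < T := by linarith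
  have hq1 : 1 ≤ q := by
    rw [hq]
    have : 0 < 1 / T := by positivity
    linarith
  have hqT : (q - 1) * T = 1 := by
    rw [hq]
    field_simp
    ring
  have hq2 : q ≤ 2 := by nlinarith
  have hqp : q ^ p ≤ q := by
    simpa using Real.rpow_le_rpow_of_exponent_le hq1 hp1
  have hqp1 : 1 ≤ q ^ p := Real.one_le_rpow hq1 hp0.le
  have hint := integrableOn_shiftDiff_sq (q := q) ha ha1 hq1 hσ (by linarith)
  rw [show (-2 * σ - 1) = -p - 1 by rw [hp]; ring] at hint
  have hunion : Set.Ioi (0 : ℝ) = Set.Ioc 0 T ∪ Set.Ioi T := (Set.Ioc_union_Ioi_eq_Ioi hT0.le).symm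
  rw [shiftVar, show (-2 * σ - 1) = -p - 1 by rw [hp]; ring, hunion,
    setIntegral_union (Set.Ioc_disjoint_Ioi le_rfl) measurableSet_Ioi
      (hint.mono_set Set.Ioc_subset_Ioi_self) (hint.mono_set (Set.Ioi_subset_Ioi hT0.le)),
    ← intervalIntegral.integral_of_le hT0.le]
  obtain ⟨hi1, he1⟩ := integral_shiftCountDiff (q := q) ha ha1 hp0 hq1 hT0.le
  obtain ⟨hi2, he2⟩ := integral_sq_mul_rpow hp1 hT0.le
  have hlow : ∫ x in (0 : ℝ)..T, shiftDiff a q x ^ 2 * x ^ (-p - 1) ≤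
      ∫ x in (0 : ℝ)..T, (2 * (shiftCountDiff a q x * x ^ (-p - 1)) +
        2 * (q - 1) ^ 2 * (x ^ 2 * x ^ (-p - 1))) := by
    refine intervalIntegral.integral_mono_on hT0.le ?_ ((hi1.const_mul 2).add (hi2.const_mul _))
      fun x hx => ?_
    · rw [intervalIntegrable_iff, Set.uIoc_of_le hT0.le]
      exact hint.mono_set Set.Ioc_subset_Ioi_self
    · have h1 := shiftCountDiff_sq (q := q) ha1 hq1 hx.1 (by nlinarith [hx.2])
      have h2 : 0 ≤ x ^ (-p - 1) := Real.rpow_nonneg hx.1 _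
      have h3 : shiftDiff a q x ^ 2 ≤ 2 * shiftCountDiff a q x + 2 * (q - 1) ^ 2 * x ^ 2 := by
        rw [shiftDiff_eq]
        nlinarith [h1, sq_nonneg (shiftCountDiff a q x + (q - 1) * x)]
      nlinarith
  rw [intervalIntegral.integral_add (hi1.const_mul 2) (hi2.const_mul _),
    intervalIntegral.integral_const_mul, intervalIntegral.integral_const_mul, he1] at hlow
  have htail : ∫ x in Set.Ioi T, shiftDiff a q x ^ 2 * x ^ (-p - 1) ≤ 4 / p * T ^ (-p) := by
    have h1 : ∫ x in Set.Ioi T, shiftDiff a q x ^ 2 * x ^ (-p - 1) ≤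
        ∫ x in Set.Ioi T, 4 * x ^ (-p - 1) := by
      refine setIntegral_mono_on (hint.mono_set (Set.Ioi_subset_Ioi hT0.le))
        ((integrableOn_Ioi_rpow_of_lt (by linarith) hT0).const_mul 4) measurableSet_Ioi
        fun x hx => ?_
      have hx0 : 0 < x := hT0.trans hx
      have h2 := abs_shiftDiff_le_two (q := q) ha ha1 (by linarith) hx0
      have h3 : shiftDiff a q x ^ 2 ≤ 4 := by
        rw [← sq_abs]
        nlinarith [abs_nonneg (shiftDiff a q x)]
      exact mul_le_mul_of_nonneg_right h3 (by positivity)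
    rw [integral_const_mul, integral_Ioi_rpow_of_lt (by linarith) hT0, sub_add_cancel,
      neg_div_neg_eq] at h1
    refine h1.trans (le_of_eq ?_)
    ring
  have hA : 0 < 1 + 1 / a := by positivity
  have hc1 := integral_shiftCount_le (p := p) ha ha1 hp0 (by linarith : a ≤ T)
  have hc2 := integral_shiftCount_short_le (q := q) (p := p) ha ha1 hp0 hq1 hT0
  rw [hqT, one_mul] at hc2
  have hL : 0 ≤ ∫ x in a..T, x ^ (-p) := intervalIntegral.integral_nonneg (by linarith)
    fun x hx => Real.rpow_nonneg (ha.le.trans hx.1) _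
  have hTp : 0 < T ^ (-p) := by positivity
  have hb1 : (q ^ p - 1) * (∫ x in (0 : ℝ)..T, (shiftCount a x : ℝ) * x ^ (-p - 1)) ≤
      (1 + 1 / a) * ((∫ x in a..T, x ^ (-p)) / T) := by
    calc _ ≤ (q ^ p - 1) * ((1 + 1 / a) * ∫ x in a..T, x ^ (-p)) := by
          gcongr
      _ ≤ (1 / T) * ((1 + 1 / a) * ∫ x in a..T, x ^ (-p)) := by
          gcongr
          linarith
      _ = _ := by ring
  have hb2 : q ^ p * (∫ x in T..(q * T), (shiftCount a x : ℝ) * x ^ (-p - 1)) ≤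
      2 * ((1 + 1 / a) * T ^ (-p)) := by
    calc _ ≤ q ^ p * ((1 + 1 / a) * T ^ (-p)) := by gcongr
      _ ≤ _ := by
        gcongr
        linarith
  have hb3 : (q - 1) ^ 2 * (∫ x in (0 : ℝ)..T, x ^ 2 * x ^ (-p - 1)) ≤ T ^ (-p) := by
    calc _ ≤ (q - 1) ^ 2 * T ^ (2 - p) := by gcongr
      _ = ((q - 1) * T) ^ 2 * T ^ (-p) := by
        rw [sub_eq_add_neg 2 p, Real.rpow_add hT0, Real.rpow_two]
        ring
      _ = _ := by rw [hqT]; ring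
  linarith

theorem le_shiftVar {a σ T θ : ℝ} (ha : 0 < a) (ha1 : a ≤ 1) (hσ : 0 < σ) (hσ1 : σ ≤ 1 / 2)
    (hT : 1 ≤ T) (hθ : 0 < θ) (hθ1 : θ ≤ 1) (hθT : 2 ≤ θ * T) :
    2 * σ / (8 * T) * (∫ x in (2 : ℝ)..(θ * T), x ^ (-(2 * σ))) -
      θ ^ (2 - 2 * σ) * T ^ (-(2 * σ)) ≤ shiftVar a (1 + 1 / T) σ := by
  set p := 2 * σ with hp
  set q := 1 + 1 / T with hq
  have hp0 : 0 < p := by positivity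
  have hp1 : p ≤ 1 := by linarith
  have hT0 : 0 < T := by linarith
  have hX0 : 0 < θ * T := by linarith
  have hq1 : 1 ≤ q := by
    rw [hq]
    have : 0 < 1 / T := by positivity
    linarith
  have hq0 : 0 < q := by linarith
  have hqT : (q - 1) * T = 1 := by
    rw [hq]
    field_simp
    ring
  have hqp : p / (2 * T) ≤ q ^ p - 1 := by
    have h1 : 1 - q⁻¹ ≤ Real.log q := Real.one_sub_inv_le_log_of_pos hq0
    have h2 : 1 / (2 * T) ≤ 1 - q⁻¹ := by
      have : 1 - q⁻¹ = 1 / (T + 1) := by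
        rw [hq]
        field_simp
        ring
      rw [this]
      exact one_div_le_one_div_of_le (by linarith) (by linarith)
    have h3 : Real.log q * p + 1 ≤ q ^ p := by
      rw [Real.rpow_def_of_pos hq0]
      exact Real.add_one_le_exp _
    calc p / (2 * T) = p * (1 / (2 * T)) := by ring
      _ ≤ p * Real.log q := by
        gcongr
        linarith
      _ ≤ _ := by linarith
  have hint := integrableOn_shiftDiff_sq (q := q) ha ha1 hq1 hσ (by linarith)
  rw [show (-2 * σ - 1) = -p - 1 by rw [hp]; ring] at hint
  obtain ⟨hi1, he1⟩ := integral_shiftCountDiff (q := q) ha ha1 hp0 hq1 hX0.le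
  obtain ⟨hi2, he2⟩ := integral_sq_mul_rpow hp1 hX0.le
  have hcut : ∫ x in (0 : ℝ)..(θ * T), shiftDiff a q x ^ 2 * x ^ (-p - 1) ≤ shiftVar a q σ := by
    rw [shiftVar, show (-2 * σ - 1) = -p - 1 by rw [hp]; ring,
      intervalIntegral.integral_of_le hX0.le]
    refine setIntegral_mono_set hint ?_ Set.Ioc_subset_Ioi_self.eventuallyLE
    exact (ae_restrict_iff' measurableSet_Ioi).2 (Eventually.of_forall fun x hx =>
      mul_nonneg (sq_nonneg _) (Real.rpow_nonneg (le_of_lt hx) _))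
  have hlow : ∫ x in (0 : ℝ)..(θ * T), (1 / 2 * (shiftCountDiff a q x * x ^ (-p - 1)) -
        (q - 1) ^ 2 * (x ^ 2 * x ^ (-p - 1))) ≤
      ∫ x in (0 : ℝ)..(θ * T), shiftDiff a q x ^ 2 * x ^ (-p - 1) := by
    refine intervalIntegral.integral_mono_on hX0.le ((hi1.const_mul _).sub (hi2.const_mul _)) ?_
      fun x hx => ?_
    · rw [intervalIntegrable_iff, Set.uIoc_of_le hX0.le]
      exact hint.mono_set Set.Ioc_subset_Ioi_self
    · have hxT : x ≤ T := hx.2.trans (by nlinarith)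
      have h1 := shiftCountDiff_sq (q := q) ha1 hq1 hx.1 (by nlinarith [hx.2])
      have h2 : 0 ≤ x ^ (-p - 1) := Real.rpow_nonneg hx.1 _
      have h3 : 1 / 2 * shiftCountDiff a q x - (q - 1) ^ 2 * x ^ 2 ≤ shiftDiff a q x ^ 2 := by
        rw [shiftDiff_eq]
        nlinarith [h1, sq_nonneg (shiftCountDiff a q x - 2 * ((q - 1) * x))]
      nlinarith
  rw [intervalIntegral.integral_sub (hi1.const_mul _) (hi2.const_mul _),
    intervalIntegral.integral_const_mul, intervalIntegral.integral_const_mul, he1] at hlow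
  have hc := le_integral_shiftCount (p := p) ha ha1 hp0 hθT
  have hL : 0 ≤ ∫ x in (2 : ℝ)..(θ * T), x ^ (-p) := intervalIntegral.integral_nonneg hθT
    fun x hx => Real.rpow_nonneg (zero_le_two.trans hx.1) _
  have hb1 : p / (2 * T) * (1 / 2 * ∫ x in (2 : ℝ)..(θ * T), x ^ (-p)) ≤
      (q ^ p - 1) * (∫ x in (0 : ℝ)..(θ * T), (shiftCount a x : ℝ) * x ^ (-p - 1)) :=
    mul_le_mul hqp hc (by positivity) (le_trans (by positivity) hqp)
  have hb2 : 0 ≤ q ^ p * ∫ x in (θ * T)..(q * (θ * T)), (shiftCount a x : ℝ) * x ^ (-p - 1) :=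
    mul_nonneg (by positivity) (intervalIntegral.integral_nonneg (by nlinarith)
      fun x hx => shiftCount_rpow_nonneg (hX0.le.trans hx.1))
  have hb3 : (q - 1) ^ 2 * (∫ x in (0 : ℝ)..(θ * T), x ^ 2 * x ^ (-p - 1)) ≤
      θ ^ (2 - p) * T ^ (-p) := by
    calc _ ≤ (q - 1) ^ 2 * (θ * T) ^ (2 - p) := by gcongr
      _ = ((q - 1) * T) ^ 2 * (θ ^ (2 - p) * T ^ (-p)) := by
        rw [Real.mul_rpow hθ.le hT0.le, sub_eq_add_neg 2 p, Real.rpow_add hT0, Real.rpow_two]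
        ring
      _ = _ := by rw [hqT]; ring
  have hb4 : p / (8 * T) * (∫ x in (2 : ℝ)..(θ * T), x ^ (-p)) =
      1 / 2 * (p / (2 * T) * (1 / 2 * ∫ x in (2 : ℝ)..(θ * T), x ^ (-p))) := by ring
  linarith

theorem log_one_add_one_div_bounds {T : ℝ} (hT : 1 ≤ T) :
    1 / (2 * T) ≤ Real.log (1 + 1 / T) ∧ Real.log (1 + 1 / T) ≤ 1 / T := by
  have hT0 : 0 < T := by linarith
  have hq0 : 0 < 1 + 1 / T := by positivity
  constructor
  · refine le_trans ?_ (Real.one_sub_inv_le_log_of_pos hq0)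
    have : 1 - (1 + 1 / T)⁻¹ = 1 / (T + 1) := by
      field_simp
      ring
    rw [this]
    exact one_div_le_one_div_of_le (by linarith) (by linarith)
  · linarith [Real.log_le_sub_one_of_pos hq0]

theorem ofReal_cpow_eq_exp {q : ℝ} (hq : 0 < q) (s : ℂ) :
    (q : ℂ) ^ s = Complex.exp ((Real.log q : ℝ) * s) := by
  rw [Complex.cpow_def_of_ne_zero (by exact_mod_cast hq.ne'), Complex.ofReal_log hq.le]

theorem norm_ofReal_mul_of_nonneg {L : ℝ} (hL : 0 ≤ L) (s : ℂ) : ‖((L : ℝ) : ℂ) * s‖ = L * ‖s‖ := by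
  rw [norm_mul, Complex.norm_real, Real.norm_of_nonneg hL]

theorem abs_im_le_norm_add_mul_I (σ t : ℝ) : |t| ≤ ‖(σ + t * I : ℂ)‖ := by
  simpa using Complex.abs_im_le_norm (σ + t * I : ℂ)

theorem le_dilationWeight {σ T t : ℝ} (hσ : 0 ≤ σ) (hσ1 : σ ≤ 1 / 2) (hT : 2 ≤ T) (ht : 0 < t)
    (htT : t ≤ T / 4) : 1 / (16 * T ^ 2) ≤ dilationWeight (1 + 1 / T) σ t := by
  have hT0 : 0 < T := by linarith
  obtain ⟨hL1, hL2⟩ := log_one_add_one_div_bounds (by linarith : 1 ≤ T)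
  rw [dilationWeight, ofReal_cpow_eq_exp (by positivity)]
  set L := Real.log (1 + 1 / T)
  set s : ℂ := σ + t * I
  have hL0 : 0 < L := lt_of_lt_of_le (by positivity) hL1
  have hs0 : 0 < ‖s‖ := ht.trans_le ((le_abs_self t).trans (abs_im_le_norm_add_mul_I σ t))
  have hs : ‖s‖ ≤ σ + t := by
    refine (norm_add_le _ _).trans (le_of_eq ?_)
    rw [norm_mul, Complex.norm_I, Complex.norm_real, Complex.norm_real, Real.norm_of_nonneg hσ,
      Real.norm_of_nonneg ht.le, mul_one]
  have hz : ‖(L : ℂ) * s‖ ≤ 1 / 2 := by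
    rw [norm_ofReal_mul_of_nonneg hL0.le]
    calc L * ‖s‖ ≤ 1 / T * (T / 2) := by
          gcongr
          linarith
      _ = 1 / 2 := by field_simp
  have h1 := Complex.norm_exp_sub_one_sub_id_le (hz.trans (by norm_num))
  have h2 := norm_sub_norm_le ((L : ℂ) * s) (-(Complex.exp ((L : ℂ) * s) - 1 - (L : ℂ) * s))
  rw [norm_neg, sub_neg_eq_add, add_sub_cancel] at h2
  have h3 : L / 2 * ‖s‖ ≤ ‖Complex.exp ((L : ℂ) * s) - 1‖ := by
    have := norm_ofReal_mul_of_nonneg hL0.le s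
    nlinarith [norm_nonneg ((L : ℂ) * s)]
  have h4 : 1 / (4 * T) ≤ ‖Complex.exp ((L : ℂ) * s) - 1‖ / ‖s‖ := by
    rw [le_div_iff₀ hs0]
    refine le_trans (mul_le_mul_of_nonneg_right ?_ hs0.le) h3
    calc 1 / (4 * T) = 1 / (2 * T) / 2 := by
          field_simp
          norm_num
      _ ≤ L / 2 := by gcongr
  calc 1 / (16 * T ^ 2) = (1 / (4 * T)) ^ 2 := by
        field_simp
        norm_num
    _ ≤ _ := by gcongr

theorem norm_ofReal_cpow_sub_one_le {q σ t : ℝ} (hq : 1 ≤ q) (hq2 : q ≤ 2) (hσ1 : σ ≤ 1) :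
    ‖(q : ℂ) ^ (σ + t * I : ℂ) - 1‖ ≤ 3 := by
  have h1 : ‖(q : ℂ) ^ (σ + t * I : ℂ)‖ ≤ 2 := by
    rw [Complex.norm_cpow_eq_rpow_re_of_pos (by linarith)]
    have := Real.rpow_le_rpow_of_exponent_le hq hσ1
    simp only [Complex.add_re, Complex.ofReal_re, Complex.mul_re, Complex.I_re, mul_zero,
      Complex.ofReal_im, Complex.I_im, mul_one, sub_self, add_zero]
    rw [Real.rpow_one] at this
    linarith
  refine (norm_sub_le _ _).trans ?_
  rw [norm_one]
  linarith

theorem dilationWeight_le {σ T t : ℝ} (hσ1 : σ ≤ 1) (hT : 1 ≤ T) (ht : 0 < t) :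
    dilationWeight (1 + 1 / T) σ t ≤ 9 / T ^ 2 := by
  have hT0 : 0 < T := by linarith
  have hT1 : 1 / T ≤ 1 := by rw [div_le_one hT0]; exact hT
  have hT2 : 0 < 1 / T := by positivity
  obtain ⟨hL1, hL2⟩ := log_one_add_one_div_bounds hT
  have hb := norm_ofReal_cpow_sub_one_le (t := t) (by linarith : 1 ≤ 1 + 1 / T) (by linarith) hσ1
  rw [dilationWeight]
  rw [ofReal_cpow_eq_exp (by positivity)] at hb ⊢
  set L := Real.log (1 + 1 / T)
  set s : ℂ := σ + t * I
  have hL0 : 0 < L := lt_of_lt_of_le (by positivity) hL1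
  have hs0 : 0 < ‖s‖ := ht.trans_le ((le_abs_self t).trans (abs_im_le_norm_add_mul_I σ t))
  have hLs : L * ‖s‖ ≤ 1 / T * ‖s‖ := by gcongr
  have h1 : ‖Complex.exp ((L : ℂ) * s) - 1‖ ≤ 3 / T * ‖s‖ := by
    have hn := norm_ofReal_mul_of_nonneg hL0.le s
    have h3 : 3 / T * ‖s‖ = 3 * (1 / T * ‖s‖) := by ring
    rcases le_or_gt ‖(L : ℂ) * s‖ 1 with hz | hz
    · have := Complex.norm_exp_sub_one_le hz
      nlinarith [norm_nonneg ((L : ℂ) * s)]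
    · linarith
  calc _ ≤ (3 / T) ^ 2 := by
        refine pow_le_pow_left₀ (by positivity) ?_ 2
        rw [div_le_iff₀ hs0]
        exact h1
    _ = 9 / T ^ 2 := by ring

theorem dilationWeight_le_of_pos {σ T t : ℝ} (hσ1 : σ ≤ 1) (hT : 1 ≤ T) (ht : 0 < t) :
    dilationWeight (1 + 1 / T) σ t ≤ 9 / t ^ 2 := by
  have hT0 : 0 < T := by linarith
  have hT1 : 1 / T ≤ 1 := by rw [div_le_one hT0]; exact hT
  have hT2 : 0 < 1 / T := by positivity
  have hb := norm_ofReal_cpow_sub_one_le (t := t) (by linarith : 1 ≤ 1 + 1 / T) (by linarith) hσ1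
  have hs := (le_abs_self t).trans (abs_im_le_norm_add_mul_I σ t)
  rw [dilationWeight]
  calc _ ≤ (3 / t) ^ 2 := by gcongr
    _ = 9 / t ^ 2 := by ring

theorem continuous_hzeta_vertical {σ : ℝ} (a : ℝ) (hσ : σ ≠ 1) :
    Continuous fun t : ℝ => hzeta a (σ + t * I) := by
  rw [continuous_iff_continuousAt]
  intro t
  have h : (σ + t * I : ℂ) ≠ 1 := by
    intro h
    have := congrArg Complex.re h
    simp at this
    exact hσ this
  exact ContinuousAt.comp (f := fun t : ℝ => (σ + t * I : ℂ))
    (g := hzeta a) (HurwitzZeta.differentiableAt_hurwitzZeta _ h).continuousAt (by fun_prop)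

theorem integral_norm_hzeta_sq_le {a σ T : ℝ} (ha : 0 < a) (ha1 : a ≤ 1) (hσ : 0 < σ)
    (hσ1 : σ ≤ 1 / 2) (hT : 2 ≤ T) :
    ∫ t in (0 : ℝ)..(T / 4), ‖hzeta a (σ + t * I)‖ ^ 2 ≤
      16 * Real.pi * (T ^ 2 * shiftVar a (1 + 1 / T) σ) := by
  have hT0 : 0 < T := by linarith
  have hT4 : 0 ≤ T / 4 := by linarith
  have hq : 1 ≤ 1 + 1 / T := by
    have : 0 < 1 / T := by positivity
    linarith
  obtain ⟨hint, heq⟩ := integral_dilationWeight_mul_hzeta ha ha1 hq hσ (by linarith : σ < 1)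
  have h1 : ∫ t in Set.Ioc (0 : ℝ) (T / 4), 1 / (16 * T ^ 2) * ‖hzeta a (σ + t * I)‖ ^ 2 ≤
      ∫ t in Set.Ioc (0 : ℝ) (T / 4), dilationWeight (1 + 1 / T) σ t *
        ‖hzeta a (σ + t * I)‖ ^ 2 := by
    refine setIntegral_mono_on ?_ (hint.mono_set Set.Ioc_subset_Ioi_self) measurableSet_Ioc
      fun t ht => mul_le_mul_of_nonneg_right (le_dilationWeight hσ.le hσ1 hT ht.1 ht.2)
        (by positivity)
    have hc := continuous_hzeta_vertical a (by linarith : σ ≠ 1)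
    exact (Continuous.integrableOn_Ioc (by fun_prop))
  have h2 : ∫ t in Set.Ioc (0 : ℝ) (T / 4), dilationWeight (1 + 1 / T) σ t *
        ‖hzeta a (σ + t * I)‖ ^ 2 ≤ Real.pi * shiftVar a (1 + 1 / T) σ := by
    rw [← heq]
    refine setIntegral_mono_set hint ?_ Set.Ioc_subset_Ioi_self.eventuallyLE
    exact Eventually.of_forall fun t => mul_nonneg (sq_nonneg _) (sq_nonneg _)
  rw [integral_const_mul] at h1
  rw [intervalIntegral.integral_of_le hT4]
  have h3 := h1.trans h2
  rw [one_div_mul_eq_div, div_le_iff₀ (by positivity)] at h3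
  linarith

theorem shiftVar_le_integral {a σ T X M : ℝ} (ha : 0 < a) (ha1 : a ≤ 1) (hσ : 0 < σ)
    (hσ1 : σ ≤ 1 / 2) (hT : 1 ≤ T) (hX : 0 < X)
    (hM : ∀ Y ≥ X, ∫ t in X..Y, (t ^ 2)⁻¹ * ‖hzeta a (σ + t * I)‖ ^ 2 ≤ M) :
    shiftVar a (1 + 1 / T) σ ≤
      9 / Real.pi * ((T ^ 2)⁻¹ * (∫ t in (0 : ℝ)..X, ‖hzeta a (σ + t * I)‖ ^ 2) + M) := by
  have hT0 : 0 < T := by linarith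
  have hq : 1 ≤ 1 + 1 / T := by
    have : 0 < 1 / T := by positivity
    linarith
  obtain ⟨hint, heq⟩ := integral_dilationWeight_mul_hzeta ha ha1 hq hσ (by linarith : σ < 1)
  have hc := continuous_hzeta_vertical a (by linarith : σ ≠ 1)
  set w : ℝ → ℝ := fun t => dilationWeight (1 + 1 / T) σ t * ‖hzeta a (σ + t * I)‖ ^ 2 with hw
  have hlim := intervalIntegral_tendsto_integral_Ioi 0 hint tendsto_id
  have hbound : ∀ Y ≥ X, ∫ t in (0 : ℝ)..Y, w t ≤
      9 * ((T ^ 2)⁻¹ * (∫ t in (0 : ℝ)..X, ‖hzeta a (σ + t * I)‖ ^ 2) + M) := by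
    intro Y hY
    have hi1 : IntervalIntegrable w volume 0 X := by
      rw [intervalIntegrable_iff, Set.uIoc_of_le hX.le]
      exact hint.mono_set Set.Ioc_subset_Ioi_self
    have hi2 : IntervalIntegrable w volume X Y := by
      rw [intervalIntegrable_iff, Set.uIoc_of_le hY]
      exact hint.mono_set fun t ht => hX.trans ht.1
    rw [← intervalIntegral.integral_add_adjacent_intervals hi1 hi2, mul_add]
    refine add_le_add ?_ ?_
    · rw [← mul_assoc, ← intervalIntegral.integral_const_mul]
      refine intervalIntegral.integral_mono_on_of_le_Ioo hX.le hi1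
        (Continuous.intervalIntegrable (by fun_prop) _ _) fun t ht => ?_
      refine mul_le_mul_of_nonneg_right ?_ (by positivity)
      exact dilationWeight_le (by linarith) hT ht.1
    · refine le_trans ?_ (mul_le_mul_of_nonneg_left (hM Y hY) (by norm_num : (0 : ℝ) ≤ 9))
      rw [← intervalIntegral.integral_const_mul]
      refine intervalIntegral.integral_mono_on hY hi2 ?_ fun t ht => ?_
      · refine ContinuousOn.intervalIntegrable ?_
        rw [Set.uIcc_of_le hY]
        refine continuousOn_const.mul (ContinuousOn.mul (ContinuousOn.inv₀ (by fun_prop)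
          fun t ht => ?_)
          (hc.norm.pow 2).continuousOn)
        have : 0 < t := hX.trans_le ht.1
        positivity
      · rw [← mul_assoc]
        refine mul_le_mul_of_nonneg_right ?_ (by positivity)
        exact dilationWeight_le_of_pos (by linarith) hT (hX.trans_le ht.1)
  have hle := le_of_tendsto hlim ((eventually_ge_atTop X).mono hbound)
  rw [heq] at hle
  rw [div_mul_eq_mul_div, le_div_iff₀ Real.pi_pos]
  linarith

/-- Integration by parts bound for the tail of a second-moment integral. -/
theorem integral_inv_sq_mul_le {g Φ : ℝ → ℝ} {A β X Y : ℝ} (hg : Continuous g)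
    (hg0 : ∀ t, 0 ≤ g t) (hβ : β < 2) (hX : 0 < X) (hXY : X ≤ Y) (hA : 0 ≤ A) (hΦ : 0 ≤ Φ X)
    (hG : ∀ y ≥ X, ∫ t in (0 : ℝ)..y, g t ≤ A * Φ y)
    (hgrowth : ∀ y ≥ X, Φ y ≤ Φ X * (y / X) ^ β) :
    ∫ t in X..Y, (t ^ 2)⁻¹ * g t ≤ A * (1 + 2 / (2 - β)) * (Φ X / X ^ 2) := by
  have hY0 : 0 < Y := hX.trans_le hXY
  set G : ℝ → ℝ := fun y => ∫ t in (0 : ℝ)..y, g t with hGdef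
  have hGd : ∀ y, HasDerivAt G (g y) y := fun y => by
    exact intervalIntegral.integral_hasDerivAt_right (hg.intervalIntegrable _ _)
      (hg.stronglyMeasurableAtFilter _ _) hg.continuousAt
  have hGc : Continuous G := continuous_iff_continuousAt.2 fun y => (hGd y).continuousAt
  have hG0 : ∀ y, 0 ≤ y → 0 ≤ G y := fun y hy =>
    intervalIntegral.integral_nonneg hy fun t _ => hg0 t
  have hGb : ∀ y ≥ X, G y ≤ A * Φ X * X ^ (-β) * y ^ β := by
    intro y hy
    have hy0 : 0 < y := hX.trans_le hy
    calc G y ≤ A * Φ y := hG y hy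
      _ ≤ A * (Φ X * (y / X) ^ β) := by
        gcongr
        exact hgrowth y hy
      _ = _ := by
        rw [Real.div_rpow hy0.le hX.le, Real.rpow_neg hX.le]
        ring
  have hu : ∀ t ∈ Set.uIcc X Y, HasDerivAt (fun t : ℝ => (t ^ 2)⁻¹) (-2 * (t ^ 3)⁻¹) t := by
    intro t ht
    rw [Set.uIcc_of_le hXY] at ht
    have ht0 : 0 < t := hX.trans_le ht.1
    have h := (hasDerivAt_pow 2 t).fun_inv (by positivity)
    refine h.congr_deriv ?_
    push_cast
    field_simp
  have hcont : ContinuousOn (fun t : ℝ => (t ^ 3)⁻¹) (Set.uIcc X Y) := by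
    rw [Set.uIcc_of_le hXY]
    refine ContinuousOn.inv₀ (by fun_prop) fun t ht => ?_
    have : 0 < t := hX.trans_le ht.1
    positivity
  have hparts := intervalIntegral.integral_mul_deriv_eq_deriv_mul hu (fun t _ => hGd t)
    (hcont.const_smul (-2 : ℝ)).intervalIntegrable (hg.intervalIntegrable _ _)
  have hrest : ∫ t in X..Y, (t ^ 3)⁻¹ * G t ≤
      ∫ t in X..Y, A * Φ X * X ^ (-β) * t ^ (β - 3) := by
    refine intervalIntegral.integral_mono_on hXY
      (hcont.mul hGc.continuousOn).intervalIntegrable ?_ fun t ht => ?_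
    · refine (intervalIntegral.intervalIntegrable_rpow (Or.inr ?_)).const_mul _
      rw [Set.uIcc_of_le hXY]
      exact fun h => absurd h.1 (not_le.2 hX)
    · have ht0 : 0 < t := hX.trans_le ht.1
      calc (t ^ 3)⁻¹ * G t ≤ (t ^ 3)⁻¹ * (A * Φ X * X ^ (-β) * t ^ β) := by
            gcongr
            exact hGb t ht.1
        _ = _ := by
          rw [show t ^ (β - 3) = t ^ β * (t ^ 3)⁻¹ by
            rw [Real.rpow_sub ht0, ← Real.rpow_natCast t 3]
            push_cast
            rfl]
          ring
  rw [intervalIntegral.integral_const_mul, integral_rpow (Or.inr ⟨by linarith, by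
    rw [Set.uIcc_of_le hXY]
    exact fun h => absurd h.1 (not_le.2 hX)⟩), show β - 3 + 1 = -(2 - β) by ring] at hrest
  have hYb := hGb Y hXY
  have hXX : X ^ (-β) * X ^ (-(2 - β)) = (X ^ 2)⁻¹ := by
    rw [← Real.rpow_add hX, show -β + -(2 - β) = -2 by ring, Real.rpow_neg hX.le, Real.rpow_two]
  have hYX : Y ^ β * (Y ^ 2)⁻¹ ≤ X ^ (-(2 - β)) := by
    have : Y ^ β * (Y ^ 2)⁻¹ = Y ^ (-(2 - β)) := by
      rw [show -(2 - β) = β - 2 by ring, Real.rpow_sub hY0, Real.rpow_two, div_eq_mul_inv]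
    rw [this]
    exact Real.rpow_le_rpow_of_nonpos hX hXY (by linarith)
  have hK : 0 ≤ A * Φ X * X ^ (-β) := by positivity
  have e1 : (Y ^ 2)⁻¹ * G Y ≤ A * Φ X * (X ^ 2)⁻¹ := by
    calc (Y ^ 2)⁻¹ * G Y ≤ (Y ^ 2)⁻¹ * (A * Φ X * X ^ (-β) * Y ^ β) := by gcongr
      _ = A * Φ X * X ^ (-β) * (Y ^ β * (Y ^ 2)⁻¹) := by ring
      _ ≤ A * Φ X * X ^ (-β) * X ^ (-(2 - β)) := by gcongr
      _ = _ := by rw [mul_assoc, hXX]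
  have e2 : A * Φ X * X ^ (-β) * ((Y ^ (-(2 - β)) - X ^ (-(2 - β))) / -(2 - β)) ≤
      A * Φ X * (X ^ 2)⁻¹ / (2 - β) := by
    have h2β : 0 < 2 - β := by linarith
    rw [← hXX, div_neg, ← neg_div, ← mul_div_assoc, ← mul_assoc]
    gcongr
    have : 0 ≤ Y ^ (-(2 - β)) := by positivity
    linarith
  have e3 : 0 ≤ (X ^ 2)⁻¹ * G X := mul_nonneg (by positivity) (hG0 X hX.le)
  have hsplit : ∫ t in X..Y, -2 * (t ^ 3)⁻¹ * G t = -2 * ∫ t in X..Y, (t ^ 3)⁻¹ * G t := by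
    rw [← intervalIntegral.integral_const_mul]
    simp only [mul_assoc]
  rw [hparts, hsplit]
  calc _ ≤ A * Φ X * (X ^ 2)⁻¹ + 2 * (A * Φ X * (X ^ 2)⁻¹ / (2 - β)) := by linarith
    _ = _ := by ring

theorem exists_integral_bounds_of_dilation {g R Φ : ℝ → ℝ} {β c C T₁ : ℝ} (hg : Continuous g)
    (hg0 : ∀ t, 0 ≤ g t) (hβ : β < 2) (hc : 0 < c) (hC : 0 < C) (hT₁ : 0 < T₁)
    (hup : ∀ T ≥ T₁, ∫ t in (0 : ℝ)..(T / 4), g t ≤ C * (T ^ 2 * R T))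
    (hlow : ∀ T ≥ T₁, ∀ X > 0, ∀ M, (∀ Y ≥ X, ∫ t in X..Y, (t ^ 2)⁻¹ * g t ≤ M) →
      R T ≤ C * ((T ^ 2)⁻¹ * (∫ t in (0 : ℝ)..X, g t) + M))
    (hR : ∀ T ≥ T₁, c * Φ T ≤ T ^ 2 * R T ∧ T ^ 2 * R T ≤ C * Φ T)
    (hΦ : ∀ T ≥ T₁, 0 < Φ T)
    (hgrowth : ∀ X ≥ T₁, ∀ y ≥ X, Φ y ≤ Φ X * (y / X) ^ β) :
    ∃ c₁ > (0 : ℝ), ∃ c₂ > (0 : ℝ), ∃ T₀ : ℝ, ∀ T ≥ T₀,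
      c₁ * Φ T ≤ ∫ t in (0 : ℝ)..T, g t ∧ ∫ t in (0 : ℝ)..T, g t ≤ c₂ * Φ T := by
  set A := C * (C * 4 ^ β) with hAdef
  have hA : 0 < A := by positivity
  have hG : ∀ T ≥ T₁, ∫ t in (0 : ℝ)..T, g t ≤ A * Φ T := by
    intro T hT
    have hT0 : 0 < T := hT₁.trans_le hT
    have h4 : 4 * T ≥ T₁ := by linarith
    have h1 := hup (4 * T) h4
    rw [mul_div_cancel_left₀ T (four_ne_zero)] at h1
    have h2 := hgrowth T hT (4 * T) (by linarith)
    rw [mul_div_cancel_right₀ _ hT0.ne'] at h2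
    calc _ ≤ C * ((4 * T) ^ 2 * R (4 * T)) := h1
      _ ≤ C * (C * Φ (4 * T)) := mul_le_mul_of_nonneg_left (hR _ h4).2 hC.le
      _ ≤ C * (C * (Φ T * 4 ^ β)) := by gcongr
      _ = _ := by rw [hAdef]; ring
  set B := A * (1 + 2 / (2 - β)) with hBdef
  have h2β : 0 < 2 - β := by linarith
  have hB : 0 < B := by positivity
  obtain ⟨K, hK, hK1⟩ : ∃ K : ℝ, C * B * K ^ (-(2 - β)) < c / 2 ∧ 1 ≤ K := by
    have h1 := (tendsto_rpow_neg_atTop h2β).const_mul (C * B)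
    rw [mul_zero] at h1
    exact ((h1.eventually_lt_const (half_pos hc)).and (eventually_ge_atTop 1)).exists
  have hK0 : 0 < K := by linarith
  refine ⟨c / 2 / C * K ^ (-β), by positivity, A, hA, K * T₁, fun T hT => ?_⟩
  have hTT₁ : T₁ ≤ T := le_trans (by nlinarith) hT
  have hT0 : 0 < T := hT₁.trans_le hTT₁
  refine ⟨?_, hG T hTT₁⟩
  have hS : T / K ≥ T₁ := by
    rw [ge_iff_le, le_div_iff₀ hK0]
    linarith
  have hS0 : 0 < T / K := by positivity
  have hST : T / K ≤ T := div_le_self hT0.le hK1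
  have h1 := hlow (T / K) hS T hT0 (B * (Φ T / T ^ 2)) fun Y hY =>
    integral_inv_sq_mul_le hg hg0 hβ hT0 hY hA.le (hΦ T hTT₁).le
      (fun y hy => hG y (hTT₁.trans hy)) (fun y hy => hgrowth T hTT₁ y hy)
  have h2 := hgrowth (T / K) hS T hST
  have hTK : T / (T / K) = K := by field_simp
  rw [hTK] at h2
  have h3 : c * Φ (T / K) ≤ C * ((∫ t in (0 : ℝ)..T, g t) + B * (Φ T * (K ^ 2)⁻¹)) := by
    calc _ ≤ (T / K) ^ 2 * R (T / K) := (hR _ hS).1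
      _ ≤ (T / K) ^ 2 * (C * (((T / K) ^ 2)⁻¹ * (∫ t in (0 : ℝ)..T, g t) +
          B * (Φ T / T ^ 2))) := by gcongr
      _ = _ := by field_simp
  have h4 : Φ T * (K ^ 2)⁻¹ ≤ Φ (T / K) * K ^ (-(2 - β)) := by
    calc _ ≤ Φ (T / K) * K ^ β * (K ^ 2)⁻¹ := by gcongr
      _ = _ := by
        rw [show -(2 - β) = β - 2 by ring, Real.rpow_sub hK0, Real.rpow_two]
        ring
  have h5 : c / 2 * Φ (T / K) ≤ C * ∫ t in (0 : ℝ)..T, g t := by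
    have h6 : C * B * (Φ T * (K ^ 2)⁻¹) ≤ C * B * (Φ (T / K) * K ^ (-(2 - β))) := by gcongr
    have h7 := mul_le_mul_of_nonneg_right hK.le (hΦ _ hS).le
    nlinarith
  have h8 : K ^ (-β) * Φ T ≤ Φ (T / K) := by
    rw [Real.rpow_neg hK0.le, inv_mul_le_iff₀ (by positivity)]
    linarith
  calc c / 2 / C * K ^ (-β) * Φ T = c / 2 / C * (K ^ (-β) * Φ T) := by ring
    _ ≤ c / 2 / C * Φ (T / K) := by gcongr
    _ = (c / 2 * Φ (T / K)) / C := by ring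
    _ ≤ _ := by
      rw [div_le_iff₀ hC]
      linarith

theorem exists_integral_norm_hzeta_sq_bounds {Φ : ℝ → ℝ} {a σ β c C T₁ : ℝ} (ha : 0 < a)
    (ha1 : a ≤ 1) (hσ : 0 < σ) (hσ1 : σ ≤ 1 / 2) (hβ : β < 2) (hc : 0 < c) (hT₁ : 2 ≤ T₁)
    (hlow : ∀ T ≥ T₁, c * Φ T ≤ T ^ 2 * shiftVar a (1 + 1 / T) σ)
    (hup : ∀ T ≥ T₁, T ^ 2 * shiftVar a (1 + 1 / T) σ ≤ C * Φ T)
    (hΦ : ∀ T ≥ T₁, 0 < Φ T)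
    (hgrowth : ∀ X ≥ T₁, ∀ y ≥ X, Φ y ≤ Φ X * (y / X) ^ β) :
    ∃ c₁ > (0 : ℝ), ∃ c₂ > (0 : ℝ), ∃ T₀ : ℝ, ∀ T ≥ T₀,
      c₁ * Φ T ≤ ∫ t in (0 : ℝ)..T, ‖hzeta a (σ + t * I)‖ ^ 2 ∧
      ∫ t in (0 : ℝ)..T, ‖hzeta a (σ + t * I)‖ ^ 2 ≤ c₂ * Φ T := by
  have hpi := Real.pi_gt_three
  have hpos : ∀ T ≥ T₁, 0 < T ^ 2 * shiftVar a (1 + 1 / T) σ := fun T hT =>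
    (mul_pos hc (hΦ T hT)).trans_le (hlow T hT)
  have hcont := continuous_hzeta_vertical a (by linarith : σ ≠ 1)
  refine exists_integral_bounds_of_dilation (g := fun t => ‖hzeta a (σ + t * I)‖ ^ 2)
    (R := fun T => shiftVar a (1 + 1 / T) σ) (C := max C (16 * Real.pi)) (T₁ := T₁)
    (by fun_prop) (fun t => by positivity) hβ hc (lt_max_of_lt_right (by positivity))
    (by linarith) (fun T hT => ?_) (fun T hT X hX M hM => ?_) (fun T hT => ⟨hlow T hT, ?_⟩)
    hΦ hgrowth
  · exact (integral_norm_hzeta_sq_le ha ha1 hσ hσ1 (hT₁.trans hT)).trans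
      (mul_le_mul_of_nonneg_right (le_max_right _ _) (hpos T hT).le)
  · have h := shiftVar_le_integral ha ha1 hσ hσ1 (by linarith : 1 ≤ T) hX hM
    have hR : 0 < shiftVar a (1 + 1 / T) σ := pos_of_mul_pos_right (hpos T hT) (sq_nonneg T)
    have hb := pos_of_mul_pos_right (hR.trans_le h) (by positivity)
    refine h.trans (mul_le_mul_of_nonneg_right (le_trans ?_ (le_max_right _ _)) hb.le)
    rw [div_le_iff₀ Real.pi_pos]
    nlinarith
  · exact (hup T hT).trans (mul_le_mul_of_nonneg_right (le_max_left _ _) (hΦ T hT).le)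

theorem exists_integral_norm_hzeta_sq_bounds_half {a : ℝ} (ha : 0 < a) (ha1 : a ≤ 1) :
    ∃ c₁ > (0 : ℝ), ∃ c₂ > (0 : ℝ), ∃ T₀ : ℝ, ∀ T ≥ T₀,
      c₁ * (T * Real.log T) ≤ ∫ t in (0 : ℝ)..T, ‖hzeta a ((1 / 2 : ℝ) + t * I)‖ ^ 2 ∧
      ∫ t in (0 : ℝ)..T, ‖hzeta a ((1 / 2 : ℝ) + t * I)‖ ^ 2 ≤ c₂ * (T * Real.log T) := by
  have hlog2 : Real.log 2 ≤ 1 := by linarith [Real.log_two_lt_d9]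
  have hE : 21 ≤ Real.exp 20 := by linarith [Real.add_one_le_exp 20]
  have hlog : ∀ T ≥ Real.exp 20, 20 ≤ Real.log T := fun T hT => by
    rw [Real.le_log_iff_exp_le (by linarith)]
    exact hT
  have hp : (-(2 * (1 / 2)) : ℝ) = -1 := by norm_num
  have hla : Real.log a ≤ 0 := Real.log_nonpos ha.le ha1
  refine exists_integral_norm_hzeta_sq_bounds (Φ := fun T => T * Real.log T) (β := 3 / 2)
    (c := 1 / 16) (C := 2 * (1 + 1 / a) * (1 - Real.log a) + (4 * (1 + 1 / a) + 6))
    (T₁ := Real.exp 20) ha ha1 (by norm_num) le_rfl (by norm_num) (by norm_num) (by linarith)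
    (fun T hT => ?_) (fun T hT => ?_) (fun T hT => ?_) (fun X hX y hy => ?_)
  · have hT0 : 0 < T := by linarith
    have h := le_shiftVar ha ha1 (by norm_num : (0 : ℝ) < 1 / 2) le_rfl (by linarith : 1 ≤ T)
      one_pos le_rfl (by linarith)
    rw [hp] at h
    simp only [Real.rpow_neg_one] at h
    rw [integral_inv_of_pos two_pos (by linarith), one_mul, Real.log_div hT0.ne' two_ne_zero,
      Real.one_rpow] at h
    have h2 := mul_le_mul_of_nonneg_left h (sq_nonneg T)
    refine le_trans ?_ h2
    have h3 : T ^ 2 * (2 * (1 / 2) / (8 * T) * (Real.log T - Real.log 2) - 1 * T⁻¹) =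
        T * ((Real.log T - Real.log 2 - 8) / 8) := by
      field_simp
    rw [h3]
    nlinarith [hlog T hT]
  · have hT0 : 0 < T := by linarith
    have h := shiftVar_le ha ha1 (by norm_num : (0 : ℝ) < 1 / 2) le_rfl (by linarith : 1 ≤ T)
    rw [hp] at h
    simp only [Real.rpow_neg_one] at h
    rw [integral_inv_of_pos ha hT0, Real.log_div hT0.ne' ha.ne'] at h
    refine (mul_le_mul_of_nonneg_left h (sq_nonneg T)).trans ?_
    have hA : 0 < 1 / a := by positivity
    have h3 : T ^ 2 * (2 * (1 + 1 / a) * ((Real.log T - Real.log a) / T) +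
        (4 * (1 + 1 / a) + 2 + 4 / (2 * (1 / 2))) * T⁻¹) =
        T * (2 * (1 + 1 / a) * (Real.log T - Real.log a) + (4 * (1 + 1 / a) + 6)) := by
      field_simp
      ring
    rw [h3]
    have hl := hlog T hT
    have h4 : 2 * (1 + 1 / a) * (Real.log T - Real.log a) ≤
        2 * (1 + 1 / a) * ((1 - Real.log a) * Real.log T) := by
      gcongr
      nlinarith
    have h5 : 4 * (1 + 1 / a) + 6 ≤ (4 * (1 + 1 / a) + 6) * Real.log T := by nlinarith
    calc _ ≤ T * (2 * (1 + 1 / a) * ((1 - Real.log a) * Real.log T) +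
          (4 * (1 + 1 / a) + 6) * Real.log T) := by gcongr
      _ = _ := by ring
  · have := hlog T hT
    have hT0 : 0 < T := by linarith
    positivity
  · have hX0 : 0 < X := by linarith
    have hy0 : 0 < y := hX0.trans_le hy
    have hu : 1 ≤ y / X := (one_le_div hX0).2 hy
    have hu0 : 0 < y / X := by positivity
    have hyX : y = X * (y / X) := by field_simp
    have hs : 1 ≤ (y / X) ^ (1 / 2 : ℝ) := Real.one_le_rpow hu (by norm_num)
    have h1 : Real.log (y / X) = 2 * Real.log ((y / X) ^ (1 / 2 : ℝ)) := by
      rw [Real.log_rpow hu0]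
      ring
    have h2 := Real.log_le_sub_one_of_pos (by linarith : 0 < (y / X) ^ (1 / 2 : ℝ))
    have h3 : Real.log y ≤ Real.log X * (y / X) ^ (1 / 2 : ℝ) := by
      have := hlog X hX
      have h4 : Real.log y = Real.log X + Real.log (y / X) := by
        rw [Real.log_div hy0.ne' hX0.ne']
        ring
      nlinarith
    calc y * Real.log y ≤ y * (Real.log X * (y / X) ^ (1 / 2 : ℝ)) := by gcongr
      _ = X * Real.log X * ((y / X) ^ (1 : ℝ) * (y / X) ^ (1 / 2 : ℝ)) := by
        rw [Real.rpow_one]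
        field_simp
      _ = _ := by
        rw [← Real.rpow_add hu0]
        norm_num

theorem exists_integral_norm_hzeta_sq_bounds_lt_half {a σ : ℝ} (ha : 0 < a) (ha1 : a ≤ 1)
    (hσ : 0 < σ) (hσ1 : σ < 1 / 2) :
    ∃ c₁ > (0 : ℝ), ∃ c₂ > (0 : ℝ), ∃ T₀ : ℝ, ∀ T ≥ T₀,
      c₁ * T ^ (2 - 2 * σ) ≤ ∫ t in (0 : ℝ)..T, ‖hzeta a (σ + t * I)‖ ^ 2 ∧
      ∫ t in (0 : ℝ)..T, ‖hzeta a (σ + t * I)‖ ^ 2 ≤ c₂ * T ^ (2 - 2 * σ) := by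
  set p := 2 * σ with hp
  have hp0 : 0 < p := by positivity
  have hp1 : 0 < 1 - p := by linarith
  set θ := p / 32 with hθ
  have hθ0 : 0 < θ := by positivity
  have hθ1 : θ ≤ 1 := by linarith
  obtain ⟨T₁, hT₁⟩ : ∃ T₁ : ℝ, ∀ T ≥ T₁, 2 * 2 ^ (1 - p) ≤ (θ * T) ^ (1 - p) ∧ 2 ≤ θ * T ∧
      2 ≤ T := by
    have h1 : Tendsto (fun T : ℝ => θ * T) atTop atTop := tendsto_id.const_mul_atTop hθ0
    have h2 := (tendsto_rpow_atTop hp1).comp h1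
    exact eventually_atTop.1 ((h2.eventually_ge_atTop _).and
      ((h1.eventually_ge_atTop 2).and (eventually_ge_atTop 2)))
  have hsq : ∀ T > (0 : ℝ), T ^ 2 * T ^ (-p) = T ^ (2 - p) := fun T hT => by
    rw [sub_eq_add_neg, Real.rpow_add hT, Real.rpow_two]
  refine exists_integral_norm_hzeta_sq_bounds (Φ := fun T => T ^ (2 - p)) (β := 2 - p)
    (c := θ ^ (2 - p)) (C := 2 * (1 + 1 / a) / (1 - p) + (4 * (1 + 1 / a) + 2 + 4 / p))
    (T₁ := max T₁ 2) ha ha1 hσ hσ1.le (by linarith) (by positivity) (le_max_right _ _)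
    (fun T hT => ?_) (fun T hT => ?_) (fun T hT => ?_) (fun X hX y hy => ?_)
  · obtain ⟨h1, h2, h3⟩ := hT₁ T ((le_max_left _ _).trans hT)
    have hT0 : 0 < T := by linarith
    have h := le_shiftVar ha ha1 hσ hσ1.le (by linarith : 1 ≤ T) hθ0 hθ1 h2
    rw [← hp, integral_rpow (Or.inl (by linarith)), show -p + 1 = 1 - p by ring] at h
    rw [← hsq T hT0, mul_left_comm]
    refine mul_le_mul_of_nonneg_left (le_trans ?_ h) (sq_nonneg T)
    have h4 : (θ * T) ^ (1 - p) / 2 ≤ ((θ * T) ^ (1 - p) - 2 ^ (1 - p)) / (1 - p) := by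
      rw [le_div_iff₀ hp1]
      have : 0 < (θ * T) ^ (1 - p) := by positivity
      nlinarith
    have h5 : p / (8 * T) * ((θ * T) ^ (1 - p) / 2) = 2 * (θ ^ (2 - p) * T ^ (-p)) := by
      rw [Real.mul_rpow hθ0.le hT0.le, show 2 - p = 1 + (1 - p) by ring, Real.rpow_add hθ0,
        show 1 - p = 1 + -p by ring, Real.rpow_add hT0, Real.rpow_one, Real.rpow_one, hθ]
      field_simp
      norm_num
    have h6 : p / (8 * T) * ((θ * T) ^ (1 - p) / 2) ≤
        p / (8 * T) * (((θ * T) ^ (1 - p) - 2 ^ (1 - p)) / (1 - p)) := by gcongr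
    linarith
  · have hT2 : 2 ≤ T := (le_max_right _ _).trans hT
    have hT0 : 0 < T := by linarith
    have h := shiftVar_le ha ha1 hσ hσ1.le (by linarith : 1 ≤ T)
    rw [← hp, integral_rpow (Or.inl (by linarith)), show -p + 1 = 1 - p by ring] at h
    refine (mul_le_mul_of_nonneg_left h (sq_nonneg T)).trans ?_
    have h1 : (T ^ (1 - p) - a ^ (1 - p)) / (1 - p) / T ≤ T ^ (-p) / (1 - p) := by
      have h2 : T ^ (-p) = T ^ (1 - p) / T := by
        rw [← Real.rpow_sub_one hT0.ne']
        congr 1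
        ring
      rw [h2, div_right_comm]
      gcongr
      have : 0 < a ^ (1 - p) := by positivity
      linarith
    rw [← hsq T hT0]
    calc _ ≤ T ^ 2 * (2 * (1 + 1 / a) * (T ^ (-p) / (1 - p)) +
          (4 * (1 + 1 / a) + 2 + 4 / p) * T ^ (-p)) := by gcongr
      _ = _ := by ring
  · have hT2 : 2 ≤ T := (le_max_right _ _).trans hT
    have hT0 : 0 < T := by linarith
    positivity
  · have hX2 : 2 ≤ X := (le_max_right _ _).trans hX
    have hX0 : 0 < X := by linarith
    rw [← Real.mul_rpow hX0.le (div_nonneg (by linarith) hX0.le), mul_div_cancel₀ _ hX0.ne']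

theorem pCoeff_succ_self (m : ℕ) (a : ℝ) : pCoeff (m + 1) a m = (Nat.factorial m : ℝ)⁻¹ := by
  have hmonic : ∀ i ∈ Finset.range m,
      (Polynomial.X + Polynomial.C ((i : ℝ) + 1 - a)).Monic := fun i _ =>
    Polynomial.monic_X_add_C _
  have hdeg : (∏ i ∈ Finset.range m,
      (Polynomial.X + Polynomial.C ((i : ℝ) + 1 - a))).natDegree = m := by
    rw [Polynomial.natDegree_prod_of_monic _ _ hmonic]
    simp only [Polynomial.natDegree_X_add_C, Finset.sum_const, Finset.card_range, smul_eq_mul,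
      mul_one]
  have h1 := (Polynomial.monic_prod_of_monic _ _ hmonic).coeff_natDegree
  rw [hdeg] at h1
  rw [pCoeff, add_tsub_cancel_right, Polynomial.coeff_smul, h1, smul_eq_mul, mul_one]

theorem exists_norm_hzeta_le {a x : ℝ} (ha : 0 < a) (ha1 : a ≤ 1) (hx : 1 < x) :
    ∃ B, ∀ t : ℝ, ‖hzeta a (x + t * I)‖ ≤ B := by
  refine ⟨∑' n : ℕ, 1 / |(n : ℝ) + a| ^ x, fun t => ?_⟩
  have hs : 1 < (x + t * I : ℂ).re := by simpa using hx
  have hnorm : ∀ n : ℕ, ‖1 / ((n : ℂ) + a) ^ (x + t * I : ℂ)‖ = 1 / |(n : ℝ) + a| ^ x := by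
    intro n
    have hn : 0 < (n : ℝ) + a := by positivity
    rw [norm_div, norm_one, show (n : ℂ) + a = (((n : ℝ) + a : ℝ) : ℂ) by push_cast; rfl,
      Complex.norm_cpow_eq_rpow_re_of_pos hn, abs_of_pos hn]
    simp
  rw [hzeta, ← (HurwitzZeta.hasSum_hurwitzZeta_of_one_lt_re ⟨ha.le, ha1⟩ hs).tsum_eq]
  refine (norm_tsum_le_tsum_norm ?_).trans (le_of_eq (tsum_congr hnorm))
  simp only [hnorm]
  exact (Real.summable_one_div_nat_add_rpow a x).2 hx

theorem exists_norm_sum_hzeta_le {a σ : ℝ} (ha : 0 < a) (ha1 : a ≤ 1) (c : ℕ → ℂ) (m : ℕ)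
    (hσ : (m : ℝ) < σ) :
    ∃ B, ∀ t : ℝ, ‖∑ j ∈ Finset.range m, c j * hzeta a (σ + t * I - j)‖ ≤ B := by
  have h : ∀ j : ℕ, ∃ B, j ∈ Finset.range m → ∀ t : ℝ, ‖hzeta a (σ + t * I - j)‖ ≤ B := by
    intro j
    by_cases hj : j ∈ Finset.range m
    · have hj1 : (j : ℝ) + 1 ≤ m := by exact_mod_cast Finset.mem_range.1 hj
      obtain ⟨B, hB⟩ := exists_norm_hzeta_le ha ha1 (by linarith : 1 < σ - j)
      refine ⟨B, fun _ t => ?_⟩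
      convert hB t using 3
      push_cast
      ring
    · exact ⟨0, fun h => absurd h hj⟩
  choose B hB using h
  refine ⟨∑ j ∈ Finset.range m, ‖c j‖ * B j, fun t => (norm_sum_le _ _).trans
    (Finset.sum_le_sum fun j hj => ?_)⟩
  rw [norm_mul]
  exact mul_le_mul_of_nonneg_left (hB j hj t) (norm_nonneg _)

theorem exists_norm_zetaR_sub_le {a σ : ℝ} (ha : 0 < a) (ha1 : a ≤ 1) (m : ℕ) (hσ : 0 < σ) :
    ∃ B, ∀ t : ℝ, ‖zetaR (m + 1) a ((m + σ : ℝ) + t * I) -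
      ((Nat.factorial m : ℝ)⁻¹ : ℝ) * hzeta a (σ + t * I)‖ ≤ B := by
  obtain ⟨B, hB⟩ := exists_norm_sum_hzeta_le ha ha1 (fun j => (pCoeff (m + 1) a j : ℂ)) m
    (by linarith : (m : ℝ) < m + σ)
  refine ⟨B, fun t => ?_⟩
  rw [zetaR, Finset.sum_range_succ, pCoeff_succ_self,
    show ((m + σ : ℝ) : ℂ) + t * I - m = σ + t * I by push_cast; ring, add_sub_cancel_right]
  exact hB t

theorem continuous_zetaR_vertical {σ : ℝ} (a : ℝ) (m : ℕ) (hσ : 0 < σ) (hσ1 : σ < 1) :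
    Continuous fun t : ℝ => zetaR (m + 1) a ((m + σ : ℝ) + t * I) := by
  unfold zetaR
  refine continuous_finsetSum _ fun j hj => continuous_const.mul ?_
  have h : (m : ℝ) + σ - j ≠ 1 := by
    intro h
    rcases Nat.lt_or_ge j m with hj' | hj'
    · have : (j : ℝ) + 1 ≤ m := by exact_mod_cast hj'
      linarith
    · have : (m : ℝ) ≤ j := by exact_mod_cast hj'
      linarith
  have := continuous_hzeta_vertical a h
  refine this.congr fun t => ?_
  congr 1
  push_cast
  ring

theorem exists_integral_norm_sq_bounds_of_norm_sub_le {f g : ℝ → ℂ} {Φ : ℝ → ℝ} {κ B : ℝ}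
    (hf : Continuous f) (hg : Continuous g) (hκ : 0 < κ) (hfg : ∀ t, ‖f t - κ * g t‖ ≤ B)
    (hΦ : ∀ K : ℝ, ∀ᶠ T in atTop, K * T ≤ Φ T)
    (h : ∃ c₁ > (0 : ℝ), ∃ c₂ > (0 : ℝ), ∃ T₀ : ℝ, ∀ T ≥ T₀,
      c₁ * Φ T ≤ ∫ t in (0 : ℝ)..T, ‖g t‖ ^ 2 ∧ ∫ t in (0 : ℝ)..T, ‖g t‖ ^ 2 ≤ c₂ * Φ T) :
    ∃ c₁ > (0 : ℝ), ∃ c₂ > (0 : ℝ), ∃ T₀ : ℝ, ∀ T ≥ T₀,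
      c₁ * Φ T ≤ ∫ t in (1 : ℝ)..T, ‖f t‖ ^ 2 ∧ ∫ t in (1 : ℝ)..T, ‖f t‖ ^ 2 ≤ c₂ * Φ T := by
  obtain ⟨c₁, hc₁, c₂, hc₂, T₀, hT₀⟩ := h
  have hB : 0 ≤ B := (norm_nonneg _).trans (hfg 0)
  set D := ∫ t in (0 : ℝ)..1, ‖f t‖ ^ 2
  have hD : 0 ≤ D := intervalIntegral.integral_nonneg zero_le_one fun t _ => sq_nonneg _
  have hκg : ∀ t, ‖(κ : ℂ) * g t‖ = κ * ‖g t‖ := fun t => norm_ofReal_mul_of_nonneg hκ.le _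
  have hint : ∀ u v : ℝ, IntervalIntegrable (fun t => ‖f t‖ ^ 2) volume u v := fun u v =>
    (hf.norm.pow 2).intervalIntegrable u v
  have hintg : ∀ k u v : ℝ, IntervalIntegrable (fun t => k * ‖g t‖ ^ 2) volume u v :=
    fun k u v => ((hg.norm.pow 2).const_mul k).intervalIntegrable u v
  have hpt1 : ∀ t, ‖f t‖ ^ 2 ≤ 2 * κ ^ 2 * ‖g t‖ ^ 2 + 2 * B ^ 2 := by
    intro t
    have h1 := norm_add_le (f t - κ * g t) (κ * g t)
    rw [sub_add_cancel, hκg] at h1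
    have h2 : ‖f t‖ ≤ B + κ * ‖g t‖ := h1.trans (add_le_add_left (hfg t) _)
    have h3 : ‖f t‖ ^ 2 ≤ (B + κ * ‖g t‖) ^ 2 := by gcongr
    nlinarith [sq_nonneg (B - κ * ‖g t‖)]
  have hpt2 : ∀ t, κ ^ 2 / 2 * ‖g t‖ ^ 2 - B ^ 2 ≤ ‖f t‖ ^ 2 := by
    intro t
    have h1 := norm_sub_norm_le ((κ : ℂ) * g t) (f t)
    rw [norm_sub_rev, hκg] at h1
    have h2 : κ * ‖g t‖ ≤ B + ‖f t‖ := by linarith [hfg t]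
    have h3 : (κ * ‖g t‖) ^ 2 ≤ (B + ‖f t‖) ^ 2 := by gcongr
    nlinarith [sq_nonneg (B - ‖f t‖)]
  obtain ⟨T₁, hT₁⟩ := eventually_atTop.1 ((hΦ 1).and ((hΦ ((D + B ^ 2) / (κ ^ 2 * c₁ / 4))).and
    ((eventually_ge_atTop 1).and (eventually_ge_atTop T₀))))
  refine ⟨κ ^ 2 * c₁ / 4, by positivity, 2 * κ ^ 2 * c₂ + 2 * B ^ 2, by positivity, T₁,
    fun T hT => ?_⟩
  obtain ⟨hΦ1, hΦ2, hT1, hTT₀⟩ := hT₁ T hT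
  obtain ⟨hlow, hup⟩ := hT₀ T hTT₀
  have hT0 : 0 ≤ T := by linarith
  have hsplit := intervalIntegral.integral_add_adjacent_intervals (hint 0 1) (hint 1 T)
  constructor
  · have h1 : ∫ t in (0 : ℝ)..T, (κ ^ 2 / 2 * ‖g t‖ ^ 2 - B ^ 2) ≤ ∫ t in (0 : ℝ)..T, ‖f t‖ ^ 2 :=
      intervalIntegral.integral_mono_on hT0 ((hintg _ _ _).sub intervalIntegrable_const)
        (hint _ _) fun t _ => hpt2 t
    rw [intervalIntegral.integral_sub (hintg _ _ _) intervalIntegrable_const,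
      intervalIntegral.integral_const_mul, intervalIntegral.integral_const, smul_eq_mul,
      sub_zero] at h1
    rw [div_mul_eq_mul_div, div_le_iff₀ (by positivity)] at hΦ2
    have h2 : D ≤ D * T := le_mul_of_one_le_right hD hT1
    have h3 := mul_le_mul_of_nonneg_left hlow (by positivity : 0 ≤ κ ^ 2 / 2)
    linarith
  · have h1 : ∫ t in (0 : ℝ)..T, ‖f t‖ ^ 2 ≤
        ∫ t in (0 : ℝ)..T, (2 * κ ^ 2 * ‖g t‖ ^ 2 + 2 * B ^ 2) :=
      intervalIntegral.integral_mono_on hT0 (hint _ _)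
        ((hintg _ _ _).add intervalIntegrable_const) fun t _ => hpt1 t
    rw [intervalIntegral.integral_add (hintg _ _ _) intervalIntegrable_const,
      intervalIntegral.integral_const_mul, intervalIntegral.integral_const, smul_eq_mul,
      sub_zero] at h1
    have h3 := mul_le_mul_of_nonneg_left hup (by positivity : 0 ≤ 2 * κ ^ 2)
    have h4 := mul_le_mul_of_nonneg_left hΦ1 (by positivity : 0 ≤ 2 * B ^ 2)
    linarith

theorem exists_integral_norm_zetaR_sq_bounds {a σ : ℝ} {Φ : ℝ → ℝ} (ha : 0 < a) (ha1 : a ≤ 1)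
    (m : ℕ) (hσ : 0 < σ) (hσ1 : σ < 1) (hΦ : ∀ K : ℝ, ∀ᶠ T in atTop, K * T ≤ Φ T)
    (h : ∃ c₁ > (0 : ℝ), ∃ c₂ > (0 : ℝ), ∃ T₀ : ℝ, ∀ T ≥ T₀,
      c₁ * Φ T ≤ ∫ t in (0 : ℝ)..T, ‖hzeta a (σ + t * I)‖ ^ 2 ∧
      ∫ t in (0 : ℝ)..T, ‖hzeta a (σ + t * I)‖ ^ 2 ≤ c₂ * Φ T) :
    ∃ c₁ > (0 : ℝ), ∃ c₂ > (0 : ℝ), ∃ T₀ : ℝ, ∀ T ≥ T₀,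
      c₁ * Φ T ≤ ∫ t in (1 : ℝ)..T, ‖zetaR (m + 1) a ((m + σ : ℝ) + t * I)‖ ^ 2 ∧
      ∫ t in (1 : ℝ)..T, ‖zetaR (m + 1) a ((m + σ : ℝ) + t * I)‖ ^ 2 ≤ c₂ * Φ T := by
  obtain ⟨B, hB⟩ := exists_norm_zetaR_sub_le ha ha1 m hσ
  exact exists_integral_norm_sq_bounds_of_norm_sub_le (continuous_zetaR_vertical a m hσ hσ1)
    (continuous_hzeta_vertical a hσ1.ne) (by positivity) hB hΦ h

theorem stmt5 (r : ℕ) (hr : 1 ≤ r) (a : ℝ) (ha : 0 < a) (ha1 : a ≤ 1) :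
    (∃ c₁ > (0 : ℝ), ∃ c₂ > (0 : ℝ), ∃ T₀ : ℝ, ∀ T ≥ T₀,
      c₁ * (T * Real.log T) ≤
          (∫ t in (1 : ℝ)..T, ‖zetaR r a (((r : ℝ) - 1 / 2 : ℝ) + t * I)‖ ^ 2) ∧
      (∫ t in (1 : ℝ)..T, ‖zetaR r a (((r : ℝ) - 1 / 2 : ℝ) + t * I)‖ ^ 2) ≤
          c₂ * (T * Real.log T)) ∧
    (∀ σ : ℝ, (r : ℝ) - 1 < σ → σ < (r : ℝ) - 1 / 2 →
      ∃ c₁ > (0 : ℝ), ∃ c₂ > (0 : ℝ), ∃ T₀ : ℝ, ∀ T ≥ T₀,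
        c₁ * T ^ (2 * (r : ℝ) - 2 * σ) ≤
            (∫ t in (1 : ℝ)..T, ‖zetaR r a (σ + t * I)‖ ^ 2) ∧
        (∫ t in (1 : ℝ)..T, ‖zetaR r a (σ + t * I)‖ ^ 2) ≤
            c₂ * T ^ (2 * (r : ℝ) - 2 * σ)) := by
  obtain ⟨m, rfl⟩ := Nat.exists_eq_add_of_le' hr
  constructor
  · rw [show ((m + 1 : ℕ) : ℝ) - 1 / 2 = m + 1 / 2 by push_cast; ring]
    refine exists_integral_norm_zetaR_sq_bounds ha ha1 m (by norm_num) (by norm_num)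
      (fun K => ?_) (exists_integral_norm_hzeta_sq_bounds_half ha ha1)
    filter_upwards [Real.tendsto_log_atTop.eventually_ge_atTop K, eventually_ge_atTop 0]
      with T h1 h2
    rw [mul_comm]
    exact mul_le_mul_of_nonneg_left h1 h2
  · intro σ h1 h2
    push_cast at h1 h2
    obtain ⟨τ, rfl⟩ : ∃ τ, σ = m + τ := ⟨σ - m, by ring⟩
    rw [show 2 * ((m + 1 : ℕ) : ℝ) - 2 * (m + τ) = 2 - 2 * τ by push_cast; ring]
    refine exists_integral_norm_zetaR_sq_bounds ha ha1 m (by linarith) (by linarith)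
      (fun K => ?_) (exists_integral_norm_hzeta_sq_bounds_lt_half ha ha1 (by linarith)
        (by linarith))
    have h3 : 0 < 1 - 2 * τ := by linarith
    filter_upwards [(tendsto_rpow_atTop h3).eventually_ge_atTop K, eventually_gt_atTop 0]
      with T h4 h5
    rw [show 2 - 2 * τ = (1 - 2 * τ) + 1 by ring, Real.rpow_add_one h5.ne']
    exact mul_le_mul_of_nonneg_right h4 h5.le
end

section
/- Let 0 < a ≤ 1. Then ζ_H(1+it, a) ≪ log t for all t ≥ 2, where ζ_H(1+it, a) denotes the value of the analytically continued Hurwitz zeta function and the implied constant depends only on a. -/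
open Complex Filter Finset MeasureTheory

theorem norm_cpow_neg_sub_integral_le {y : ℝ} (hy : 1 ≤ y) {s : ℂ} (hs : 1 ≤ s.re) (hs1 : s ≠ 1) :
    ‖(y : ℂ) ^ (-s) - (((y + 1 : ℝ) : ℂ) ^ (-s + 1) / (-s + 1) - (y : ℂ) ^ (-s + 1) / (-s + 1))‖
      ≤ ‖s‖ / y ^ 2 := by
  have hs0 : -s ≠ 0 := by
    rintro h
    rw [neg_eq_zero] at h
    norm_num [h] at hs
  have hsub : ∀ x ∈ Set.Icc y (y + 1), ‖(x : ℂ) ^ (-s) - (y : ℂ) ^ (-s)‖ ≤ ‖s‖ / y ^ 2 := by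
    intro x hx
    have hderiv := norm_image_sub_le_of_norm_deriv_le_segment' (a := y) (b := y + 1)
      (f := fun u : ℝ => (u : ℂ) ^ (-s)) (f' := fun u : ℝ => -s * (u : ℂ) ^ (-s - 1))
      (C := ‖s‖ / y ^ 2)
      (fun u hu => (hasDerivAt_ofReal_cpow_const (by linarith [hu.1]) hs0).hasDerivWithinAt)
      (fun u hu => by
        have hu0 : 0 < u := by linarith [hu.1]
        rw [norm_mul, norm_neg, norm_cpow_eq_rpow_re_of_pos hu0, div_eq_mul_inv]
        gcongr
        calc u ^ (-s - 1).re ≤ u ^ (-2 : ℝ) := by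
              apply Real.rpow_le_rpow_of_exponent_le (by linarith [hu.1])
              simp only [sub_re, neg_re, one_re]
              linarith
          _ = (u ^ 2)⁻¹ := by
              rw [Real.rpow_neg hu0.le]
              norm_num
          _ ≤ (y ^ 2)⁻¹ := by
              have := hu.1
              gcongr) x hx
    exact hderiv.trans (mul_le_of_le_one_right (by positivity) (by linarith [hx.2]))
  have hmean := norm_image_sub_le_of_norm_deriv_le_segment' (a := y) (b := y + 1)
    (f := fun u : ℝ => (u : ℂ) ^ (-s + 1) / (-s + 1) - (u : ℂ) * (y : ℂ) ^ (-s))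
    (f' := fun u : ℝ => (u : ℂ) ^ (-s) - 1 * (y : ℂ) ^ (-s)) (C := ‖s‖ / y ^ 2)
    (fun u hu => ((hasDerivAt_ofReal_cpow_const' (by linarith [hu.1]) (by simpa using hs1)).sub
      ((hasDerivAt_id u).ofReal_comp.mul_const _)).hasDerivWithinAt)
    (fun u hu => by simpa using hsub u ⟨hu.1, hu.2.le⟩) (y + 1) ⟨by linarith, le_rfl⟩
  rw [add_sub_cancel_left, mul_one] at hmean
  rw [norm_sub_rev]
  refine le_of_eq_of_le (congrArg norm ?_) hmean
  push_cast
  ring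

theorem norm_sum_cpow_neg_sub_integral_le {y : ℝ} (hy : 1 < y) {s : ℂ} (hs : 1 ≤ s.re)
    (hs1 : s ≠ 1) (k : ℕ) :
    ‖∑ i ∈ range k, ((y + i : ℝ) : ℂ) ^ (-s) -
      (((y + k : ℝ) : ℂ) ^ (-s + 1) / (-s + 1) - (y : ℂ) ^ (-s + 1) / (-s + 1))‖
      ≤ ‖s‖ * (1 / (y - 1) - 1 / (y + k - 1)) := by
  induction k with
  | zero => simp
  | succ k ih =>
    have hk : (0 : ℝ) ≤ k := k.cast_nonneg
    have hstep := norm_cpow_neg_sub_integral_le (y := y + k) (by linarith) hs hs1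
    have hsq : 1 / (y + k) ^ 2 ≤ 1 / (y + k - 1) - 1 / (y + k) := by
      have h1 : 0 < y + k - 1 := by linarith
      have h2 : 0 < y + k := by linarith
      rw [div_sub_div _ _ h1.ne' h2.ne', div_le_div_iff₀ (by positivity) (by positivity)]
      nlinarith
    have hadd := norm_add_le_of_le ih hstep
    rw [sum_range_succ]
    have hbound : ‖s‖ / (y + k) ^ 2 ≤ ‖s‖ * (1 / (y + k - 1) - 1 / (y + k)) := by
      rw [div_eq_mul_one_div]
      gcongr
    calc _ = _ := by
          congr 1
          push_cast
          ring_nf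
      _ ≤ _ := hadd
      _ ≤ _ := add_le_add_right hbound _
      _ = _ := by
          push_cast
          ring

theorem norm_sum_cpow_neg_le {y : ℝ} (hy : 1 < y) {s : ℂ} (hs : 1 ≤ s.re)
    (hs1 : s ≠ 1) (k : ℕ) :
    ‖∑ i ∈ range k, ((y + i : ℝ) : ℂ) ^ (-s)‖ ≤ ‖s‖ / (y - 1) + 2 / ‖s - 1‖ := by
  have hprim : ∀ x : ℝ, 1 ≤ x → ‖(x : ℂ) ^ (-s + 1) / (-s + 1)‖ ≤ 1 / ‖s - 1‖ := by
    intro x hx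
    rw [norm_div, norm_cpow_eq_rpow_re_of_pos (by linarith),
      show -s + 1 = -(s - 1) by ring, norm_neg]
    gcongr
    apply Real.rpow_le_one_of_one_le_of_nonpos hx
    simpa using hs
  have hk : (0 : ℝ) ≤ k := k.cast_nonneg
  have hdiff := norm_sum_cpow_neg_sub_integral_le hy hs hs1 k
  have hle : ‖s‖ * (1 / (y - 1) - 1 / (y + k - 1)) ≤ ‖s‖ / (y - 1) := by
    rw [div_eq_mul_one_div ‖s‖]
    gcongr
    have : 0 < y + k - 1 := by linarith
    have : 0 ≤ 1 / (y + k - 1) := by positivity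
    linarith
  calc _ ≤ _ + _ := norm_le_norm_sub_add _
          (((y + k : ℝ) : ℂ) ^ (-s + 1) / (-s + 1) - (y : ℂ) ^ (-s + 1) / (-s + 1))
    _ ≤ ‖s‖ / (y - 1) + (1 / ‖s - 1‖ + 1 / ‖s - 1‖) :=
        add_le_add (hdiff.trans hle)
          (norm_sub_le_of_le (hprim _ (by linarith)) (hprim _ hy.le))
    _ = _ := by ring

theorem norm_sum_range_succ_cpow_neg_le {a : ℝ} (ha : 0 < a) (ha1 : a ≤ 1) {s : ℂ}
    (hs : 1 ≤ s.re) (hs2 : s.re ≤ 2) (N : ℕ) :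
    ‖∑ m ∈ range (N + 1), ((m + a : ℝ) : ℂ) ^ (-s)‖ ≤ 1 + Real.log N + (a ^ 2)⁻¹ := by
  rw [sum_range_succ']
  refine norm_add_le_of_le ?_ ?_
  · refine le_trans ?_ (harmonic_le_one_add_log N)
    rw [harmonic, Rat.cast_sum]
    refine norm_sum_le_of_le _ fun m _ => ?_
    have hm : (0 : ℝ) ≤ m := m.cast_nonneg
    rw [norm_cpow_eq_rpow_re_of_pos (by positivity)]
    push_cast
    calc ((m : ℝ) + 1 + a) ^ (-s).re ≤ ((m : ℝ) + 1 + a) ^ (-1 : ℝ) := by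
          apply Real.rpow_le_rpow_of_exponent_le (by linarith)
          simpa using hs
      _ = ((m : ℝ) + 1 + a)⁻¹ := Real.rpow_neg_one _
      _ ≤ ((m : ℝ) + 1)⁻¹ := inv_anti₀ (by positivity) (by linarith)
  · rw [norm_cpow_eq_rpow_re_of_pos (by simpa using ha)]
    calc (((0 : ℕ) : ℝ) + a) ^ (-s).re ≤ a ^ (-2 : ℝ) := by
          rw [Nat.cast_zero, zero_add]
          apply Real.rpow_le_rpow_of_exponent_ge ha ha1
          simpa using hs2
      _ = (a ^ 2)⁻¹ := by
          rw [Real.rpow_neg ha.le]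
          norm_num

theorem norm_hzeta_le_of_one_lt_re {a : ℝ} (ha : 0 < a) (ha1 : a ≤ 1) {s : ℂ}
    (hs : 1 < s.re) (hs2 : s.re ≤ 2) (ht : 2 ≤ s.im) :
    ‖hzeta a s‖ ≤ (a ^ 2)⁻¹ + 4 + 2 * Real.log s.im := by
  have hs1 : s ≠ 1 := by
    rintro rfl
    simp at hs
  set N := ⌈s.im⌉₊
  have hN : s.im ≤ N := Nat.le_ceil _
  have hN' : (N : ℝ) < s.im + 1 := Nat.ceil_lt_add_one (by linarith)
  have hlog : Real.log N ≤ 2 * Real.log s.im := by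
    rw [← Real.log_rpow (by linarith)]
    apply Real.log_le_log (by linarith)
    rw [Real.rpow_two]
    nlinarith
  have hsum := HurwitzZeta.hasSum_hurwitzZeta_of_one_lt_re (a := a) ⟨ha.le, ha1⟩ hs
  have hlim := (tendsto_add_atTop_iff_nat (N + 1)).2 hsum.tendsto_sum_nat
  refine le_of_tendsto hlim.norm (Eventually.of_forall fun k => ?_)
  have hterm : ∀ m : ℕ, 1 / ((m : ℂ) + a) ^ s = ((m + a : ℝ) : ℂ) ^ (-s) := fun m => by
    rw [cpow_neg, one_div]
    push_cast
    rfl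
  simp only [hterm]
  rw [add_comm k, sum_range_add]
  have hhead := norm_sum_range_succ_cpow_neg_le ha ha1 hs.le hs2 N
  have htail := norm_sum_cpow_neg_le (y := N + 1 + a) (by linarith) hs.le hs1 k
  have hnorm : ‖s‖ ≤ 2 + s.im := by
    refine (norm_le_abs_re_add_abs_im s).trans ?_
    rw [abs_of_nonneg (by linarith), abs_of_nonneg (by linarith)]
    linarith
  have hnorm' : s.im ≤ ‖s - 1‖ := by
    simpa using (le_abs_self _).trans (abs_im_le_norm (s - 1))
  have hfst : ‖s‖ / (N + 1 + a - 1) ≤ 2 := by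
    rw [div_le_iff₀ (by linarith)]
    linarith
  have hsnd : 2 / ‖s - 1‖ ≤ 1 := by
    rw [div_le_one (by linarith)]
    linarith
  have heq : ∑ x ∈ range k, (((N + 1 + x : ℕ) + a : ℝ) : ℂ) ^ (-s) =
      ∑ i ∈ range k, ((N + 1 + a + i : ℝ) : ℂ) ^ (-s) := by
    refine sum_congr rfl fun i _ => ?_
    push_cast
    ring_nf
  rw [heq]
  refine (norm_add_le_of_le hhead htail).trans ?_
  linarith

theorem stmt16 (a : ℝ) (ha : 0 < a) (ha1 : a ≤ 1) :
    ∃ C > (0 : ℝ), ∀ t : ℝ, 2 ≤ t → ‖hzeta a (1 + t * I)‖ ≤ C * Real.log t := by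
  have hlog2 : 0 < Real.log 2 := Real.log_pos one_lt_two
  refine ⟨((a ^ 2)⁻¹ + 4) / Real.log 2 + 2, by positivity, fun t ht => ?_⟩
  have hne : (1 + t * I : ℂ) ≠ 1 := fun h => by
    have := congrArg im h
    simp at this
    linarith
  have hcont : Tendsto (fun σ : ℝ => ‖hzeta a (σ + t * I)‖) (nhdsWithin 1 (Set.Ioi 1))
      (nhds ‖hzeta a (1 + t * I)‖) := by
    have hζ : ContinuousAt (hzeta a) (((1 : ℝ) : ℂ) + t * I) :=
      (HurwitzZeta.differentiableAt_hurwitzZeta a (by simpa using hne)).continuousAt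
    have hpath : ContinuousAt (fun σ : ℝ => (σ : ℂ) + t * I) 1 := by fun_prop
    simpa using ((hζ.comp_of_eq hpath rfl).norm.tendsto).mono_left nhdsWithin_le_nhds
  have hbound : ‖hzeta a (1 + t * I)‖ ≤ (a ^ 2)⁻¹ + 4 + 2 * Real.log t := by
    refine le_of_tendsto hcont ?_
    filter_upwards [Ioc_mem_nhdsGT one_lt_two] with σ hσ
    simpa using norm_hzeta_le_of_one_lt_re ha ha1 (s := σ + t * I) (by simpa using hσ.1)
      (by simpa using hσ.2) (by simpa using ht)
  have hmul : (a ^ 2)⁻¹ + 4 ≤ ((a ^ 2)⁻¹ + 4) / Real.log 2 * Real.log t := by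
    rw [div_mul_eq_mul_div, le_div_iff₀ hlog2]
    gcongr
  linarith
end
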